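/- Suppose c_0 ≠ 1 and the structural conditions (C1)–(C5) hold. Then there is a constant C > 0 such that every smooth local solution u = (u_1,u_2,u_3) of the Cauchy problem on (0,T)×ℝ³, compactly supported in x for each fixed t, satisfies for all t ∈ (0,T): (⟨t⟩^{−δ}N_3(u_1(t);1))² + N_3(u_2(t);1)² + N_3(u_3(t);c_0)² ≤ C Σ_{k=1}^3 N_3(u_k(0);c_k)² + C ⟨⟨u⟩⟩_T (sup_{0<t<T} ⟨t⟩^{−δ}𝒩_4(u(t)) + sup_{0<t<T} ⟨t⟩^{−δ}ℳ_4(u(t))) · sup_{0<t<T} 𝒩_3(u(t)) + C ⟨⟨u⟩⟩_T² (sup_{0<t<T} 𝒩_3(u(t)))². -/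

import Mathlib

open MeasureTheory Real Set

noncomputable section

namespace MultiSpeedWave

/-- Physical space `ℝ³` with the Euclidean norm. -/
abbrev Sp : Type := EuclideanSpace ℝ (Fin 3)

/-- A space-time point `(t, x)`. -/
abbrev Pt : Type := ℝ × Sp

/-- A scalar field on space-time. -/
abbrev Fn : Type := Pt → ℝ

/-- Time derivative `∂_t`. -/
def pt (v : Fn) : Fn := fun p => fderiv ℝ v p (1, 0)

/-- Spatial derivative `∂_j`. -/
def px (j : Fin 3) (v : Fn) : Fn := fun p => fderiv ℝ v p (0, EuclideanSpace.single j 1)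

/-- Space-time derivative `∂_α` (`α = 0` is time). -/
def pd (α : Fin 4) : Fn → Fn := Fin.cases pt px α

/-- Rotation `Ω_{ij} = x_i ∂_j − x_j ∂_i` (0-based indices). -/
def om (i j : Fin 3) (v : Fn) : Fn := fun p => p.2 i * px j v p - p.2 j * px i v p

/-- Scaling vector field `S = t ∂_t + x·∇`. -/
def sOp (v : Fn) : Fn := fun p => p.1 * pt v p + ∑ j : Fin 3, p.2 j * px j v p

/-- The seven generators `Z_1,…,Z_7 = ∂_1,∂_2,∂_3,Ω_{12},Ω_{23},Ω_{13},S`. -/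
def Zop : Fin 7 → Fn → Fn := ![px 0, px 1, px 2, om 0 1, om 1 2, om 0 2, sOp]

/-- `Z^a` for a multi-index `a`. -/
def Zmulti (a : Fin 7 → ℕ) (v : Fn) : Fn :=
  (List.finRange 7).foldr (fun i w => (Zop i)^[a i] w) v

/-- `∂_x^a` for a spatial multi-index `a`, acting on space-time functions. -/
def pxMulti (a : Fin 3 → ℕ) (v : Fn) : Fn :=
  (List.finRange 3).foldr (fun i w => (px i)^[a i] w) v

/-- `Ω^b = Ω_{12}^{b₁} Ω_{23}^{b₂} Ω_{13}^{b₃}`. -/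
def omMulti (b : Fin 3 → ℕ) (v : Fn) : Fn :=
  (om 0 1)^[b 0] ((om 1 2)^[b 1] ((om 0 2)^[b 2] v))

/-- All multi-indices of length `n` and total degree `≤ m`. -/
def idxSet (n m : ℕ) : Finset (Fin n → ℕ) :=
  (Fintype.piFinset fun _ => Finset.range (m+1)).filter fun a => ∑ i, a i ≤ m

/-- The Japanese bracket `⟨ρ⟩ = (1+ρ²)^{1/2}`. -/
def jb (ρ : ℝ) : ℝ := Real.sqrt (1 + ρ^2)

/-- The d'Alembertian `□_c = ∂_t² − c²Δ`. -/
def boxOp (c : ℝ) (v : Fn) : Fn :=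
  fun p => pt (pt v) p - c^2 * ∑ j : Fin 3, px j (px j v) p

/-- Energy `E(v(t);c)`. -/
def energy (c : ℝ) (v : Fn) (t : ℝ) : ℝ :=
  (1/2) * ∫ x : Sp, ((pt v (t,x))^2 + c^2 * ∑ j : Fin 3, (px j v (t,x))^2)

/-- Generalized energy `N_κ(v(t);c)`. -/
def Nnorm (κ : ℕ) (c : ℝ) (v : Fn) (t : ℝ) : ℝ :=
  Real.sqrt (∑ a ∈ idxSet 7 (κ-1), energy c (Zmulti a v) t)

/-- `L²(ℝ³)` norm. -/
def L2 (f : Sp → ℝ) : ℝ := Real.sqrt (∫ x : Sp, (f x)^2)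

/-- The auxiliary norm `M₂(v(t);c)`. -/
def M2 (c : ℝ) (v : Fn) (t : ℝ) : ℝ :=
  ∑ α : Fin 4, ∑ j : Fin 3, L2 (fun x => jb (c*t - ‖x‖) * pd α (px j v) (t,x))

/-- The auxiliary norm `M_μ(v(t);c)`. -/
def Mmu (μ : ℕ) (c : ℝ) (v : Fn) (t : ℝ) : ℝ :=
  ∑ a ∈ idxSet 7 (μ-2), M2 c (Zmulti a v) t

/-- The good derivative `T_j^{(c)} = c ∂_j + (x_j/|x|) ∂_t`. -/
def Tder (c : ℝ) (j : Fin 3) (v : Fn) : Fn :=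
  fun p => c * px j v p + (p.2 j / ‖p.2‖) * pt v p

/-- `|T^{(c)} v|`. -/
def Tnorm (c : ℝ) (v : Fn) (p : Pt) : ℝ := Real.sqrt (∑ j : Fin 3, (Tder c j v p)^2)

/-- `|∂v|` (full space-time gradient). -/
def pdNorm (v : Fn) (p : Pt) : ℝ := Real.sqrt (∑ α : Fin 4, (pd α v p)^2)

/-- `|∂_x v|` (spatial gradient). -/
def pxNorm (v : Fn) (p : Pt) : ℝ := Real.sqrt (∑ j : Fin 3, (px j v p)^2)

/-- `L^∞(ℝ³)` norm. -/
def Linf (f : Sp → ℝ) : ℝ := ⨆ x : Sp, |f x|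

/-- `L⁶(ℝ³)` norm. -/
def L6 (f : Sp → ℝ) : ℝ := (∫ x : Sp, |f x|^6) ^ ((1:ℝ)/6)

/-- The unit sphere `S²`. -/
abbrev S2 := Metric.sphere (0 : Sp) 1

/-- Surface measure on the unit sphere. -/
def sphMeas : Measure S2 := (volume : Measure Sp).toSphere

/-- `‖f(r·)‖_{L⁴(S²)}`. -/
def L4sph (f : Sp → ℝ) (r : ℝ) : ℝ :=
  (∫ ω : S2, |f (r • (ω : Sp))|^4 ∂sphMeas) ^ ((1:ℝ)/4)

/-- Mixed norm `‖f‖_{L_r^∞ L_ω^4}`. -/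
def LinfrL4 (f : Sp → ℝ) : ℝ := ⨆ r : Set.Ioi (0:ℝ), L4sph f (r : ℝ)

/-- Spatial derivative for functions of `x` only. -/
def dxj (j : Fin 3) (f : Sp → ℝ) : Sp → ℝ := fun x => fderiv ℝ f x (EuclideanSpace.single j 1)

/-- `∂_x^a` for functions of `x` only. -/
def dxMulti (a : Fin 3 → ℕ) (f : Sp → ℝ) : Sp → ℝ :=
  (List.finRange 3).foldr (fun i w => (dxj i)^[a i] w) f

/-- The null condition for coefficients `{H^{αβ}}` relative to the cone `𝒩^{(c)}`. -/
def nullCond (c : ℝ) (H : Fin 4 → Fin 4 → ℝ) : Prop :=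
  ∀ X : Fin 4 → ℝ, (X 0)^2 = c^2 * ((X 1)^2 + (X 2)^2 + (X 3)^2) →
    ∑ α : Fin 4, ∑ β : Fin 4, H α β * X α * X β = 0

/-- The quadratic form `H^{αβ}(∂_α v)(∂_β w)`. -/
def nullQ (H : Fin 4 → Fin 4 → ℝ) (v w : Fn) : Fn :=
  fun p => ∑ α : Fin 4, ∑ β : Fin 4, H α β * pd α v p * pd β w p

/-- Coefficients `F_i^{jk,αβ}` of the quadratic part. -/
abbrev Coef := Fin 3 → Fin 3 → Fin 3 → Fin 4 → Fin 4 → ℝ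

/-- The speeds `c₁ = c₂ = 1`, `c₃ = c₀`. -/
def cspeed (c0 : ℝ) : Fin 3 → ℝ := ![1, 1, c0]

/-- Evaluation of a cubic remainder at the gradients of `u`. -/
def cubicEval (P : MvPolynomial (Fin 3 × Fin 4) ℝ) (u : Fin 3 → Fn) : Fn :=
  fun p => MvPolynomial.eval (fun q => pd q.2 (u q.1) p) P

/-- Every monomial has degree at least 3. -/
def CubicLike (P : MvPolynomial (Fin 3 × Fin 4) ℝ) : Prop :=
  ∀ m ∈ P.support, 3 ≤ m.sum fun _ e => e

/-- The right-hand side `F_i(∂u)`. -/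
def rhs (F : Coef) (Cub : Fin 3 → MvPolynomial (Fin 3 × Fin 4) ℝ)
    (u : Fin 3 → Fn) (i : Fin 3) : Fn :=
  fun p => (∑ j : Fin 3, ∑ k : Fin 3, ∑ α : Fin 4, ∑ β : Fin 4,
      F i j k α β * pd α (u j) p * pd β (u k) p) + cubicEval (Cub i) u p

/-- `u` solves the system for times in `s`. -/
def IsSolutionOn (c0 : ℝ) (F : Coef) (Cub : Fin 3 → MvPolynomial (Fin 3 × Fin 4) ℝ)
    (u : Fin 3 → Fn) (s : Set ℝ) : Prop :=
  ∀ i : Fin 3, ∀ t ∈ s, ∀ x : Sp, boxOp (cspeed c0 i) (u i) (t,x) = rhs F Cub u i (t,x)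

/-- `F_i^{jk} = 0` for `j > k`. -/
def LowerTri (F : Coef) : Prop :=
  ∀ (i j k : Fin 3), (k : ℕ) < (j : ℕ) → ∀ (α β : Fin 4), F i j k α β = 0

/-- Structural condition (C1). -/
def CondC1 (F : Coef) : Prop := nullCond 1 (F 0 0 0)

/-- Structural condition (C2). -/
def CondC2 (F : Coef) : Prop :=
  nullCond 1 (F 1 0 0) ∧ nullCond 1 (F 1 0 1) ∧ nullCond 1 (F 1 1 1)

/-- Structural condition (C3). -/
def CondC3 (c0 : ℝ) (F : Coef) : Prop := nullCond c0 (F 2 2 2)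

/-- Structural condition (C4). -/
def CondC4 (F : Coef) : Prop := ∀ (α β : Fin 4), F 1 0 2 α β = 0

/-- Structural condition (C5). -/
def CondC5 (F : Coef) : Prop := ∀ (α β : Fin 4), F 2 0 2 α β = 0

/-- Structural condition (C6). -/
def CondC6 (F : Coef) : Prop := nullCond 1 (F 2 0 0) ∧ nullCond 1 (F 2 0 1)

/-- The data norm `‖(f,g)‖_D`. -/
def dataNorm (f g : Fin 3 → Sp → ℝ) : ℝ :=
  ∑ i : Fin 3,
    ((∑ a ∈ (idxSet 3 4).filter (fun a => 1 ≤ ∑ j, a j),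
        L2 (fun x => jb ‖x‖ ^ ((∑ j, a j) - 1) * dxMulti a (f i) x))
      + ∑ a ∈ idxSet 3 3, L2 (fun x => jb ‖x‖ ^ (∑ j, a j) * dxMulti a (g i) x))

/-- The weights `σ₁ = δ`, `σ₂ = σ₃ = 0`. -/
def sig (δ : ℝ) : Fin 3 → ℝ := ![δ, 0, 0]

/-- Weighted `L^∞` norm of a gradient. -/
def wInf (w : Sp → ℝ) (v : Fn) (t : ℝ) : ℝ := Linf fun x => w x * pdNorm v (t,x)

/-- Weighted `L_r^∞ L_ω^4` norm of a gradient. -/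
def wL4 (w : Sp → ℝ) (v : Fn) (t : ℝ) : ℝ := LinfrL4 fun x => w x * pdNorm v (t,x)

/-- Weighted `L⁶` norm of a gradient. -/
def wL6 (w : Sp → ℝ) (v : Fn) (t : ℝ) : ℝ := L6 fun x => w x * pdNorm v (t,x)

/-- The collection of weighted pointwise norms `⟨⟨u(t)⟩⟩`. -/
def bigBracket (c0 δ : ℝ) (u : Fin 3 → Fn) (t : ℝ) : ℝ :=
  (∑ i : Fin 3, jb t ^ (-(sig δ i)) *
     wInf (fun x => ‖x‖ * Real.sqrt (jb (cspeed c0 i * t - ‖x‖))) (u i) t)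
  + (∑ i : Fin 3, ∑ a ∈ idxSet 7 1, jb t ^ (-(sig δ i) - δ) *
     wInf (fun x => ‖x‖ * Real.sqrt (jb (cspeed c0 i * t - ‖x‖))) (Zmulti a (u i)) t)
  + (∑ i : Fin 3, ∑ a ∈ idxSet 7 1, jb t ^ (-(sig δ i)) *
     (wL4 (fun x => Real.sqrt ‖x‖ * jb (cspeed c0 i * t - ‖x‖)) (Zmulti a (u i)) t
      + ∑ j : Fin 7, LinfrL4 fun x => Real.sqrt ‖x‖ * Zop j (Zmulti a (u i)) (t,x)))
  + (∑ i : Fin 3, ∑ a ∈ idxSet 7 2, jb t ^ (-(sig δ i) - δ) *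
     (wL4 (fun x => Real.sqrt ‖x‖ * jb (cspeed c0 i * t - ‖x‖)) (Zmulti a (u i)) t
      + ∑ j : Fin 7, LinfrL4 fun x => Real.sqrt ‖x‖ * Zop j (Zmulti a (u i)) (t,x)))
  + (∑ i : Fin 3, ∑ a ∈ idxSet 7 1, jb t ^ (-(sig δ i)) *
     wL4 (fun x => ‖x‖) (Zmulti a (u i)) t)
  + (∑ i : Fin 3, jb t ^ (-(sig δ i)) *
     wInf (fun x => jb (cspeed c0 i * t - ‖x‖)) (u i) t)
  + (jb t ^ (-δ) * ∑ i : Fin 3, ∑ a ∈ idxSet 7 1, jb t ^ (-(sig δ i)) *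
     wInf (fun x => jb (cspeed c0 i * t - ‖x‖)) (Zmulti a (u i)) t)
  + (∑ i : Fin 3, ∑ a ∈ idxSet 7 1, jb t ^ (-(sig δ i)) *
     wL6 (fun x => jb (cspeed c0 i * t - ‖x‖)) (Zmulti a (u i)) t)

/-- `⟨⟨u⟩⟩_T = sup_{0<t<T} ⟨⟨u(t)⟩⟩`. -/
def bigBracketSup (c0 δ T : ℝ) (u : Fin 3 → Fn) : ℝ :=
  ⨆ t : Set.Ioo (0:ℝ) T, bigBracket c0 δ u t

/-- `sup_{0<t<T} f(t)`. -/
def supIoo (T : ℝ) (f : ℝ → ℝ) : ℝ := ⨆ t : Set.Ioo (0:ℝ) T, f t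

/-- `𝒩_κ(u(t))`. -/
def calN (c0 δ : ℝ) (κ : ℕ) (u : Fin 3 → Fn) (t : ℝ) : ℝ :=
  jb t ^ (-δ) * Nnorm κ 1 (u 0) t + Nnorm κ 1 (u 1) t + Nnorm κ c0 (u 2) t

/-- `ℳ_κ(u(t))`. -/
def calM (c0 δ : ℝ) (κ : ℕ) (u : Fin 3 → Fn) (t : ℝ) : ℝ :=
  jb t ^ (-δ) * Mmu κ 1 (u 0) t + Mmu κ 1 (u 1) t + Mmu κ c0 (u 2) t

/-- The ghost-weight quantity `G(v(t);c)` (with parameter `η`). -/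
def Gnorm (η c : ℝ) (v : Fn) (t : ℝ) : ℝ :=
  Real.sqrt (∑ a ∈ idxSet 7 3, ∑ j : Fin 3,
    ∫ x : Sp, jb (c*t - ‖x‖) ^ (-1 - 2*η) * (Tder c j (Zmulti a v) (t,x))^2)

/-- The Keel–Smith–Sogge type local-energy norm `L(v(t))`. -/
def Lnorm (v : Fn) (t : ℝ) : ℝ :=
  Real.sqrt (∑ a ∈ idxSet 7 3,
    ((∫ x : Sp, (‖x‖ ^ (-(5:ℝ)/4) * Zmulti a v (t,x))^2) +
     ∑ α : Fin 4, ∫ x : Sp, (‖x‖ ^ (-(1:ℝ)/4) * pd α (Zmulti a v) (t,x))^2))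

/-- A smooth local solution on `(0,T)×ℝ³`, compactly supported in `x`. -/
def LocalSolution (c0 : ℝ) (F : Coef) (Cub : Fin 3 → MvPolynomial (Fin 3 × Fin 4) ℝ)
    (T : ℝ) (u : Fin 3 → Fn) : Prop :=
  (∀ i, ContDiff ℝ (⊤ : ℕ∞) (u i)) ∧
  (∀ i t, HasCompactSupport fun x => u i (t, x)) ∧
  IsSolutionOn c0 F Cub u (Set.Ioo 0 T)

/-- A global solution of the Cauchy problem with data `(f,g)`. -/
def IsGlobalSolution (c0 : ℝ) (F : Coef) (Cub : Fin 3 → MvPolynomial (Fin 3 × Fin 4) ℝ)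
    (f g : Fin 3 → Sp → ℝ) (u : Fin 3 → Fn) : Prop :=
  (∀ i, ContDiff ℝ (⊤ : ℕ∞) (u i)) ∧
  IsSolutionOn c0 F Cub u (Set.Ioi 0) ∧
  (∀ i x, u i (0, x) = f i x ∧ pt (u i) (0, x) = g i x)

end MultiSpeedWave
namespace MultiSpeedWave

/-- Smooth fields on space-time. -/
abbrev Sm (v : Fn) : Prop := ContDiff ℝ (⊤ : ℕ∞) v

/-- The standard basis of space-time. -/
def eb : Fin 4 → Pt := Fin.cases (1, 0) (fun j => (0, EuclideanSpace.single j 1))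

/-- The coordinate functionals of space-time. -/
def co : Fin 4 → Pt →L[ℝ] ℝ :=
  Fin.cases (ContinuousLinearMap.fst ℝ ℝ Sp)
    (fun j => (EuclideanSpace.proj j).comp (ContinuousLinearMap.snd ℝ ℝ Sp))

lemma co_zero (p : Pt) : co 0 p = p.1 := rfl
lemma co_succ (j : Fin 3) (p : Pt) : co j.succ p = p.2 j := rfl
lemma co_one (p : Pt) : co 1 p = p.2 0 := rfl
lemma co_two (p : Pt) : co 2 p = p.2 1 := rfl
lemma co_three (p : Pt) : co 3 p = p.2 2 := rfl

lemma co_eb (α β : Fin 4) : co α (eb β) = if α = β then 1 else 0 := by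
  fin_cases α <;> fin_cases β <;> simp [co, eb, Fin.cases, Fin.induction, Fin.induction.go]

lemma pd_eq (α : Fin 4) (v : Fn) (p : Pt) : pd α v p = fderiv ℝ v p (eb α) := by
  refine Fin.cases ?_ (fun j => ?_) α <;> rfl

lemma pd_zero (v : Fn) : pd 0 v = pt v := rfl
lemma pd_succ (j : Fin 3) (v : Fn) : pd j.succ v = px j v := rfl

lemma Sm.diff {v : Fn} (h : Sm v) : Differentiable ℝ v := h.differentiable (by simp)

lemma Sm.pd {v : Fn} (h : Sm v) (α : Fin 4) : Sm (pd α v) := by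
  have : MultiSpeedWave.pd α v = fun p => fderiv ℝ v p (eb α) := by
    funext p; exact pd_eq α v p
  rw [this]
  exact (h.fderiv_right (m := (⊤ : ℕ∞)) (by simp)).clm_apply contDiff_const

lemma Sm.px {v : Fn} (h : Sm v) (j : Fin 3) : Sm (px j v) := h.pd j.succ
lemma Sm.pt {v : Fn} (h : Sm v) : Sm (pt v) := h.pd 0

lemma pd_add {v w : Fn} (hv : Sm v) (hw : Sm w) (α : Fin 4) :
    pd α (v + w) = pd α v + pd α w := by
  funext p
  simp only [pd_eq, Pi.add_apply]
  rw [fderiv_add (hv.diff p) (hw.diff p)]; rfl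

lemma pd_smul {v : Fn} (hv : Sm v) (c : ℝ) (α : Fin 4) :
    pd α (c • v) = c • pd α v := by
  funext p
  simp only [pd_eq, Pi.smul_apply]
  rw [fderiv_const_smul (hv.diff p)]; rfl

lemma pd_sum {ι : Type*} (s : Finset ι) {v : ι → Fn} (hv : ∀ i, Sm (v i)) (α : Fin 4) :
    pd α (∑ i ∈ s, v i) = ∑ i ∈ s, pd α (v i) := by
  funext p
  simp only [pd_eq, Finset.sum_apply]
  rw [fderiv_sum (fun i _ => (hv i).diff p)]
  simp

lemma pd_mul {v w : Fn} (hv : Sm v) (hw : Sm w) (α : Fin 4) :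
    pd α (v * w) = pd α v * w + v * pd α w := by
  funext p
  simp only [pd_eq, Pi.add_apply, Pi.mul_apply]
  rw [fderiv_mul (hv.diff p) (hw.diff p)]
  simp; ring

lemma pd_const (c : ℝ) (α : Fin 4) : pd α (fun _ => c) = fun _ => 0 := by
  funext p
  rw [pd_eq]
  simp

lemma pd_comm {v : Fn} (hv : Sm v) (α β : Fin 4) : pd α (pd β v) = pd β (pd α v) := by
  have key : ∀ (γ δ : Fin 4) (p : Pt),
      pd γ (pd δ v) p = fderiv ℝ (fderiv ℝ v) p (eb γ) (eb δ) := by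
    intro γ δ p
    have h1 : pd δ v = fun p => fderiv ℝ v p (eb δ) := by funext p; exact pd_eq δ v p
    have h2 : DifferentiableAt ℝ (fderiv ℝ v) p :=
      ((hv.fderiv_right (m := (⊤ : ℕ∞)) (by simp)).differentiable (by simp)) p
    rw [pd_eq, h1]
    rw [fderiv_clm_apply h2 (differentiableAt_const _)]
    simp
  funext p
  rw [key, key]
  have : IsSymmSndFDerivAt ℝ v p := by
    refine (hv.contDiffAt).isSymmSndFDerivAt ?_
    simp only [minSmoothness_of_isRCLikeNormedField]
    exact WithTop.coe_le_coe.2 le_top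
  exact this _ _

/-- Linear parts of the generators. -/
def kk : Fin 7 → Fin 4 → Fin 4 → ℝ :=
  ![0, 0, 0,
    ![0, ![0, 0, 1, 0], ![0, -1, 0, 0], 0],
    ![0, 0, ![0, 0, 0, 1], ![0, 0, -1, 0]],
    ![0, ![0, 0, 0, 1], 0, ![0, -1, 0, 0]],
    ![![1, 0, 0, 0], ![0, 1, 0, 0], ![0, 0, 1, 0], ![0, 0, 0, 1]]]

/-- Constant parts of the generators. -/
def bb : Fin 7 → Fin 4 → ℝ :=
  ![![0, 1, 0, 0], ![0, 0, 1, 0], ![0, 0, 0, 1], 0, 0, 0, 0]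

/-- Coefficients of the generators. -/
def xi (i : Fin 7) (β : Fin 4) : Fn := fun p => ∑ α : Fin 4, kk i α β * co α p + bb i β

lemma Zop_eq (i : Fin 7) (v : Fn) : Zop i v = ∑ β : Fin 4, xi i β * pd β v := by
  funext p
  have h1 : pd 1 v = px 0 v := rfl
  have h2 : pd 2 v = px 1 v := rfl
  have h3 : pd 3 v = px 2 v := rfl
  fin_cases i <;>
    simp [Zop, xi, Fin.sum_univ_four, Fin.sum_univ_three, pd_zero, h1, h2, h3, kk, bb, om, sOp,
      co_zero, co_one, co_two, co_three] <;> ring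

lemma xi_sm (i : Fin 7) (β : Fin 4) : Sm (xi i β) := by
  unfold xi
  refine ContDiff.add (ContDiff.sum fun α _ => ?_) contDiff_const
  exact contDiff_const.mul (co α).contDiff

lemma pd_xi (i : Fin 7) (β γ : Fin 4) : pd γ (xi i β) = fun _ => kk i γ β := by
  have : xi i β = ∑ α : Fin 4, (fun p => kk i α β * co α p) + fun _ => bb i β := by
    funext p; simp [xi]
  funext p
  rw [this, pd_eq]
  have hd : ∀ α : Fin 4, DifferentiableAt ℝ (fun p : Pt => kk i α β * co α p) p := fun α =>
    ((co α).differentiableAt).const_mul _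
  rw [fderiv_add (DifferentiableAt.sum fun α _ => hd α) (differentiableAt_const _),
    fderiv_sum (fun α _ => hd α)]
  simp only [add_apply, sum_apply]
  have : ∀ α : Fin 4, (fderiv ℝ (fun p : Pt => kk i α β * co α p) p) (eb γ)
      = kk i α β * (if α = γ then 1 else 0) := by
    intro α
    rw [fderiv_const_mul ((co α).differentiableAt)]
    simp [co_eb]
  simp [this]

lemma Sm.zop {v : Fn} (h : Sm v) (i : Fin 7) : Sm (Zop i v) := by
  rw [Zop_eq]
  have : ∑ β : Fin 4, xi i β * MultiSpeedWave.pd β v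
      = fun p => ∑ β : Fin 4, xi i β p * MultiSpeedWave.pd β v p := by
    funext p; simp
  rw [this]
  exact ContDiff.sum fun β _ => (xi_sm i β).mul (h.pd β)

lemma Zop_add {v w : Fn} (hv : Sm v) (hw : Sm w) (i : Fin 7) :
    Zop i (v + w) = Zop i v + Zop i w := by
  simp only [Zop_eq, pd_add hv hw, mul_add, Finset.sum_add_distrib]

lemma Zop_smul {v : Fn} (hv : Sm v) (c : ℝ) (i : Fin 7) :
    Zop i (c • v) = c • Zop i v := by
  simp only [Zop_eq, pd_smul hv, Finset.smul_sum, mul_smul_comm]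

lemma Zop_zero (i : Fin 7) : Zop i 0 = 0 := by
  have := Zop_smul (v := 0) contDiff_const 0 i
  simpa using this

lemma Zop_mul {v w : Fn} (hv : Sm v) (hw : Sm w) (i : Fin 7) :
    Zop i (v * w) = Zop i v * w + v * Zop i w := by
  simp only [Zop_eq, pd_mul hv hw, Finset.sum_mul, Finset.mul_sum, ← Finset.sum_add_distrib]
  refine Finset.sum_congr rfl fun β _ => ?_
  ring

lemma Sm.add' {v w : Fn} (hv : Sm v) (hw : Sm w) : Sm (v + w) := ContDiff.add hv hw
lemma Sm.mul' {v w : Fn} (hv : Sm v) (hw : Sm w) : Sm (v * w) := ContDiff.mul hv hw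
lemma Sm.smul' {v : Fn} (hv : Sm v) (c : ℝ) : Sm (c • v) := hv.const_smul c
lemma Sm.sum' {ι : Type*} (s : Finset ι) {v : ι → Fn} (hv : ∀ i, Sm (v i)) :
    Sm (∑ i ∈ s, v i) := by
  have : (∑ i ∈ s, v i) = fun p => ∑ i ∈ s, v i p := by funext p; simp
  rw [this]
  exact ContDiff.sum fun i _ => hv i

/-- Commuting a coordinate derivative with a generator. -/
lemma pd_Zop {v : Fn} (hv : Sm v) (α : Fin 4) (i : Fin 7) :
    pd α (Zop i v) = Zop i (pd α v) + ∑ β : Fin 4, kk i α β • pd β v := by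
  rw [Zop_eq, Zop_eq, pd_sum _ (fun β => (xi_sm i β).mul' (hv.pd β)), ← Finset.sum_add_distrib]
  refine Finset.sum_congr rfl fun β _ => ?_
  rw [pd_mul (xi_sm i β) (hv.pd β), pd_xi, pd_comm hv α β]
  funext p
  simp; ring

/-- Structure constants of the generators. -/
def sc (i j m : Fin 7) : ℝ :=
  (![
    ![0, 0, 0, ![0,1,0,0,0,0,0], 0, ![0,0,1,0,0,0,0], ![1,0,0,0,0,0,0]],
    ![0, 0, 0, ![-1,0,0,0,0,0,0], ![0,0,1,0,0,0,0], 0, ![0,1,0,0,0,0,0]],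
    ![0, 0, 0, 0, ![0,-1,0,0,0,0,0], ![-1,0,0,0,0,0,0], ![0,0,1,0,0,0,0]],
    ![![0,-1,0,0,0,0,0], ![1,0,0,0,0,0,0], 0, 0, ![0,0,0,0,0,1,0], ![0,0,0,0,-1,0,0], 0],
    ![0, ![0,0,-1,0,0,0,0], ![0,1,0,0,0,0,0], ![0,0,0,0,0,-1,0], 0, ![0,0,0,1,0,0,0], 0],
    ![![0,0,-1,0,0,0,0], 0, ![1,0,0,0,0,0,0], ![0,0,0,0,1,0,0], ![0,0,0,-1,0,0,0], 0, 0],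
    ![![-1,0,0,0,0,0,0], ![0,-1,0,0,0,0,0], ![0,0,-1,0,0,0,0], 0, 0, 0, 0]
  ] : Fin 7 → Fin 7 → Fin 7 → ℝ) i j m

set_option maxHeartbeats 4000000 in
lemma xi_bracket (i j : Fin 7) (β : Fin 4) (p : Pt) :
    ∑ γ : Fin 4, (xi i γ p * kk j γ β - xi j γ p * kk i γ β) = ∑ m : Fin 7, sc i j m * xi m β p := by
  fin_cases i <;> fin_cases j <;> fin_cases β <;>
    simp [xi, Fin.sum_univ_four, Fin.sum_univ_seven, kk, bb, sc]

/-- The commutator of two generators is a combination of generators. -/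
lemma Zop_comm {v : Fn} (hv : Sm v) (i j : Fin 7) :
    Zop i (Zop j v) = Zop j (Zop i v) + ∑ m : Fin 7, sc i j m • Zop m v := by
  have key : ∀ i j : Fin 7, ∀ p, Zop i (Zop j v) p = ∑ γ : Fin 4, ∑ β : Fin 4,
      (xi i γ p * kk j γ β * pd β v p + xi i γ p * xi j β p * pd γ (pd β v) p) := by
    intro i j p
    rw [Zop_eq i, Finset.sum_apply]
    refine Finset.sum_congr rfl fun γ _ => ?_
    rw [pd_Zop hv, Zop_eq j]
    simp only [Pi.mul_apply, Pi.add_apply, Finset.sum_apply, Pi.smul_apply, smul_eq_mul]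
    rw [mul_add, Finset.mul_sum, Finset.mul_sum, ← Finset.sum_add_distrib]
    refine Finset.sum_congr rfl fun β _ => ?_
    rw [pd_comm hv β γ]; ring
  funext p
  simp only [Pi.add_apply, Finset.sum_apply, Pi.smul_apply, smul_eq_mul]
  rw [key i j, key j i]
  have h3 : ∑ m : Fin 7, sc i j m * Zop m v p
      = ∑ β : Fin 4, (∑ γ : Fin 4, (xi i γ p * kk j γ β - xi j γ p * kk i γ β)) * pd β v p := by
    simp only [xi_bracket, Zop_eq, Finset.sum_apply, Pi.mul_apply, Finset.mul_sum, Finset.sum_mul]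
    rw [Finset.sum_comm]
    simp only [mul_assoc]
  rw [h3]
  simp only [Finset.sum_add_distrib, Finset.sum_mul, sub_mul, Finset.sum_sub_distrib]
  have h4 : ∑ γ : Fin 4, ∑ β : Fin 4, xi i γ p * xi j β p * pd γ (pd β v) p
      = ∑ γ : Fin 4, ∑ β : Fin 4, xi j γ p * xi i β p * pd γ (pd β v) p := by
    rw [Finset.sum_comm]
    refine Finset.sum_congr rfl fun β _ => Finset.sum_congr rfl fun γ _ => ?_
    rw [pd_comm hv γ β]; ring
  rw [h4, Finset.sum_comm (f := fun γ β => xi i γ p * kk j γ β * pd β v p),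
    Finset.sum_comm (f := fun γ β => xi j γ p * kk i γ β * pd β v p)]
  ring

/-- The composition of generators along a word. -/
def Zw (l : List (Fin 7)) (v : Fn) : Fn := l.foldr Zop v

@[simp] lemma Zw_nil (v : Fn) : Zw [] v = v := rfl
@[simp] lemma Zw_cons (i : Fin 7) (l : List (Fin 7)) (v : Fn) : Zw (i :: l) v = Zop i (Zw l v) := rfl

lemma Sm.zw {v : Fn} (h : Sm v) (l : List (Fin 7)) : Sm (Zw l v) := by
  induction l with
  | nil => exact h
  | cons i l ih => exact ih.zop i

/-- The ordered word of a multi-index. -/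
def wordOf (a : Fin 7 → ℕ) : List (Fin 7) :=
  (List.finRange 7).flatMap fun i => List.replicate (a i) i

lemma foldr_replicate_iter {α β : Type*} (f : α → β → β) (n : ℕ) (a : α) (b : β) :
    (List.replicate n a).foldr f b = (f a)^[n] b := by
  induction n with
  | zero => rfl
  | succ n ih => rw [List.replicate_succ, List.foldr_cons, ih, Function.iterate_succ_apply']

lemma Zmulti_eq (a : Fin 7 → ℕ) (v : Fn) : Zmulti a v = Zw (wordOf a) v := by
  unfold Zmulti Zw wordOf
  generalize List.finRange 7 = l
  induction l with
  | nil => rfl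
  | cons i l ih => rw [List.foldr_cons, ih, List.flatMap_cons, List.foldr_append,
      foldr_replicate_iter]

lemma Sm.zmulti {v : Fn} (h : Sm v) (a : Fin 7 → ℕ) : Sm (Zmulti a v) := by
  rw [Zmulti_eq]; exact h.zw _

lemma length_wordOf (a : Fin 7 → ℕ) : (wordOf a).length = ∑ i, a i := by
  simp [wordOf, List.finRange_succ, Fin.sum_univ_seven]
  ring

lemma count_wordOf (a : Fin 7 → ℕ) (i : Fin 7) : (wordOf a).count i = a i := by
  simp only [wordOf, List.finRange_succ, List.finRange_zero, List.map_cons, List.map_nil,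
    List.flatMap_cons, List.flatMap_nil, List.count_append, List.count_replicate, List.count_nil]
  fin_cases i <;> simp

lemma sorted_wordOf (a : Fin 7 → ℕ) : (wordOf a).Pairwise (· ≤ ·) := by
  unfold wordOf
  rw [List.flatMap, List.pairwise_flatten]
  refine ⟨?_, ?_⟩
  · intro l hl
    obtain ⟨i, -, rfl⟩ := List.mem_map.1 hl
    rw [List.pairwise_replicate]
    right; exact le_rfl
  · rw [List.pairwise_map]
    refine (List.pairwise_lt_finRange 7).imp ?_
    intro i j hij x hx y hy
    rw [(List.mem_replicate.1 hx).2, (List.mem_replicate.1 hy).2]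
    exact hij.le

lemma eq_wordOf_of_sorted {l : List (Fin 7)} (hl : l.Pairwise (· ≤ ·)) :
    l = wordOf (fun i => l.count i) := by
  refine List.Perm.eq_of_pairwise (le := (· ≤ ·)) ?_ hl (sorted_wordOf _) ?_
  · intro a b _ _ h1 h2; exact le_antisymm h1 h2
  · rw [List.perm_iff_count]
    intro i; rw [count_wordOf]

lemma exists_wordOf_of_sublist {l : List (Fin 7)} {a : Fin 7 → ℕ} (h : l.Sublist (wordOf a)) :
    ∃ b : Fin 7 → ℕ, l = wordOf b ∧ ∑ i, b i = l.length := by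
  refine ⟨fun i => l.count i, eq_wordOf_of_sorted ((sorted_wordOf a).sublist h), ?_⟩
  conv_rhs => rw [eq_wordOf_of_sorted ((sorted_wordOf a).sublist h)]
  rw [length_wordOf]

lemma mem_idxSet {n m : ℕ} {a : Fin n → ℕ} : a ∈ idxSet n m ↔ ∑ i, a i ≤ m := by
  unfold idxSet
  rw [Finset.mem_filter, Fintype.mem_piFinset]
  refine ⟨fun h => h.2, fun h => ⟨fun i => ?_, h⟩⟩
  rw [Finset.mem_range]
  have := Finset.single_le_sum (f := a) (fun i _ => Nat.zero_le _) (Finset.mem_univ i)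
  omega

/-- The shifted generator appearing when a generator is commuted with the d'Alembertian. -/
def Zt (i : Fin 7) (f : Fn) : Fn := Zop i f + (if i = 6 then (2 : ℝ) else 0) • f

/-- The composition of shifted generators along a word. -/
def Ztw (l : List (Fin 7)) (f : Fn) : Fn := l.foldr Zt f

@[simp] lemma Ztw_nil (v : Fn) : Ztw [] v = v := rfl
@[simp] lemma Ztw_cons (i : Fin 7) (l : List (Fin 7)) (v : Fn) :
    Ztw (i :: l) v = Zt i (Ztw l v) := rfl

lemma Sm.zt {v : Fn} (h : Sm v) (i : Fin 7) : Sm (Zt i v) := (h.zop i).add' (h.smul' _)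

lemma Sm.ztw {v : Fn} (h : Sm v) (l : List (Fin 7)) : Sm (Ztw l v) := by
  induction l with
  | nil => exact h
  | cons i l ih => exact ih.zt i

lemma Zt_add {v w : Fn} (hv : Sm v) (hw : Sm w) (i : Fin 7) :
    Zt i (v + w) = Zt i v + Zt i w := by
  unfold Zt; rw [Zop_add hv hw, smul_add]; abel

lemma Ztw_add {v w : Fn} (hv : Sm v) (hw : Sm w) (l : List (Fin 7)) :
    Ztw l (v + w) = Ztw l v + Ztw l w := by
  induction l with
  | nil => rfl
  | cons i l ih => rw [Ztw_cons, ih, Zt_add (hv.ztw l) (hw.ztw l)]; rfl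

lemma Ztw_zero (l : List (Fin 7)) : Ztw l 0 = 0 := by
  induction l with
  | nil => rfl
  | cons i l ih => rw [Ztw_cons, ih]; simp [Zt, Zop_zero]

lemma Ztw_sum {ι : Type*} (s : Finset ι) {v : ι → Fn} (hv : ∀ i, Sm (v i)) (l : List (Fin 7)) :
    Ztw l (∑ i ∈ s, v i) = ∑ i ∈ s, Ztw l (v i) := by
  classical
  induction s using Finset.induction_on with
  | empty => simp [Ztw_zero]
  | insert a s ha ih =>
    rw [Finset.sum_insert ha, Finset.sum_insert ha, Ztw_add (hv a) (Sm.sum' s hv), ih]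

lemma boxOp_eq (c : ℝ) (v : Fn) : boxOp c v = pd 0 (pd 0 v)
    + (-c^2) • ∑ j : Fin 3, pd j.succ (pd j.succ v) := by
  funext p
  simp [boxOp, pd_zero, pd_succ]; ring

lemma Zop_sum {ι : Type*} (s : Finset ι) {v : ι → Fn} (hv : ∀ i, Sm (v i)) (j : Fin 7) :
    Zop j (∑ i ∈ s, v i) = ∑ i ∈ s, Zop j (v i) := by
  classical
  induction s using Finset.induction_on with
  | empty => simp [Zop_zero]
  | insert a s ha ih =>
    rw [Finset.sum_insert ha, Finset.sum_insert ha, Zop_add (hv a) (Sm.sum' s hv), ih]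

lemma pd_pd_Zop {v : Fn} (hv : Sm v) (α : Fin 4) (i : Fin 7) :
    pd α (pd α (Zop i v)) = Zop i (pd α (pd α v))
      + ∑ β : Fin 4, (2 * kk i α β) • pd β (pd α v) := by
  rw [pd_Zop hv, pd_add ((hv.pd α).zop i) (Sm.sum' _ fun β => (hv.pd β).smul' _),
    pd_Zop (hv.pd α), pd_sum _ (fun β => (hv.pd β).smul' _), add_assoc, ← Finset.sum_add_distrib]
  congr 1
  refine Finset.sum_congr rfl fun β _ => ?_
  rw [pd_smul (hv.pd β), pd_comm hv α β, ← add_smul]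
  congr 1; ring

lemma boxOp_Zop {v : Fn} (hv : Sm v) (c : ℝ) (i : Fin 7) :
    boxOp c (Zop i v) = Zt i (boxOp c v) := by
  unfold Zt
  rw [boxOp_eq, boxOp_eq, Zop_add ((hv.pd 0).pd 0) ((Sm.sum' _ fun j => (hv.pd _).pd _).smul' _),
    Zop_smul (Sm.sum' _ fun j => (hv.pd _).pd _), Zop_sum _ (fun j => (hv.pd _).pd _)]
  simp only [pd_pd_Zop hv]
  funext p
  have h10 := congrFun (pd_comm hv 1 0) p
  have h20 := congrFun (pd_comm hv 2 0) p
  have h30 := congrFun (pd_comm hv 3 0) p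
  have h21 := congrFun (pd_comm hv 2 1) p
  have h31 := congrFun (pd_comm hv 3 1) p
  have h32 := congrFun (pd_comm hv 3 2) p
  fin_cases i <;>
    simp [Fin.sum_univ_four, Fin.sum_univ_three, kk, h10, h20, h30, h21, h31, h32] <;> ring

lemma boxOp_Zw {v : Fn} (hv : Sm v) (c : ℝ) (l : List (Fin 7)) :
    boxOp c (Zw l v) = Ztw l (boxOp c v) := by
  induction l with
  | nil => rfl
  | cons i l ih => rw [Zw_cons, boxOp_Zop (hv.zw l), ih]; rfl

lemma pd_congr_on {f g : Fn} {O : Set Pt} (hO : IsOpen O) (h : ∀ p ∈ O, f p = g p) (α : Fin 4) :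
    ∀ p ∈ O, pd α f p = pd α g p := by
  intro p hp
  rw [pd_eq, pd_eq]
  have : f =ᶠ[nhds p] g := Filter.eventuallyEq_of_mem (hO.mem_nhds hp) h
  rw [this.fderiv_eq]

lemma Zop_congr_on {f g : Fn} {O : Set Pt} (hO : IsOpen O) (h : ∀ p ∈ O, f p = g p) (i : Fin 7) :
    ∀ p ∈ O, Zop i f p = Zop i g p := by
  intro p hp
  simp only [Zop_eq, Finset.sum_apply, Pi.mul_apply]
  exact Finset.sum_congr rfl fun β _ => by rw [pd_congr_on hO h β p hp]

lemma Zw_congr_on {f g : Fn} {O : Set Pt} (hO : IsOpen O) (h : ∀ p ∈ O, f p = g p)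
    (l : List (Fin 7)) : ∀ p ∈ O, Zw l f p = Zw l g p := by
  induction l with
  | nil => exact h
  | cons i l ih => exact Zop_congr_on hO ih i

lemma Ztw_congr_on {f g : Fn} {O : Set Pt} (hO : IsOpen O) (h : ∀ p ∈ O, f p = g p)
    (l : List (Fin 7)) : ∀ p ∈ O, Ztw l f p = Ztw l g p := by
  induction l with
  | nil => exact h
  | cons i l ih =>
    intro p hp
    simp only [Ztw_cons, Zt, Pi.add_apply, Pi.smul_apply]
    rw [Zop_congr_on hO ih i p hp, ih p hp]

lemma pd_zero_fn (α : Fin 4) : pd α (0 : Fn) = 0 := pd_const 0 α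

lemma Zw_zero (l : List (Fin 7)) : Zw l 0 = 0 := by
  induction l with
  | nil => rfl
  | cons i l ih => rw [Zw_cons, ih, Zop_zero]

/-- Triples of smooth fields. -/
abbrev SU : Type := {u : Fin 3 → Fn // ∀ i, Sm (u i)}

/-- The action of a generator on the coefficients of a quadratic form. -/
def act (i : Fin 7) (H : Fin 4 → Fin 4 → ℝ) : Fin 4 → Fin 4 → ℝ := fun γ δ =>
  -(∑ α : Fin 4, kk i α γ * H α δ) - ∑ β : Fin 4, kk i β δ * H γ β

lemma nullQ_eq (H : Fin 4 → Fin 4 → ℝ) (v w : Fn) :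
    nullQ H v w = ∑ α : Fin 4, ∑ β : Fin 4, H α β • (pd α v * pd β w) := by
  funext p; simp [nullQ, mul_assoc]

lemma Sm.nullQ {v w : Fn} (hv : Sm v) (hw : Sm w) (H : Fin 4 → Fin 4 → ℝ) : Sm (nullQ H v w) := by
  rw [nullQ_eq]
  exact Sm.sum' _ fun α => Sm.sum' _ fun β => ((hv.pd α).mul' (hw.pd β)).smul' _

lemma Zop_pd {v : Fn} (hv : Sm v) (α : Fin 4) (i : Fin 7) :
    Zop i (pd α v) = pd α (Zop i v) - ∑ β : Fin 4, kk i α β • pd β v := by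
  rw [pd_Zop hv]; abel

lemma act_identity (H k : Fin 4 → Fin 4 → ℝ) (a a' b b' : Fin 4 → ℝ) :
    ∑ α : Fin 4, ∑ β : Fin 4, H α β * ((a' α - ∑ γ : Fin 4, k α γ * a γ) * b β
        + a α * (b' β - ∑ γ : Fin 4, k β γ * b γ))
      = ∑ α : Fin 4, ∑ β : Fin 4, H α β * a' α * b β + ∑ α : Fin 4, ∑ β : Fin 4, H α β * a α * b' β
        + ∑ γ : Fin 4, ∑ δ : Fin 4, (-(∑ α : Fin 4, k α γ * H α δ) - ∑ β : Fin 4, k β δ * H γ β)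
          * a γ * b δ := by
  have h1 : ∑ γ : Fin 4, ∑ δ : Fin 4, (∑ α : Fin 4, k α γ * H α δ) * a γ * b δ
      = ∑ α : Fin 4, ∑ β : Fin 4, H α β * (∑ γ : Fin 4, k α γ * a γ) * b β := by
    simp only [Finset.sum_mul, Finset.mul_sum]
    rw [Finset.sum_comm' (t' := Finset.univ) (s' := fun _ => Finset.univ) (by simp)]
    rw [Finset.sum_comm]
    simp only [Fin.sum_univ_four]; ring
  have h2 : ∑ γ : Fin 4, ∑ δ : Fin 4, (∑ β : Fin 4, k β δ * H γ β) * a γ * b δ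
      = ∑ α : Fin 4, ∑ β : Fin 4, H α β * a α * ∑ γ : Fin 4, k β γ * b γ := by
    simp only [Finset.sum_mul, Finset.mul_sum]
    simp only [Fin.sum_univ_four]; ring
  calc _ = ∑ α : Fin 4, ∑ β : Fin 4, H α β * a' α * b β
        + ∑ α : Fin 4, ∑ β : Fin 4, H α β * a α * b' β
        - (∑ α : Fin 4, ∑ β : Fin 4, H α β * (∑ γ : Fin 4, k α γ * a γ) * b β
          + ∑ α : Fin 4, ∑ β : Fin 4, H α β * a α * ∑ γ : Fin 4, k β γ * b γ) := by
        simp only [← Finset.sum_add_distrib, ← Finset.sum_sub_distrib]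
        refine Finset.sum_congr rfl fun α _ => Finset.sum_congr rfl fun β _ => ?_
        ring
    _ = _ := by
        rw [← h1, ← h2]
        simp only [sub_mul, neg_mul, Finset.sum_sub_distrib, Finset.sum_neg_distrib]
        ring

lemma Zop_nullQ {v w : Fn} (hv : Sm v) (hw : Sm w) (H : Fin 4 → Fin 4 → ℝ) (i : Fin 7) :
    Zop i (nullQ H v w) = nullQ H (Zop i v) w + nullQ H v (Zop i w) + nullQ (act i H) v w := by
  have h1 : Zop i (nullQ H v w) = ∑ α : Fin 4, ∑ β : Fin 4,
      H α β • (Zop i (pd α v) * pd β w + pd α v * Zop i (pd β w)) := by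
    rw [nullQ_eq, Zop_sum _ (fun α => Sm.sum' _ fun β => ((hv.pd α).mul' (hw.pd β)).smul' _)]
    refine Finset.sum_congr rfl fun α _ => ?_
    rw [Zop_sum _ (fun β => ((hv.pd α).mul' (hw.pd β)).smul' _)]
    refine Finset.sum_congr rfl fun β _ => ?_
    rw [Zop_smul ((hv.pd α).mul' (hw.pd β)), Zop_mul (hv.pd α) (hw.pd β)]
  rw [h1]
  funext p
  have := act_identity H (kk i) (fun α => pd α v p) (fun α => pd α (Zop i v) p)
    (fun α => pd α w p) (fun α => pd α (Zop i w) p)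
  simp only [Zop_pd hv, Zop_pd hw, nullQ, act, Finset.sum_apply, Pi.add_apply, Pi.smul_apply,
    Pi.mul_apply, Pi.sub_apply, smul_eq_mul] at this ⊢
  exact this

/-- Linear combinations of null-type forms applied to subwords. -/
def QSpan (A : Set (Fin 4 → Fin 4 → ℝ)) (j k : Fin 3) (l : List (Fin 7)) : Submodule ℝ (SU → Fn) :=
  Submodule.span ℝ {Φ | ∃ H ∈ A, ∃ l₁ l₂ : List (Fin 7), l₁.Sublist l ∧ l₂.Sublist l ∧
    l₁.length + l₂.length ≤ l.length ∧ Φ = fun u : SU => nullQ H (Zw l₁ (u.1 j)) (Zw l₂ (u.1 k))}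

lemma QSpan_sm {A : Set (Fin 4 → Fin 4 → ℝ)} {j k : Fin 3} {l : List (Fin 7)} {Φ : SU → Fn}
    (h : Φ ∈ QSpan A j k l) (u : SU) : Sm (Φ u) := by
  refine Submodule.span_induction (p := fun Φ _ => Sm (Φ u)) ?_ ?_ ?_ ?_ h
  · rintro _ ⟨H, -, l₁, l₂, -, -, -, rfl⟩
    exact Sm.nullQ ((u.2 j).zw l₁) ((u.2 k).zw l₂) H
  · exact contDiff_const
  · intro x y _ _ hx hy; exact hx.add' hy
  · intro c x _ hx; exact hx.smul' c

lemma QSpan_mono {A : Set (Fin 4 → Fin 4 → ℝ)} {j k : Fin 3} (i : Fin 7) (l : List (Fin 7)) :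
    QSpan A j k l ≤ QSpan A j k (i :: l) := by
  refine Submodule.span_mono ?_
  rintro _ ⟨H, hH, l₁, l₂, h1, h2, h3, rfl⟩
  exact ⟨H, hH, l₁, l₂, h1.cons i, h2.cons i, h3.trans (by simp), rfl⟩

lemma QSpan_Zop {A : Set (Fin 4 → Fin 4 → ℝ)} (hA : ∀ i, ∀ H ∈ A, act i H ∈ A) {j k : Fin 3}
    (i : Fin 7) {l : List (Fin 7)} {Φ : SU → Fn} (h : Φ ∈ QSpan A j k l) :
    (fun u => Zop i (Φ u)) ∈ QSpan A j k (i :: l) := by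
  refine Submodule.span_induction
    (p := fun Φ _ => (fun u => Zop i (Φ u)) ∈ QSpan A j k (i :: l)) ?_ ?_ ?_ ?_ h
  · rintro _ ⟨H, hH, l₁, l₂, h1, h2, h3, rfl⟩
    have : (fun u : SU => Zop i (nullQ H (Zw l₁ (u.1 j)) (Zw l₂ (u.1 k))))
      = (fun u : SU => nullQ H (Zw (i :: l₁) (u.1 j)) (Zw l₂ (u.1 k)))
      + (fun u : SU => nullQ H (Zw l₁ (u.1 j)) (Zw (i :: l₂) (u.1 k)))
      + fun u : SU => nullQ (act i H) (Zw l₁ (u.1 j)) (Zw l₂ (u.1 k)) := by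
      funext u
      rw [Zop_nullQ ((u.2 j).zw l₁) ((u.2 k).zw l₂)]; rfl
    rw [this]
    refine Submodule.add_mem _ (Submodule.add_mem _ ?_ ?_) ?_
    · exact Submodule.subset_span ⟨H, hH, i :: l₁, l₂, h1.cons_cons i, h2.cons i,
        by simp; omega, rfl⟩
    · exact Submodule.subset_span ⟨H, hH, l₁, i :: l₂, h1.cons i, h2.cons_cons i,
        by simp; omega, rfl⟩
    · exact Submodule.subset_span ⟨_, hA i H hH, l₁, l₂, h1.cons i, h2.cons i,
        by simp; omega, rfl⟩
  · have : (fun u : SU => Zop i ((0 : SU → Fn) u)) = 0 := by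
      funext u; exact Zop_zero i
    rw [this]; exact Submodule.zero_mem _
  · intro x y hx hy h1 h2
    have : (fun u : SU => Zop i ((x + y) u)) = (fun u => Zop i (x u)) + fun u => Zop i (y u) := by
      funext u; exact Zop_add (QSpan_sm hx u) (QSpan_sm hy u) i
    rw [this]; exact Submodule.add_mem _ h1 h2
  · intro c x hx h1
    have : (fun u : SU => Zop i ((c • x) u)) = c • fun u => Zop i (x u) := by
      funext u; exact Zop_smul (QSpan_sm hx u) c i
    rw [this]; exact Submodule.smul_mem _ c h1

lemma QSpan_Ztw {A : Set (Fin 4 → Fin 4 → ℝ)} (hA : ∀ i, ∀ H ∈ A, act i H ∈ A) {j k : Fin 3}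
    {H : Fin 4 → Fin 4 → ℝ} (hH : H ∈ A) (l : List (Fin 7)) :
    (fun u : SU => Ztw l (nullQ H (u.1 j) (u.1 k))) ∈ QSpan A j k l := by
  induction l with
  | nil => exact Submodule.subset_span ⟨H, hH, [], [], List.Sublist.refl _, List.Sublist.refl _,
      le_rfl, rfl⟩
  | cons i l ih =>
    have : (fun u : SU => Ztw (i :: l) (nullQ H (u.1 j) (u.1 k)))
      = (fun u : SU => Zop i (Ztw l (nullQ H (u.1 j) (u.1 k))))
        + (if i = 6 then (2 : ℝ) else 0) • fun u : SU => Ztw l (nullQ H (u.1 j) (u.1 k)) := by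
      funext u; rfl
    rw [this]
    exact Submodule.add_mem _ (QSpan_Zop hA i ih) (Submodule.smul_mem _ _ (QSpan_mono i l ih))

/-- A factor `∂_α Z^l u_i`. -/
abbrev Fac : Type := List (Fin 7) × Fin 3 × Fin 4

/-- Evaluation of a factor. -/
def ev (u : SU) (f : Fac) : Fn := pd f.2.2 (Zw f.1 (u.1 f.2.1))

lemma ev_sm (u : SU) (f : Fac) : Sm (ev u f) := ((u.2 _).zw _).pd _

/-- Products of factors. -/
def evp (q : List Fac) (u : SU) : Fn := (q.map (ev u)).prod

lemma evp_sm (q : List Fac) (u : SU) : Sm (evp q u) := by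
  induction q with
  | nil => exact contDiff_const
  | cons f q ih =>
    have : evp (f :: q) u = ev u f * evp q u := by simp [evp]
    rw [this]; exact (ev_sm u f).mul' ih

/-- Linear combinations of products of factors with prescribed components. -/
def PSpan (js : List (Fin 3)) (l : List (Fin 7)) (n : ℕ) : Submodule ℝ (SU → Fn) :=
  Submodule.span ℝ {Φ | ∃ q : List Fac, q.map (fun f => f.2.1) = js ∧
    (∀ f ∈ q, f.1.Sublist l) ∧ (q.map fun f => f.1.length).sum ≤ n ∧ Φ = evp q}

lemma PSpan_sm {js : List (Fin 3)} {l : List (Fin 7)} {n : ℕ} {Φ : SU → Fn}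
    (h : Φ ∈ PSpan js l n) (u : SU) : Sm (Φ u) := by
  refine Submodule.span_induction (p := fun Φ _ => Sm (Φ u)) ?_ ?_ ?_ ?_ h
  · rintro _ ⟨q, -, -, -, rfl⟩
    exact evp_sm q u
  · exact contDiff_const
  · intro x y _ _ hx hy; exact hx.add' hy
  · intro c x _ hx; exact hx.smul' c

lemma PSpan_mono {js : List (Fin 3)} (i : Fin 7) (l : List (Fin 7)) (n : ℕ) :
    PSpan js l n ≤ PSpan js (i :: l) (n + 1) := by
  refine Submodule.span_mono ?_
  rintro _ ⟨q, h1, h2, h3, rfl⟩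
  exact ⟨q, h1, fun f hf => (h2 f hf).cons i, by omega, rfl⟩

lemma PSpan_mul {js : List (Fin 3)} {l : List (Fin 7)} {n m : ℕ} {Φ : SU → Fn}
    (h : Φ ∈ PSpan js l n) (f : Fac) (hf : f.1.Sublist l) (hm : f.1.length + n ≤ m) :
    (fun u => ev u f * Φ u) ∈ PSpan (f.2.1 :: js) l m := by
  refine Submodule.span_induction
    (p := fun Φ _ => (fun u => ev u f * Φ u) ∈ PSpan (f.2.1 :: js) l m) ?_ ?_ ?_ ?_ h
  · rintro _ ⟨q, h1, h2, h3, rfl⟩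
    refine Submodule.subset_span ⟨f :: q, by simp [h1], ?_, by simp; omega, ?_⟩
    · intro g hg
      rcases List.mem_cons.1 hg with rfl | hg
      · exact hf
      · exact h2 g hg
    · funext u; simp [evp]
  · have : (fun u : SU => ev u f * (0 : SU → Fn) u) = 0 := by funext u; simp
    rw [this]; exact Submodule.zero_mem _
  · intro x y _ _ h1 h2
    have : (fun u : SU => ev u f * (x + y) u) = (fun u => ev u f * x u) + fun u => ev u f * y u := by
      funext u; simp [mul_add]
    rw [this]; exact Submodule.add_mem _ h1 h2
  · intro c x _ h1
    have : (fun u : SU => ev u f * (c • x) u) = c • fun u => ev u f * x u := by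
      funext u; simp
    rw [this]; exact Submodule.smul_mem _ c h1

lemma PSpan_Zop_evp (i : Fin 7) (l : List (Fin 7)) (q : List Fac) (n : ℕ)
    (h2 : ∀ f ∈ q, f.1.Sublist l) (h3 : (q.map fun f => f.1.length).sum ≤ n) :
    (fun u => Zop i (evp q u)) ∈ PSpan (q.map fun f => f.2.1) (i :: l) (n + 1) := by
  induction q generalizing n with
  | nil =>
    have : (fun u : SU => Zop i (evp [] u)) = 0 := by
      funext u p
      have : evp [] u = fun _ => (1 : ℝ) := by funext p; simp [evp]
      rw [this, Zop_eq]
      simp [pd_const]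
    rw [this]; exact Submodule.zero_mem _
  | cons f q ih =>
    obtain ⟨lf, j, α⟩ := f
    have hf : lf.Sublist l := h2 (lf, j, α) (by simp)
    simp only [List.map_cons, List.sum_cons] at h3
    have hq : evp q ∈ PSpan (q.map fun f => f.2.1) (i :: l) (n - lf.length) :=
      Submodule.subset_span ⟨q, rfl, fun g hg => (h2 g (by simp [hg])).cons i, by omega, rfl⟩
    have hZ := ih (n - lf.length) (fun g hg => h2 g (by simp [hg])) (by omega)
    have : (fun u : SU => Zop i (evp ((lf, j, α) :: q) u))
      = ((fun u : SU => ev u (i :: lf, j, α) * evp q u)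
        - ∑ β : Fin 4, kk i α β • fun u : SU => ev u (lf, j, β) * evp q u)
        + fun u : SU => ev u (lf, j, α) * Zop i (evp q u) := by
      funext u
      have h4 : evp ((lf, j, α) :: q) u = ev u (lf, j, α) * evp q u := by simp [evp]
      rw [h4, Zop_mul (ev_sm u _) (evp_sm q u)]
      have h5 : Zop i (ev u (lf, j, α)) = ev u (i :: lf, j, α)
          - ∑ β : Fin 4, kk i α β • ev u (lf, j, β) := Zop_pd ((u.2 j).zw lf) α i
      rw [h5]
      simp [sub_mul, Finset.sum_mul]
    rw [this]
    refine Submodule.add_mem _ (Submodule.sub_mem _ ?_ (Submodule.sum_mem _ fun β _ =>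
      Submodule.smul_mem _ _ ?_)) ?_
    · exact PSpan_mul hq (i :: lf, j, α) (hf.cons_cons i) (by simp; omega)
    · exact PSpan_mul hq (lf, j, β) (hf.cons i) (by simp; omega)
    · exact PSpan_mul hZ (lf, j, α) (hf.cons i) (by simp; omega)

lemma PSpan_Zop {js : List (Fin 3)} (i : Fin 7) {l : List (Fin 7)} {n : ℕ} {Φ : SU → Fn}
    (h : Φ ∈ PSpan js l n) : (fun u => Zop i (Φ u)) ∈ PSpan js (i :: l) (n + 1) := by
  refine Submodule.span_induction
    (p := fun Φ _ => (fun u => Zop i (Φ u)) ∈ PSpan js (i :: l) (n + 1)) ?_ ?_ ?_ ?_ h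
  · rintro _ ⟨q, rfl, h2, h3, rfl⟩
    exact PSpan_Zop_evp i l q n h2 h3
  · have : (fun u : SU => Zop i ((0 : SU → Fn) u)) = 0 := by
      funext u; exact Zop_zero i
    rw [this]; exact Submodule.zero_mem _
  · intro x y hx hy h1 h2
    have : (fun u : SU => Zop i ((x + y) u)) = (fun u => Zop i (x u)) + fun u => Zop i (y u) := by
      funext u; exact Zop_add (PSpan_sm hx u) (PSpan_sm hy u) i
    rw [this]; exact Submodule.add_mem _ h1 h2
  · intro c x hx h1
    have : (fun u : SU => Zop i ((c • x) u)) = c • fun u => Zop i (x u) := by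
      funext u; exact Zop_smul (PSpan_sm hx u) c i
    rw [this]; exact Submodule.smul_mem _ c h1

lemma PSpan_Ztw {js : List (Fin 3)} {Φ : SU → Fn} (h : Φ ∈ PSpan js [] 0) (l : List (Fin 7)) :
    (fun u : SU => Ztw l (Φ u)) ∈ PSpan js l l.length := by
  induction l with
  | nil => exact h
  | cons i l ih =>
    have : (fun u : SU => Ztw (i :: l) (Φ u)) = (fun u : SU => Zop i (Ztw l (Φ u)))
        + (if i = 6 then (2 : ℝ) else 0) • fun u : SU => Ztw l (Φ u) := by
      funext u; rfl
    rw [this]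
    exact Submodule.add_mem _ (PSpan_Zop i ih) (Submodule.smul_mem _ _ (PSpan_mono i l _ ih))

lemma jb_sq (ρ : ℝ) : jb ρ ^ 2 = 1 + ρ ^ 2 := Real.sq_sqrt (by positivity)

lemma one_le_jb (ρ : ℝ) : 1 ≤ jb ρ := by
  unfold jb; rw [Real.one_le_sqrt]; nlinarith [sq_nonneg ρ]

lemma jb_pos (ρ : ℝ) : 0 < jb ρ := lt_of_lt_of_le one_pos (one_le_jb ρ)

lemma abs_le_jb (ρ : ℝ) : |ρ| ≤ jb ρ := by
  unfold jb; exact Real.abs_le_sqrt (by linarith)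

lemma jb_le (ρ : ℝ) : jb ρ ≤ 1 + |ρ| := by
  unfold jb; rw [Real.sqrt_le_left (by positivity)]
  nlinarith [sq_abs ρ, abs_nonneg ρ]

lemma jb_smooth : ContDiff ℝ (⊤ : ℕ∞) jb := by
  unfold jb
  exact ContDiff.sqrt (contDiff_const.add (contDiff_id.pow 2)) fun x => by positivity

lemma jb_cont : Continuous jb := jb_smooth.continuous

lemma jb_lip (a b : ℝ) : jb a ≤ jb b + |a - b| := by
  have h1 := jb_sq a
  have h2 := jb_sq b
  have h3 := abs_le_jb b
  have h4 : a ^ 2 ≤ b ^ 2 + 2 * |b| * |a - b| + |a - b| ^ 2 := by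
    have : |a| ≤ |b| + |a - b| := by
      calc |a| = |b + (a - b)| := by ring_nf
        _ ≤ _ := abs_add_le _ _
    have := pow_le_pow_left₀ (abs_nonneg a) this 2
    rw [sq_abs] at this
    nlinarith [sq_abs b]
  have h5 : 0 ≤ jb b + |a - b| := by have := jb_pos b; positivity
  refine le_of_sq_le_sq ?_ h5 
  nlinarith [abs_nonneg (a - b), mul_le_mul_of_nonneg_right h3 (abs_nonneg (a - b))]

/-- The relative size of the regions separating the light cones. -/
def kap (c0 : ℝ) : ℝ := min (1/4) (min (c0/4) (|1 - c0|/4))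

lemma kap_pos {c0 : ℝ} (h : 0 < c0) (hne : c0 ≠ 1) : 0 < kap c0 := by
  have : 0 < |1 - c0| := abs_pos.2 (sub_ne_zero.2 hne.symm)
  unfold kap; positivity

lemma kap_le (c0 : ℝ) : kap c0 ≤ 1/4 := min_le_left _ _

lemma kap_le_speed (c0 : ℝ) (i : Fin 3) : kap c0 ≤ cspeed c0 i / 4 := by
  fin_cases i <;> simp [kap, cspeed]

lemma kap_le_diff (c0 : ℝ) {i j : Fin 3} (h : cspeed c0 i ≠ cspeed c0 j) :
    kap c0 ≤ |cspeed c0 i - cspeed c0 j| / 4 := by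
  have h1 : kap c0 ≤ |1 - c0| / 4 := (min_le_right _ _).trans (min_le_right _ _)
  have h2 : |1 - c0| = |c0 - 1| := abs_sub_comm _ _
  fin_cases i <;> fin_cases j <;> simp [cspeed] at h ⊢ <;> linarith

lemma cspeed_pos {c0 : ℝ} (h : 0 < c0) (i : Fin 3) : 0 < cspeed c0 i := by
  fin_cases i <;> simp [cspeed, h]

lemma jb_time_le {κ t : ℝ} (hκ : 0 < κ) (hκ' : κ ≤ 1/4) (ht : 0 ≤ t) (h : 1 < κ * jb t) :
    jb t ≤ 2 * t := by
  have h1 := jb_le t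
  rw [abs_of_nonneg ht] at h1
  nlinarith [jb_pos t]

lemma interior_far {c0 t r : ℝ} (h0 : 0 < c0) (hne : c0 ≠ 1) (ht : 0 ≤ t)
    (hr : r ≤ kap c0 * jb t) (i : Fin 3) : kap c0 * jb t ≤ jb (cspeed c0 i * t - r) := by
  by_contra hlt
  push Not at hlt
  have hκ := kap_pos h0 hne
  have h1 := jb_time_le hκ (kap_le c0) ht ((one_le_jb _).trans_lt hlt)
  have h2 := (le_abs_self _).trans_lt ((abs_le_jb _).trans_lt hlt)
  have h3 := kap_le_speed c0 i
  have h4 : 0 < t := by nlinarith [jb_pos t]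
  nlinarith

lemma cones_separate {c0 t r : ℝ} (h0 : 0 < c0) (hne : c0 ≠ 1) (ht : 0 ≤ t) {i j : Fin 3}
    (hij : cspeed c0 i ≠ cspeed c0 j) :
    kap c0 * jb t ≤ jb (cspeed c0 i * t - r) ∨ kap c0 * jb t ≤ jb (cspeed c0 j * t - r) := by
  by_contra! hlt
  obtain ⟨h5, h6⟩ := hlt
  have hκ := kap_pos h0 hne
  have h1 := jb_time_le hκ (kap_le c0) ht ((one_le_jb _).trans_lt h5)
  have h2 := (abs_le_jb _).trans_lt h5
  have h2' := (abs_le_jb _).trans_lt h6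
  have h3 := kap_le_diff c0 hij
  have h4 : 0 < t := by nlinarith [jb_pos t]
  have h7 : |cspeed c0 i - cspeed c0 j| * t < 2 * (kap c0 * jb t) := by
    calc |cspeed c0 i - cspeed c0 j| * t = |(cspeed c0 i - cspeed c0 j) * t| := by
          rw [abs_mul, abs_of_pos h4]
      _ = |(cspeed c0 i * t - r) - (cspeed c0 j * t - r)| := by ring_nf
      _ ≤ |cspeed c0 i * t - r| + |cspeed c0 j * t - r| := abs_sub _ _
      _ < _ := by linarith
  nlinarith

lemma abs_pd_le (v : Fn) (p : Pt) (α : Fin 4) : |pd α v p| ≤ pdNorm v p := by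
  unfold pdNorm
  refine Real.abs_le_sqrt ?_
  exact Finset.single_le_sum (f := fun α => (pd α v p) ^ 2) (fun i _ => sq_nonneg _)
    (Finset.mem_univ α)

lemma pdNorm_nonneg (v : Fn) (p : Pt) : 0 ≤ pdNorm v p := Real.sqrt_nonneg _

/-- The sum of the absolute values of all generators applied to a field. -/
def ZN (v : Fn) (p : Pt) : ℝ := ∑ k : Fin 7, |Zop k v p|

lemma ZN_nonneg (v : Fn) (p : Pt) : 0 ≤ ZN v p := Finset.sum_nonneg fun _ _ => abs_nonneg _

lemma abs_Zop_le (v : Fn) (p : Pt) (k : Fin 7) : |Zop k v p| ≤ ZN v p :=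
  Finset.single_le_sum (f := fun k => |Zop k v p|) (fun i _ => abs_nonneg _) (Finset.mem_univ k)

lemma om_bounds (v : Fn) (p : Pt) (i j : Fin 3) : |om i j v p| ≤ ZN v p := by
  have h0 := abs_Zop_le v p 3
  have h1 := abs_Zop_le v p 4
  have h2 := abs_Zop_le v p 5
  have hn := ZN_nonneg v p
  simp only [Zop] at h0 h1 h2
  change |om 0 1 v p| ≤ _ at h0
  change |om 1 2 v p| ≤ _ at h1
  change |om 0 2 v p| ≤ _ at h2
  have hs : ∀ i j : Fin 3, om j i v p = - om i j v p := fun i j => by simp [om]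
  have hd : ∀ i : Fin 3, om i i v p = 0 := fun i => by simp [om]
  fin_cases i <;> fin_cases j <;> simp only [Fin.zero_eta, Fin.mk_one, Fin.reduceFinMk, hd, abs_zero] <;>
    first | assumption | (rw [hs, abs_neg]; assumption)

lemma abs_coord_le (x : Sp) (j : Fin 3) : |x j| ≤ ‖x‖ := by
  have := PiLp.norm_apply_le x j
  rwa [Real.norm_eq_abs] at this

lemma norm_sq_eq (x : Sp) : ‖x‖ ^ 2 = x 0 ^ 2 + x 1 ^ 2 + x 2 ^ 2 := by
  rw [EuclideanSpace.norm_sq_eq, Fin.sum_univ_three]; simp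

lemma Tder_identity (c t : ℝ) (x : Sp) (hx : x ≠ 0) (v : Fn) (j : Fin 3) :
    t * ‖x‖ ^ 2 * Tder c j v (t, x)
      = x j * (∑ k : Fin 3, x k * px k v (t, x)) * (c * t - ‖x‖)
        + c * t * (∑ k : Fin 3, x k * om k j v (t, x)) + x j * ‖x‖ * sOp v (t, x) := by
  have hr : ‖x‖ ≠ 0 := norm_ne_zero_iff.2 hx
  have h2 := norm_sq_eq x
  have h3 : ‖x‖ ^ 2 * Tder c j v (t, x) = ‖x‖ ^ 2 * c * px j v (t, x)
      + x j * ‖x‖ * pt v (t, x) := by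
    simp only [Tder]; field_simp
  rw [mul_assoc, h3]
  have h4 : ‖x‖ ^ 2 * c * px j v (t, x) = (x 0 ^ 2 + x 1 ^ 2 + x 2 ^ 2) * c * px j v (t, x) := by
    rw [h2]
  rw [h4]
  simp only [om, sOp, Fin.sum_univ_three]
  ring

lemma Tder_bound {c κ : ℝ} (hc : 0 < c) (hκ : 0 < κ) : ∃ C : ℝ, 0 ≤ C ∧ ∀ (v : Fn) (t : ℝ) (x : Sp)
    (j : Fin 3), 0 ≤ t → κ * jb t ≤ ‖x‖ →
    |Tder c j v (t, x)| ≤ C / jb t * (jb (c * t - ‖x‖) * pdNorm v (t, x) + ZN v (t, x)) := by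
  refine ⟨2 * (c + 1) + 2 * (4 + 3 * c / κ), by positivity, fun v t x j ht hx => ?_⟩
  have hτ := jb_pos t
  have hr : 0 < ‖x‖ := lt_of_lt_of_le (by positivity) hx
  have hx0 : x ≠ 0 := norm_pos_iff.1 hr
  have hD := pdNorm_nonneg v (t, x)
  have hZ := ZN_nonneg v (t, x)
  have hJ := one_le_jb (c * t - ‖x‖)
  have hJa := abs_le_jb (c * t - ‖x‖)
  set D := pdNorm v (t, x)
  set Z := ZN v (t, x)
  set J := jb (c * t - ‖x‖)
  set r := ‖x‖
  rcases le_or_gt t 1 with h1 | h1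
  · have hτ2 : jb t ≤ 2 := (jb_le t).trans (by rw [abs_of_nonneg ht]; linarith)
    have h2 : |Tder c j v (t, x)| ≤ (c + 1) * D := by
      have a1 : |c * px j v (t, x)| ≤ c * D := by
        rw [abs_mul, abs_of_pos hc]
        exact mul_le_mul_of_nonneg_left (abs_pd_le v (t, x) j.succ) hc.le
      have a2 : |x j / r * pt v (t, x)| ≤ 1 * D := by
        rw [abs_mul]
        refine mul_le_mul ?_ (abs_pd_le v (t, x) 0) (abs_nonneg _) zero_le_one
        rw [abs_div, abs_of_pos hr]
        exact div_le_one_of_le₀ (abs_coord_le x j) hr.le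
      calc |Tder c j v (t, x)| ≤ |c * px j v (t, x)| + |x j / r * pt v (t, x)| := abs_add_le _ _
        _ ≤ _ := by linarith
    refine h2.trans ?_
    have h3 : (c + 1) ≤ (2 * (c + 1) + 2 * (4 + 3 * c / κ)) / jb t := by
      rw [le_div_iff₀ hτ]
      have : 0 ≤ 2 * (4 + 3 * c / κ) := by positivity
      nlinarith
    calc (c + 1) * D ≤ (2 * (c + 1) + 2 * (4 + 3 * c / κ)) / jb t * D := by gcongr
      _ ≤ _ := by gcongr; nlinarith
  · have hτ2 : jb t ≤ 2 * t := (jb_le t).trans (by rw [abs_of_nonneg ht]; linarith)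
    have ht0 : 0 < t := by linarith
    have hid := Tder_identity c t x hx0 v j
    have a1 : |∑ k : Fin 3, x k * px k v (t, x)| ≤ 3 * (r * D) := by
      refine (Finset.abs_sum_le_sum_abs _ _).trans ?_
      refine (Finset.sum_le_sum (g := fun _ => r * D) fun k _ => ?_).trans (by simp)
      rw [abs_mul]
      exact mul_le_mul (abs_coord_le x k) (abs_pd_le v (t, x) k.succ) (abs_nonneg _) hr.le
    have a2 : |∑ k : Fin 3, x k * om k j v (t, x)| ≤ 3 * (r * Z) := by
      refine (Finset.abs_sum_le_sum_abs _ _).trans ?_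
      refine (Finset.sum_le_sum (g := fun _ => r * Z) fun k _ => ?_).trans (by simp)
      rw [abs_mul]
      exact mul_le_mul (abs_coord_le x k) (om_bounds v (t, x) k j) (abs_nonneg _) hr.le
    have a3 : |sOp v (t, x)| ≤ Z := abs_Zop_le v (t, x) 6
    have a4 : t * r ^ 2 * |Tder c j v (t, x)| ≤ r * (3 * (r * D)) * J + c * t * (3 * (r * Z))
        + r * r * Z := by
      calc t * r ^ 2 * |Tder c j v (t, x)| = |t * r ^ 2 * Tder c j v (t, x)| := by
            rw [abs_mul, abs_of_nonneg (by positivity : 0 ≤ t * r ^ 2)]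
        _ ≤ |x j * (∑ k : Fin 3, x k * px k v (t, x)) * (c * t - r)|
            + |c * t * (∑ k : Fin 3, x k * om k j v (t, x))| + |x j * r * sOp v (t, x)| := by
            rw [hid]; exact (abs_add_le _ _).trans (add_le_add_left (abs_add_le _ _) _)
        _ ≤ _ := by
            simp only [abs_mul, abs_of_pos hc, abs_of_pos ht0, abs_of_pos hr]
            have := abs_coord_le x j
            gcongr
    have a5 : |Tder c j v (t, x)| ≤ 3 * D * J / t + 3 * c * Z / r + Z / t := by
      have : 0 < t * r ^ 2 := by positivity
      refine le_of_mul_le_mul_left (a4.trans (le_of_eq ?_)) this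
      field_simp
    have a6 : 1 / t ≤ 2 / jb t := by rw [div_le_div_iff₀ ht0 hτ]; linarith
    have a7 : 1 / r ≤ (1 / κ) / jb t := by
      rw [div_div, one_div_le_one_div hr (by positivity)]; exact hx
    have a8 : 3 * D * J / t + 3 * c * Z / r + Z / t
        = (3 * D * J + Z) * (1 / t) + 3 * c * Z * (1 / r) := by ring
    rw [a8] at a5
    refine a5.trans ?_
    calc (3 * D * J + Z) * (1 / t) + 3 * c * Z * (1 / r)
        ≤ (3 * D * J + Z) * (2 / jb t) + 3 * c * Z * ((1 / κ) / jb t) := by gcongr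
      _ = (6 * (J * D) + (2 + 3 * c / κ) * Z) / jb t := by field_simp; ring
      _ ≤ ((2 * (c + 1) + 2 * (4 + 3 * c / κ)) * (J * D + Z)) / jb t := by
          have : 0 ≤ c / κ := by positivity
          have h10 : 3 * c / κ = 3 * (c / κ) := by ring
          have h11 : 0 ≤ J * D := by positivity
          gcongr
          rw [h10]
          nlinarith [mul_nonneg this h11, mul_nonneg this hZ, mul_nonneg hc.le h11, mul_nonneg hc.le hZ]
      _ = _ := by ring

lemma nullCond_rel {c : ℝ} (hc : c ≠ 0) {H : Fin 4 → Fin 4 → ℝ} (h : nullCond c H) :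
    (H 1 1 = -c^2 * H 0 0 ∧ H 2 2 = -c^2 * H 0 0 ∧ H 3 3 = -c^2 * H 0 0) ∧
    (H 1 0 = - H 0 1 ∧ H 2 0 = - H 0 2 ∧ H 3 0 = - H 0 3) ∧
    (H 2 1 = - H 1 2 ∧ H 3 1 = - H 1 3 ∧ H 3 2 = - H 2 3) := by
  have a1 := h ![c, 1, 0, 0] (by simp)
  have b1 := h ![c, -1, 0, 0] (by simp)
  have a2 := h ![c, 0, 1, 0] (by simp)
  have b2 := h ![c, 0, -1, 0] (by simp)
  have a3 := h ![c, 0, 0, 1] (by simp)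
  have b3 := h ![c, 0, 0, -1] (by simp)
  have s2 : Real.sqrt 2 ^ 2 = 2 := Real.sq_sqrt (by norm_num)
  have d1 := h ![c * Real.sqrt 2, 1, 1, 0] (by simp; linear_combination c^2 * s2)
  have d2 := h ![c * Real.sqrt 2, 1, 0, 1] (by simp; linear_combination c^2 * s2)
  have d3 := h ![c * Real.sqrt 2, 0, 1, 1] (by simp; linear_combination c^2 * s2)
  simp [Fin.sum_univ_four] at a1 b1 a2 b2 a3 b3 d1 d2 d3
  have e1 : H 1 0 + H 0 1 = 0 := by
    have : c * (H 1 0 + H 0 1) = 0 := by linarith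
    exact (mul_eq_zero.1 this).resolve_left hc
  have e2 : H 2 0 + H 0 2 = 0 := by
    have : c * (H 2 0 + H 0 2) = 0 := by linarith
    exact (mul_eq_zero.1 this).resolve_left hc
  have e3 : H 3 0 + H 0 3 = 0 := by
    have : c * (H 3 0 + H 0 3) = 0 := by linarith
    exact (mul_eq_zero.1 this).resolve_left hc
  have f1 : H 1 1 = -c^2 * H 0 0 := by linarith
  have f2 : H 2 2 = -c^2 * H 0 0 := by linarith
  have f3 : H 3 3 = -c^2 * H 0 0 := by linarith
  refine ⟨⟨f1, f2, f3⟩, ⟨by linarith, by linarith, by linarith⟩, ?_, ?_, ?_⟩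
  · linear_combination d1 - f1 - f2 - c * √2 * (e1 + e2) - c^2 * H 0 0 * s2
  · linear_combination d2 - f1 - f3 - c * √2 * (e1 + e3) - c^2 * H 0 0 * s2
  · linear_combination d3 - f2 - f3 - c * √2 * (e2 + e3) - c^2 * H 0 0 * s2

lemma act_nullCond {c : ℝ} (hc : c ≠ 0) (i : Fin 7) (H : Fin 4 → Fin 4 → ℝ)
    (h : nullCond c H) : nullCond c (act i H) := by
  obtain ⟨⟨f1, f2, f3⟩, ⟨e1, e2, e3⟩, d1, d2, d3⟩ := nullCond_rel hc h
  intro X hX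
  fin_cases i <;>
    simp [Fin.sum_univ_four, act, kk, f1, f2, f3, e1, e2, e3, d1, d2, d3] <;>
    first
      | ring1
      | linear_combination (-2 * H 0 0) * hX

lemma nullQ_bound {c : ℝ} (hc : 0 < c) {H : Fin 4 → Fin 4 → ℝ} (h : nullCond c H) :
    ∃ C : ℝ, 0 ≤ C ∧ ∀ (v w : Fn) (t : ℝ) (x : Sp), x ≠ 0 →
      |nullQ H v w (t, x)| ≤ C * ((∑ j : Fin 3, |Tder c j v (t, x)|) * pdNorm w (t, x)
        + pdNorm v (t, x) * ∑ j : Fin 3, |Tder c j w (t, x)|) := by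
  set M := ∑ α : Fin 4, ∑ β : Fin 4, |H α β| with hM
  have hMn : 0 ≤ M := Finset.sum_nonneg fun _ _ => Finset.sum_nonneg fun _ _ => abs_nonneg _
  refine ⟨M * ((1 + 1 / c) * (1 / c)) + M * (1 / c), by positivity, fun v w t x hx => ?_⟩
  have hr : 0 < ‖x‖ := norm_pos_iff.2 hx
  set Tv := ∑ j : Fin 3, |Tder c j v (t, x)| with hTv
  set Tw := ∑ j : Fin 3, |Tder c j w (t, x)| with hTw
  have hTvn : 0 ≤ Tv := Finset.sum_nonneg fun _ _ => abs_nonneg _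
  have hTwn : 0 ≤ Tw := Finset.sum_nonneg fun _ _ => abs_nonneg _
  have hDv := pdNorm_nonneg v (t, x)
  have hDw := pdNorm_nonneg w (t, x)
  set X : Fin 4 → ℝ := Fin.cases 1 (fun j => - (x j / ‖x‖) / c) with hXdef
  have hX : ∑ α : Fin 4, ∑ β : Fin 4, H α β * X α * X β = 0 := by
    refine h X ?_
    have h2 := norm_sq_eq x
    have e1 : X 1 = - (x 0 / ‖x‖) / c := rfl
    have e2 : X 2 = - (x 1 / ‖x‖) / c := rfl
    have e3 : X 3 = - (x 2 / ‖x‖) / c := rfl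
    have e0 : X 0 = 1 := rfl
    rw [e0, e1, e2, e3]
    field_simp
    linarith
  have hXb : ∀ α, |X α| ≤ 1 + 1 / c := by
    intro α
    have hc1 : 0 ≤ 1 / c := by positivity
    refine Fin.cases ?_ (fun j => ?_) α
    · change |(1 : ℝ)| ≤ _; rw [abs_one]; linarith
    · change |- (x j / ‖x‖) / c| ≤ _
      rw [abs_div, abs_neg, abs_div, abs_of_pos hr, abs_of_pos hc]
      have : |x j| / ‖x‖ ≤ 1 := div_le_one_of_le₀ (abs_coord_le x j) hr.le
      calc |x j| / ‖x‖ / c ≤ 1 / c := by gcongr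
        _ ≤ _ := by linarith
  have hA : ∀ (v : Fn) (α : Fin 4), |pd α v (t, x) - pd 0 v (t, x) * X α|
      ≤ (1 / c) * ∑ j : Fin 3, |Tder c j v (t, x)| := by
    intro v α
    have hs : 0 ≤ ∑ j : Fin 3, |Tder c j v (t, x)| := Finset.sum_nonneg fun _ _ => abs_nonneg _
    refine Fin.cases ?_ (fun j => ?_) α
    · change |pd 0 v (t, x) - pd 0 v (t, x) * 1| ≤ _
      rw [mul_one, sub_self, abs_zero]; positivity
    · change |pd j.succ v (t, x) - pd 0 v (t, x) * (- (x j / ‖x‖) / c)| ≤ _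
      have : pd j.succ v (t, x) - pd 0 v (t, x) * (- (x j / ‖x‖) / c)
          = (1 / c) * Tder c j v (t, x) := by
        rw [pd_succ, pd_zero]; simp only [Tder]; field_simp; ring
      rw [this, abs_mul, abs_of_pos (by positivity : 0 < 1 / c)]
      refine mul_le_mul_of_nonneg_left ?_ (by positivity)
      exact Finset.single_le_sum (f := fun j => |Tder c j v (t, x)|) (fun i _ => abs_nonneg _)
        (Finset.mem_univ j)
  have hsplit : nullQ H v w (t, x) = ∑ α : Fin 4, ∑ β : Fin 4, (
      pd 0 v (t, x) * pd 0 w (t, x) * (H α β * X α * X β)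
      + H α β * (pd 0 v (t, x) * X α * (pd β w (t, x) - pd 0 w (t, x) * X β))
      + H α β * ((pd α v (t, x) - pd 0 v (t, x) * X α) * pd β w (t, x))) := by
    unfold nullQ
    refine Finset.sum_congr rfl fun α _ => Finset.sum_congr rfl fun β _ => ?_
    ring
  have hzero : ∑ α : Fin 4, ∑ β : Fin 4, pd 0 v (t, x) * pd 0 w (t, x) * (H α β * X α * X β) = 0 := by
    simp only [← Finset.mul_sum, hX, mul_zero]
  have : nullQ H v w (t, x) = ∑ α : Fin 4, ∑ β : Fin 4, (
      H α β * (pd 0 v (t, x) * X α * (pd β w (t, x) - pd 0 w (t, x) * X β))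
      + H α β * ((pd α v (t, x) - pd 0 v (t, x) * X α) * pd β w (t, x))) := by
    rw [hsplit]
    simp only [Finset.sum_add_distrib, hzero, zero_add]
  rw [this]
  refine (Finset.abs_sum_le_sum_abs _ _).trans ((Finset.sum_le_sum fun α _ =>
    Finset.abs_sum_le_sum_abs _ _).trans ?_)
  have hterm : ∀ α β : Fin 4,
      |H α β * (pd 0 v (t, x) * X α * (pd β w (t, x) - pd 0 w (t, x) * X β))
      + H α β * ((pd α v (t, x) - pd 0 v (t, x) * X α) * pd β w (t, x))|
      ≤ |H α β| * (((1 + 1 / c) * (1 / c) + 1 / c) * (Tv * pdNorm w (t, x) + pdNorm v (t, x) * Tw)) := by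
    intro α β
    rw [← mul_add, abs_mul]
    refine mul_le_mul_of_nonneg_left ?_ (abs_nonneg _)
    refine (abs_add_le _ _).trans ?_
    simp only [abs_mul]
    have g1 : |pd 0 v (t, x)| * |X α| * |pd β w (t, x) - pd 0 w (t, x) * X β|
        ≤ pdNorm v (t, x) * (1 + 1 / c) * ((1 / c) * Tw) := by
      have := abs_pd_le v (t, x) 0
      have := hXb α
      have := hA w β
      gcongr
    have g2 : |pd α v (t, x) - pd 0 v (t, x) * X α| * |pd β w (t, x)|
        ≤ (1 / c) * Tv * pdNorm w (t, x) := by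
      have := hA v α
      have := abs_pd_le w (t, x) β
      gcongr
    refine (add_le_add g1 g2).trans ?_
    have h1 : 0 ≤ (1 + 1 / c) * (1 / c) := by positivity
    have h2 : 0 ≤ 1 / c := by positivity
    nlinarith [mul_nonneg h1 (mul_nonneg hTvn hDw), mul_nonneg h2 (mul_nonneg hDv hTwn)]
  refine (Finset.sum_le_sum fun α _ => Finset.sum_le_sum fun β _ => hterm α β).trans (le_of_eq ?_)
  simp only [← Finset.sum_mul]
  ring

lemma nullQ_decay {c κ : ℝ} (hc : 0 < c) (hκ : 0 < κ) {H : Fin 4 → Fin 4 → ℝ} (h : nullCond c H) :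
    ∃ C : ℝ, 0 ≤ C ∧ ∀ (v w : Fn) (t : ℝ) (x : Sp), 0 ≤ t → κ * jb t ≤ ‖x‖ →
      |nullQ H v w (t, x)| ≤ C / jb t *
        ((jb (c * t - ‖x‖) * pdNorm v (t, x) + ZN v (t, x)) * pdNorm w (t, x)
        + pdNorm v (t, x) * (jb (c * t - ‖x‖) * pdNorm w (t, x) + ZN w (t, x))) := by
  obtain ⟨C₁, h1, hQ⟩ := nullQ_bound hc h
  obtain ⟨C₂, h2, hT⟩ := Tder_bound hc hκ
  refine ⟨C₁ * (3 * C₂), by positivity, fun v w t x ht hx => ?_⟩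
  have hx0 : x ≠ 0 := norm_pos_iff.1 (lt_of_lt_of_le (mul_pos hκ (jb_pos t)) hx)
  have key : ∀ v : Fn, ∑ j : Fin 3, |Tder c j v (t, x)| ≤
      3 * (C₂ / jb t * (jb (c * t - ‖x‖) * pdNorm v (t, x) + ZN v (t, x))) := fun v => by
    refine (Finset.sum_le_sum fun j _ => hT v t x j ht hx).trans (by simp)
  refine (hQ v w t x hx0).trans ?_
  have hDv := pdNorm_nonneg v (t, x)
  have hDw := pdNorm_nonneg w (t, x)
  calc _ ≤ C₁ * (3 * (C₂ / jb t * (jb (c * t - ‖x‖) * pdNorm v (t, x) + ZN v (t, x))) * pdNorm w (t, x)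
        + pdNorm v (t, x) * (3 * (C₂ / jb t * (jb (c * t - ‖x‖) * pdNorm w (t, x) + ZN w (t, x))))) := by
        have := key v
        have := key w
        gcongr
    _ = _ := by ring

/-- `f` vanishes outside the closed ball of radius `R`. -/
def SuppIn {E : Type*} [Zero E] (R : ℝ) (f : Sp → E) : Prop := ∀ x, R < ‖x‖ → f x = 0

lemma SuppIn.compact {E : Type*} [Zero E] {R : ℝ} {f : Sp → E} (h : SuppIn R f) :
    HasCompactSupport f :=
  HasCompactSupport.intro (isCompact_closedBall (0 : Sp) R) fun x hx => h x (by
    simpa [Metric.mem_closedBall] using hx)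

lemma SuppIn.integrable {E : Type*} [NormedAddCommGroup E] {R : ℝ} {f : Sp → E} (h : SuppIn R f)
    (hf : Continuous f) : Integrable f := hf.integrable_of_hasCompactSupport h.compact

lemma SuppIn.mul_right {R : ℝ} {f : Sp → ℝ} (h : SuppIn R f) (g : Sp → ℝ) :
    SuppIn R (fun x => f x * g x) := fun x hx => by simp [h x hx]

lemma SuppIn.mul_left {R : ℝ} {f : Sp → ℝ} (h : SuppIn R f) (g : Sp → ℝ) :
    SuppIn R (fun x => g x * f x) := fun x hx => by simp [h x hx]

lemma SuppIn.fderiv {R : ℝ} {f : Sp → ℝ} (h : SuppIn R f) : SuppIn R (fderiv ℝ f) := fun x hx => by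
  have : f =ᶠ[nhds x] fun _ => 0 := by
    have : {y : Sp | R < ‖y‖} ∈ nhds x := (isOpen_lt continuous_const continuous_norm).mem_nhds hx
    filter_upwards [this] with y hy using h y hy
  rw [this.fderiv_eq]; simp

lemma integral_dir_deriv_eq_zero {R : ℝ} {g : Sp → ℝ} (h : SuppIn R g) (hg : ContDiff ℝ 1 g) (v : Sp) :
    ∫ x, fderiv ℝ g x v = 0 := by
  have hc : Continuous fun x => fderiv ℝ g x v := (hg.continuous_fderiv (by simp)).clm_apply continuous_const
  have hs : SuppIn R fun x => fderiv ℝ g x v := fun x hx => by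
    simp [h.fderiv x hx]
  have := integral_mul_fderiv_eq_neg_fderiv_mul_of_integrable (μ := (volume : Measure Sp)) (𝕜 := ℝ)
    (f := fun _ => (1 : ℝ)) (g := g) (v := v) (by simp)
    (by simpa using hs.integrable hc) (by simpa using h.integrable hg.continuous)
    (fun x _ => differentiableAt_const _) (fun x _ => hg.differentiable (by simp) x)
  simpa using this

/-- The time slice of a field. -/
def sl (f : Fn) (t : ℝ) : Sp → ℝ := fun x => f (t, x)

lemma Sm.slice {f : Fn} (h : Sm f) (t : ℝ) : ContDiff ℝ (⊤ : ℕ∞) (sl f t) :=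
  ContDiff.comp h (contDiff_prodMk_right t)

lemma Sm.slice_cont {f : Fn} (h : Sm f) (t : ℝ) : Continuous (sl f t) := (h.slice t).continuous

lemma fderiv_sl {f : Fn} (h : Sm f) (t : ℝ) (x : Sp) (j : Fin 3) :
    fderiv ℝ (sl f t) x (EuclideanSpace.single j 1) = px j f (t, x) := by
  have h1 : HasFDerivAt (fun x : Sp => (t, x)) (ContinuousLinearMap.inr ℝ ℝ Sp) x :=
    hasFDerivAt_prodMk_right t x
  have h2 := (h.diff (t, x)).hasFDerivAt.comp x h1
  have h3 : fderiv ℝ (sl f t) x = _ := h2.fderiv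
  rw [h3]; simp [px]

lemma hasDerivAt_time {f : Fn} (h : Sm f) (t : ℝ) (x : Sp) :
    HasDerivAt (fun s => f (s, x)) (pt f (t, x)) t := by
  have h1 : HasFDerivAt (fun s : ℝ => (s, x)) (ContinuousLinearMap.inl ℝ ℝ Sp) t :=
    hasFDerivAt_prodMk_left t x
  have h2 := ((h.diff (t, x)).hasFDerivAt.comp t h1).hasDerivAt
  exact h2.congr_deriv (by simp [pt])

/-- `f` vanishes for times in `O` outside a fixed ball. -/
def VanOut (O : Set ℝ) (R : ℝ) (f : Fn) : Prop := ∀ t ∈ O, ∀ x : Sp, R < ‖x‖ → f (t, x) = 0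

lemma VanOut.open_eq {O : Set ℝ} (hO : IsOpen O) (R : ℝ) :
    IsOpen {p : Pt | p.1 ∈ O ∧ R < ‖p.2‖} :=
  (hO.preimage continuous_fst).inter (isOpen_lt continuous_const continuous_snd.norm)

lemma VanOut.pd {O : Set ℝ} {R : ℝ} {f : Fn} (h : VanOut O R f) (hO : IsOpen O) (α : Fin 4) :
    VanOut O R (pd α f) := fun t ht x hx => by
  rw [pd_congr_on (VanOut.open_eq hO R) (g := 0) (fun p hp => h p.1 hp.1 p.2 hp.2) α (t, x) ⟨ht, hx⟩,
    pd_zero_fn]; rfl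

lemma VanOut.zw {O : Set ℝ} {R : ℝ} {f : Fn} (h : VanOut O R f) (hO : IsOpen O) (l : List (Fin 7)) :
    VanOut O R (Zw l f) := fun t ht x hx => by
  rw [Zw_congr_on (VanOut.open_eq hO R) (g := 0) (fun p hp => h p.1 hp.1 p.2 hp.2) l (t, x) ⟨ht, hx⟩,
    Zw_zero]; rfl

lemma VanOut.slice {O : Set ℝ} {R : ℝ} {f : Fn} (h : VanOut O R f) {t : ℝ} (ht : t ∈ O) :
    SuppIn R (sl f t) := fun x hx => h t ht x hx

lemma hasDerivAt_integral_slice {f : Fn} (hf : Sm f) {O : Set ℝ} (hO : IsOpen O) {R : ℝ}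
    (h : VanOut O R f) {t : ℝ} (ht : t ∈ O) :
    HasDerivAt (fun s => ∫ x, f (s, x)) (∫ x, pt f (t, x)) t := by
  obtain ⟨ε, hε, hball⟩ := Metric.nhds_basis_closedBall.mem_iff.1 (hO.mem_nhds ht)
  have hd : VanOut O R (pt f) := h.pd hO 0
  obtain ⟨C, hC⟩ := ((isCompact_closedBall t ε).prod (isCompact_closedBall (0 : Sp) R)).exists_bound_of_continuousOn
    (f := pt f) (hf.pt.continuous.continuousOn)
  have hC' : ∀ s ∈ Metric.closedBall t ε, ∀ x : Sp, ‖pt f (s, x)‖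
      ≤ (Metric.closedBall (0 : Sp) R).indicator (fun _ => C) x := by
    intro s hs x
    by_cases hx : x ∈ Metric.closedBall (0 : Sp) R
    · rw [indicator_of_mem hx]; exact hC (s, x) ⟨hs, hx⟩
    · rw [indicator_of_notMem hx, hd s (hball hs) x (by simpa using hx)]; simp
  refine (hasDerivAt_integral_of_dominated_loc_of_deriv_le
    (F := fun s x => f (s, x)) (F' := fun s x => pt f (s, x))
    (bound := (Metric.closedBall (0 : Sp) R).indicator fun _ => C)
    (Metric.closedBall_mem_nhds t hε) ?_ ?_ ?_ ?_ ?_ ?_).2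
  · exact Filter.Eventually.of_forall fun s => (hf.slice_cont s).aestronglyMeasurable
  · exact (h.slice ht).integrable (hf.slice_cont t)
  · exact (hf.pt.slice_cont t).aestronglyMeasurable
  · exact Filter.Eventually.of_forall fun x s hs => hC' s hs x
  · rw [integrable_indicator_iff Metric.isClosed_closedBall.measurableSet]
    exact integrableOn_const (by exact (isCompact_closedBall (0 : Sp) R).measure_lt_top.ne)
  · exact Filter.Eventually.of_forall fun x s _ => hasDerivAt_time hf s x

/-- The energy density. -/
def en (c : ℝ) (v : Fn) : Fn := fun p =>
  (1/2) * ((pt v p)^2 + c^2 * ∑ j : Fin 3, (px j v p)^2)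

lemma Sm.en {v : Fn} (h : Sm v) (c : ℝ) : Sm (en c v) := by
  unfold MultiSpeedWave.en
  exact contDiff_const.mul ((h.pt.pow 2).add (contDiff_const.mul (ContDiff.sum fun j _ => (h.px j).pow 2)))

lemma en_nonneg (c : ℝ) (v : Fn) (p : Pt) : 0 ≤ en c v p := by
  unfold en
  have : 0 ≤ ∑ j : Fin 3, (px j v p)^2 := Finset.sum_nonneg fun _ _ => sq_nonneg _
  positivity

lemma energy_eq (c : ℝ) (v : Fn) (t : ℝ) : energy c v t = ∫ x, en c v (t, x) := by
  unfold energy en; rw [integral_const_mul]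

/-- The flux `ψ ∂_t v ∂_j v`. -/
def flux (ψ v : Fn) (j : Fin 3) : Fn := ψ * (px j v * pt v)

/-- The source in the weighted energy identity. -/
def esrc (c : ℝ) (ψ v : Fn) : Fn := fun p => pt ψ p * en c v p + ψ p * (pt v p * boxOp c v p)
  - c^2 * ∑ j : Fin 3, px j ψ p * (px j v p * pt v p)

lemma Sm.flux {ψ v : Fn} (hψ : Sm ψ) (hv : Sm v) (j : Fin 3) : Sm (flux ψ v j) :=
  hψ.mul' ((hv.px j).mul' hv.pt)

lemma pt_en {v : Fn} (hv : Sm v) (c : ℝ) : pt (en c v)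
    = pt v * pt (pt v) + c^2 • ∑ j : Fin 3, px j v * px j (pt v) := by
  have h1 : en c v = (1/2 : ℝ) • (pt v * pt v + (c^2) • ∑ j : Fin 3, px j v * px j v) := by
    funext p; simp [en, sq]
  have hs : ∀ j : Fin 3, Sm (px j v * px j v) := fun j => (hv.px j).mul' (hv.px j)
  have hc : ∀ j : Fin 3, pt (px j v) = px j (pt v) := fun j => pd_comm hv 0 j.succ
  rw [← pd_zero, h1, pd_smul ((hv.pt.mul' hv.pt).add' ((Sm.sum' _ hs).smul' _)),
    pd_add (hv.pt.mul' hv.pt) ((Sm.sum' _ hs).smul' _), pd_mul hv.pt hv.pt, pd_smul (Sm.sum' _ hs),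
    pd_sum _ hs]
  simp only [fun j => pd_mul (hv.px j) (hv.px j) 0, pd_zero, hc]
  funext p
  simp [Fin.sum_univ_three]
  ring

lemma weighted_energy_identity {ψ v : Fn} (hψ : Sm ψ) (hv : Sm v) (c : ℝ) :
    pt (ψ * en c v) = fun p => esrc c ψ v p + c^2 * ∑ j : Fin 3, px j (flux ψ v j) p := by
  have h1 : pt (ψ * en c v) = _ := pd_mul hψ (hv.en c) 0
  have h2 : ∀ j : Fin 3, px j (flux ψ v j) = px j ψ * (px j v * pt v)
      + ψ * (px j (px j v) * pt v + px j v * px j (pt v)) := fun j => by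
    have a : px j (flux ψ v j) = _ := pd_mul hψ ((hv.px j).mul' hv.pt) j.succ
    have b : px j (px j v * pt v) = _ := pd_mul (hv.px j) hv.pt j.succ
    rw [a, pd_succ, pd_succ, b]; rfl
  rw [h1]
  simp only [h2, pd_zero, pt_en hv]
  funext p
  simp [esrc, boxOp, Fin.sum_univ_three]
  ring

lemma hasDerivAt_weighted_energy {ψ v : Fn} (hψ : Sm ψ) (hv : Sm v) (c : ℝ) {O : Set ℝ}
    (hO : IsOpen O) {R : ℝ} (h1 : VanOut O R (ψ * en c v)) (h2 : ∀ j, VanOut O R (flux ψ v j))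
    {t : ℝ} (ht : t ∈ O) :
    HasDerivAt (fun s => ∫ x, (ψ * en c v) (s, x)) (∫ x, esrc c ψ v (t, x)) t := by
  have hE := hasDerivAt_integral_slice (hψ.mul' (hv.en c)) hO h1 ht
  have hid := weighted_energy_identity hψ hv c
  have hdiv : ∀ j : Fin 3, Integrable (fun x => px j (flux ψ v j) (t, x)) := fun j =>
    (((h2 j).pd hO j.succ).slice ht).integrable (((hψ.flux hv j).px j).slice_cont t)
  have hdiv0 : ∀ j : Fin 3, ∫ x, px j (flux ψ v j) (t, x) = 0 := fun j => by
    have := integral_dir_deriv_eq_zero ((h2 j).slice ht) (((hψ.flux hv j).slice t).of_le (by exact_mod_cast le_top))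
      (EuclideanSpace.single j 1)
    simpa only [fderiv_sl (hψ.flux hv j)] using this
  have hI : Integrable (fun x => pt (ψ * en c v) (t, x)) :=
    ((h1.pd hO 0).slice ht).integrable ((hψ.mul' (hv.en c)).pt.slice_cont t)
  have hsrc : ∀ x, esrc c ψ v (t, x) = pt (ψ * en c v) (t, x)
      - c^2 * ∑ j : Fin 3, px j (flux ψ v j) (t, x) := fun x => by rw [hid]; ring
  have : ∫ x, esrc c ψ v (t, x) = ∫ x, pt (ψ * en c v) (t, x) := by
    simp only [hsrc]
    rw [integral_sub hI ((integrable_finsetSum _ fun j _ => hdiv j).const_mul _), integral_const_mul,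
      integral_finsetSum _ fun j _ => hdiv j]
    simp [hdiv0]
  rw [this]
  exact hE

lemma hasDerivAt_energy {v : Fn} (hv : Sm v) (c : ℝ) {O : Set ℝ} (hO : IsOpen O) {R : ℝ}
    (h : VanOut O R v) {t : ℝ} (ht : t ∈ O) :
    HasDerivAt (fun s => energy c v s) (∫ x, pt v (t, x) * boxOp c v (t, x)) t := by
  have h0 : ∀ s ∈ O, ∀ x : Sp, R < ‖x‖ → ∀ α, pd α v (s, x) = 0 := fun s hs x hx α => h.pd hO α s hs x hx
  have hone : Sm (fun _ : Pt => (1 : ℝ)) := contDiff_const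
  have hd1 : ∀ p, pt (fun _ : Pt => (1 : ℝ)) p = 0 := fun p => congrFun (pd_const 1 0) p
  have hd2 : ∀ j p, px j (fun _ : Pt => (1 : ℝ)) p = 0 := fun j p => congrFun (pd_const 1 j.succ) p
  have key := hasDerivAt_weighted_energy hone hv c hO (R := R) ?_ ?_ ht
  · have e1 : (fun s => energy c v s) = fun s => ∫ x, ((fun _ : Pt => (1 : ℝ)) * en c v) (s, x) := by
      funext s; rw [energy_eq]; simp
    have e2 : ∀ x, esrc c (fun _ => 1) v (t, x) = pt v (t, x) * boxOp c v (t, x) := fun x => by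
      simp [esrc, hd1, hd2]
    rw [e1]
    simpa only [e2] using key
  · intro s hs x hx
    have a0 : pt v (s, x) = 0 := h0 s hs x hx 0
    have aj : ∀ j, px j v (s, x) = 0 := fun j => h0 s hs x hx j.succ
    simp [en, a0, aj]
  · intro j s hs x hx
    have a0 : pt v (s, x) = 0 := h0 s hs x hx 0
    simp [flux, a0]

lemma cubicLike_bound {P : MvPolynomial (Fin 3 × Fin 4) ℝ} (hP : CubicLike P) (M : ℝ) :
    ∃ L : ℝ, 0 ≤ L ∧ ∀ x : Fin 3 × Fin 4 → ℝ, (∀ q, |x q| ≤ M) →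
      |MvPolynomial.eval x P| ≤ L * ∑ q, |x q| := by
  have hsm : ContDiff ℝ 1 (fun x : Fin 3 × Fin 4 → ℝ => MvPolynomial.eval x P) := by
    rw [← contDiffOn_univ]
    exact (AnalyticOnNhd.eval_mvPolynomial P).contDiffOn uniqueDiffOn_univ
  have h0 : MvPolynomial.eval (0 : Fin 3 × Fin 4 → ℝ) P = 0 := by
    rw [MvPolynomial.eval_zero, MvPolynomial.constantCoeff_eq]
    by_contra h
    have := hP 0 (MvPolynomial.mem_support_iff.2 h)
    simp at this
  obtain ⟨K, hK⟩ := (hsm.locallyLipschitz.locallyLipschitzOn (s := Metric.closedBall 0 (max M 0))).exists_lipschitzOnWith_of_compact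
    (isCompact_closedBall (0 : Fin 3 × Fin 4 → ℝ) (max M 0))
  refine ⟨K, K.2, fun x hx => ?_⟩
  have hxm : x ∈ Metric.closedBall (0 : Fin 3 × Fin 4 → ℝ) (max M 0) := by
    rw [mem_closedBall_zero_iff, pi_norm_le_iff_of_nonneg (le_max_right _ _)]
    exact fun q => (hx q).trans (le_max_left _ _)
  have h := hK.dist_le_mul x hxm 0 (by simp)
  rw [h0, dist_zero_right, dist_zero_right] at h
  refine h.trans (mul_le_mul_of_nonneg_left ?_ K.2)
  rw [pi_norm_le_iff_of_nonneg (Finset.sum_nonneg fun _ _ => abs_nonneg _)]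
  exact fun q => Finset.single_le_sum (f := fun q => |x q|) (fun _ _ => abs_nonneg _) (Finset.mem_univ q)

lemma rhs_bound (F : Coef) {Cub : Fin 3 → MvPolynomial (Fin 3 × Fin 4) ℝ}
    (hCub : ∀ i, CubicLike (Cub i)) (M : ℝ) :
    ∃ L : ℝ, 0 ≤ L ∧ ∀ (u : Fin 3 → Fn) (p : Pt), (∀ i α, |pd α (u i) p| ≤ M) →
      ∀ i, |rhs F Cub u i p| ≤ L * ∑ q : Fin 3 × Fin 4, |pd q.2 (u q.1) p| := by
  choose L1 hL1 hb using fun i => cubicLike_bound (hCub i) M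
  set L2 : Fin 3 → ℝ := fun i => ∑ j : Fin 3, ∑ k : Fin 3, ∑ α : Fin 4, ∑ β : Fin 4, |F i j k α β| * |M|
  have hL2 : ∀ i, 0 ≤ L2 i := fun i => Finset.sum_nonneg fun _ _ => Finset.sum_nonneg fun _ _ =>
    Finset.sum_nonneg fun _ _ => Finset.sum_nonneg fun _ _ => by positivity
  refine ⟨∑ i, (L2 i + L1 i), Finset.sum_nonneg fun i _ => add_nonneg (hL2 i) (hL1 i), fun u p hM i => ?_⟩
  set Sg := ∑ q : Fin 3 × Fin 4, |pd q.2 (u q.1) p|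
  have hS : 0 ≤ Sg := Finset.sum_nonneg fun _ _ => abs_nonneg _
  have hq : ∀ k β, |pd β (u k) p| ≤ Sg := fun k β =>
    Finset.single_le_sum (f := fun q : Fin 3 × Fin 4 => |pd q.2 (u q.1) p|) (fun _ _ => abs_nonneg _)
      (Finset.mem_univ (k, β))
  have h1 : |∑ j : Fin 3, ∑ k : Fin 3, ∑ α : Fin 4, ∑ β : Fin 4,
      F i j k α β * pd α (u j) p * pd β (u k) p| ≤ L2 i * Sg := by
    simp only [L2, Finset.sum_mul]
    refine (Finset.abs_sum_le_sum_abs _ _).trans (Finset.sum_le_sum fun j _ => ?_)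
    refine (Finset.abs_sum_le_sum_abs _ _).trans (Finset.sum_le_sum fun k _ => ?_)
    refine (Finset.abs_sum_le_sum_abs _ _).trans (Finset.sum_le_sum fun α _ => ?_)
    refine (Finset.abs_sum_le_sum_abs _ _).trans (Finset.sum_le_sum fun β _ => ?_)
    rw [abs_mul, abs_mul]
    exact mul_le_mul (mul_le_mul_of_nonneg_left ((hM j α).trans (le_abs_self M)) (abs_nonneg _)) (hq k β)
      (abs_nonneg _) (by positivity)
  have h2 : |cubicEval (Cub i) u p| ≤ L1 i * Sg := hb i _ fun q => hM q.1 q.2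
  have h3 : L2 i + L1 i ≤ ∑ i, (L2 i + L1 i) :=
    Finset.single_le_sum (f := fun i => L2 i + L1 i) (fun i _ => add_nonneg (hL2 i) (hL1 i)) (Finset.mem_univ i)
  calc |rhs F Cub u i p| ≤ L2 i * Sg + L1 i * Sg := (abs_add_le _ _).trans (add_le_add h1 h2)
    _ = (L2 i + L1 i) * Sg := by ring
    _ ≤ _ := mul_le_mul_of_nonneg_right h3 hS

lemma gronwall_zero {g g' : ℝ → ℝ} {L b : ℝ} (hb : 0 ≤ b)
    (hd : ∀ s ∈ Icc 0 b, HasDerivAt g (g' s) s) (hle : ∀ s ∈ Icc 0 b, g' s ≤ L * g s)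
    (h0 : g 0 = 0) (hpos : 0 ≤ g b) : g b = 0 := by
  have hd' : ∀ s ∈ Icc 0 b, HasDerivAt (fun s => rexp (-L * s) * g s)
      (rexp (-L * s) * (g' s - L * g s)) s := fun s hs => by
    have h1 : HasDerivAt (fun s => rexp (-L * s)) (rexp (-L * s) * (-L)) s := by
      simpa using ((hasDerivAt_id s).const_mul (-L)).exp
    exact (h1.mul (hd s hs)).congr_deriv (by ring)
  have hanti : AntitoneOn (fun s => rexp (-L * s) * g s) (Icc 0 b) := by
    refine antitoneOn_of_deriv_nonpos (convex_Icc 0 b) (fun s hs => (hd' s hs).continuousAt.continuousWithinAt)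
      (fun s hs => (hd' s (interior_subset hs)).differentiableAt.differentiableWithinAt) fun s hs => ?_
    rw [(hd' s (interior_subset hs)).deriv]
    exact mul_nonpos_of_nonneg_of_nonpos (exp_pos _).le (by linarith [hle s (interior_subset hs)])
  have := hanti (left_mem_Icc.2 hb) (right_mem_Icc.2 hb) hb
  simp only [h0, mul_zero] at this
  have h2 : g b ≤ 0 := by
    by_contra h
    push Not at h
    exact absurd this (not_le.2 (mul_pos (exp_pos _) h))
  exact le_antisymm h2 hpos

/-- A smooth weight supported in a (regularised) backward light cone. -/
def coneW (A a t1 : ℝ) (y : Sp) : Fn := fun p =>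
  Real.smoothTransition (A + 1 - a * (p.1 - t1) - jb ‖p.2 - y‖)

lemma jbnorm_smooth : ContDiff ℝ (⊤ : ℕ∞) (fun z : Sp => jb ‖z‖) := by
  unfold jb
  exact ContDiff.sqrt (contDiff_const.add (contDiff_norm_sq ℝ)) fun x => by positivity

lemma jbnorm_deriv (z v : Sp) : |fderiv ℝ (fun z : Sp => jb ‖z‖) z v| ≤ ‖v‖ := by
  have hl : LipschitzWith 1 (fun z : Sp => jb ‖z‖) := by
    refine LipschitzWith.of_le_add fun a b => ?_
    have h1 := jb_lip ‖a‖ ‖b‖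
    have h2 := abs_norm_sub_norm_le a b
    rw [dist_eq_norm]; linarith
  have := norm_fderiv_le_of_lipschitz ℝ hl (x₀ := z)
  calc |fderiv ℝ (fun z : Sp => jb ‖z‖) z v| ≤ ‖fderiv ℝ (fun z : Sp => jb ‖z‖) z‖ * ‖v‖ :=
        (fderiv ℝ (fun z : Sp => jb ‖z‖) z).le_opNorm v
    _ ≤ 1 * ‖v‖ := mul_le_mul_of_nonneg_right (by simpa using this) (norm_nonneg _)
    _ = ‖v‖ := one_mul _

lemma jbnorm_grad (z : Sp) :
    ∑ j : Fin 3, (fderiv ℝ (fun z : Sp => jb ‖z‖) z (EuclideanSpace.single j 1))^2 ≤ 1 := by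
  set f := fun z : Sp => jb ‖z‖
  set d : Fin 3 → ℝ := fun j => fderiv ℝ f z (EuclideanSpace.single j 1)
  set w : Sp := ∑ j : Fin 3, d j • EuclideanSpace.single j (1 : ℝ)
  have hw : fderiv ℝ f z w = ∑ j, d j ^ 2 := by
    simp only [w, map_sum, map_smul, smul_eq_mul]
    exact Finset.sum_congr rfl fun j _ => by simp only [d]; ring
  have hn : ‖w‖ ^ 2 = ∑ j, d j ^ 2 := by
    have hc : ∀ i, w i = d i := fun i => by
      fin_cases i <;> simp [w, Fin.sum_univ_three]
    rw [norm_sq_eq]; simp [hc, Fin.sum_univ_three]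
  have h1 := jbnorm_deriv z w
  change |fderiv ℝ f z w| ≤ ‖w‖ at h1
  rw [hw, ← hn, abs_of_nonneg (sq_nonneg _)] at h1
  change ∑ j, d j ^ 2 ≤ 1
  rw [← hn]
  nlinarith [norm_nonneg w]

lemma coneW_arg_smooth (A a t1 : ℝ) (y : Sp) :
    Sm (fun p : Pt => A + 1 - a * (p.1 - t1) - jb ‖p.2 - y‖) := by
  have : ContDiff ℝ (⊤ : ℕ∞) (fun p : Pt => jb ‖p.2 - y‖) :=
    jbnorm_smooth.comp (contDiff_snd.sub contDiff_const)
  exact (contDiff_const.sub (contDiff_const.mul (contDiff_fst.sub contDiff_const))).sub this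

lemma coneW_smooth (A a t1 : ℝ) (y : Sp) : Sm (coneW A a t1 y) :=
  Real.smoothTransition.contDiff.comp (coneW_arg_smooth A a t1 y)

lemma coneW_nonneg (A a t1 : ℝ) (y : Sp) (p : Pt) : 0 ≤ coneW A a t1 y p :=
  Real.smoothTransition.nonneg _

lemma coneW_deriv (A a t1 : ℝ) (y : Sp) (p : Pt) : ∃ χ : ℝ, 0 ≤ χ ∧
    pt (coneW A a t1 y) p = - a * χ ∧ ∑ j : Fin 3, (px j (coneW A a t1 y) p)^2 ≤ χ^2 := by
  set arg : Fn := fun p => A + 1 - a * (p.1 - t1) - jb ‖p.2 - y‖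
  have harg : Sm arg := coneW_arg_smooth A a t1 y
  have hst : ContDiff ℝ 1 Real.smoothTransition := Real.smoothTransition.contDiff (n := 1)
  have hcomp : HasFDerivAt (coneW A a t1 y) (deriv Real.smoothTransition (arg p) • fderiv ℝ arg p) p :=
    HasDerivAt.comp_hasFDerivAt p ((hst.differentiable (by simp)) _).hasDerivAt (harg.diff p).hasFDerivAt
  have hjn : HasFDerivAt (fun p : Pt => jb ‖p.2 - y‖)
      ((fderiv ℝ (fun z : Sp => jb ‖z‖) (p.2 - y)).comp (ContinuousLinearMap.snd ℝ ℝ Sp)) p :=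
    HasFDerivAt.comp (g := fun z : Sp => jb ‖z‖) p
      ((jbnorm_smooth.differentiable (by simp)) (p.2 - y)).hasFDerivAt
      (f := fun p : Pt => p.2 - y) ((hasFDerivAt_snd (𝕜 := ℝ) (p := p)).sub_const y)
  have hlin : HasFDerivAt (fun p : Pt => A + 1 - a * (p.1 - t1)) (-(a • ContinuousLinearMap.fst ℝ ℝ Sp)) p :=
    (((hasFDerivAt_fst (𝕜 := ℝ) (p := p)).sub_const t1).const_mul a).const_sub (A + 1)
  have hargd : fderiv ℝ arg p = _ := (hlin.sub hjn).fderiv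
  refine ⟨deriv Real.smoothTransition (arg p), Real.smoothTransition.monotone.deriv_nonneg, ?_, ?_⟩
  · simp only [pt, hcomp.fderiv, hargd]; simp; ring
  · have hx : ∀ j : Fin 3, px j (coneW A a t1 y) p = - (deriv Real.smoothTransition (arg p) *
        fderiv ℝ (fun z : Sp => jb ‖z‖) (p.2 - y) (EuclideanSpace.single j 1)) := fun j => by
      simp only [px, hcomp.fderiv, hargd]; simp
    simp only [hx, neg_sq, mul_pow, ← Finset.mul_sum]
    exact mul_le_of_le_one_right (sq_nonneg _) (jbnorm_grad _)

lemma coneW_zero {A a t1 : ℝ} {y : Sp} {p : Pt} (h : A + 1 - a * (p.1 - t1) ≤ ‖p.2 - y‖) :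
    coneW A a t1 y p = 0 :=
  Real.smoothTransition.zero_of_nonpos (by
    have := (le_abs_self _).trans (abs_le_jb ‖p.2 - y‖); linarith)

lemma coneW_pos {A a t1 t : ℝ} {y : Sp} (h : 0 < A - a * (t - t1)) : 0 < coneW A a t1 y (t, y) :=
  Real.smoothTransition.pos_of_pos (by simp [jb]; linarith)

lemma esrc_le {c s ci χ : ℝ} {ψ v : Fn} {p : Pt} (hs : s * s = 1) (hχ : 0 ≤ χ) (hci : 0 < ci) (hcc : ci ≤ c)
    (hψ : 0 ≤ ψ p) (h1 : pt ψ p = - (c * s) * χ) (h2 : ∑ j : Fin 3, (px j ψ p)^2 ≤ χ^2) :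
    s * esrc ci ψ v p ≤ ψ p * (|pt v p| * |boxOp ci v p|) := by
  set X := ∑ j : Fin 3, px j ψ p * px j v p with hX
  set G := ∑ j : Fin 3, (px j v p)^2 with hG
  have hG0 : 0 ≤ G := Finset.sum_nonneg fun _ _ => sq_nonneg _
  have hXX : X ^ 2 ≤ χ ^ 2 * G := (Finset.sum_mul_sq_le_sq_mul_sq _ _ _).trans
    (mul_le_mul_of_nonneg_right h2 hG0)
  have hXa : |X| ≤ χ * √G := by
    rw [← abs_of_nonneg (mul_nonneg hχ (Real.sqrt_nonneg G)), ← sq_le_sq, mul_pow, Real.sq_sqrt hG0]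
    exact hXX
  have hg := Real.sq_sqrt hG0
  have hen : en ci v p = (1/2) * (|pt v p|^2 + ci^2 * √G^2) := by rw [hg, sq_abs]; rfl
  have hesrc : s * esrc ci ψ v p = - c * χ * (s * s) * en ci v p + ψ p * (s * (pt v p * boxOp ci v p))
      - ci^2 * (s * (X * pt v p)) := by
    have : ∑ j : Fin 3, px j ψ p * (px j v p * pt v p) = X * pt v p := by
      rw [hX, Finset.sum_mul]; exact Finset.sum_congr rfl fun j _ => by ring
    rw [esrc, h1, this]; ring
  have hsabs : |s| = 1 := by
    have : |s| * |s| = 1 := by rw [← abs_mul, hs, abs_one]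
    nlinarith [abs_nonneg s]
  have i1 : s * (pt v p * boxOp ci v p) ≤ |pt v p| * |boxOp ci v p| := by
    refine (le_abs_self _).trans_eq ?_
    rw [abs_mul, abs_mul, hsabs, one_mul]
  have i2 : - (s * (X * pt v p)) ≤ χ * √G * |pt v p| := by
    refine (neg_le_abs _).trans ?_
    rw [abs_mul, abs_mul, hsabs, one_mul]
    exact mul_le_mul_of_nonneg_right hXa (abs_nonneg _)
  have i3 : ci^2 * (χ * √G * |pt v p|) ≤ c * χ * en ci v p := by
    rw [hen]
    have : ci * √G * |pt v p| ≤ (1/2) * (|pt v p|^2 + ci^2 * √G^2) := by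
      nlinarith [sq_nonneg (|pt v p| - ci * √G)]
    have h0 : 0 ≤ (1/2) * (|pt v p|^2 + ci^2 * √G^2) := by positivity
    calc ci^2 * (χ * √G * |pt v p|) = ci * χ * (ci * √G * |pt v p|) := by ring
      _ ≤ ci * χ * ((1/2) * (|pt v p|^2 + ci^2 * √G^2)) := mul_le_mul_of_nonneg_left this (by positivity)
      _ ≤ c * χ * ((1/2) * (|pt v p|^2 + ci^2 * √G^2)) := by gcongr
  rw [hesrc, hs]
  have i4 := mul_le_mul_of_nonneg_left i1 hψ
  have i5 := mul_le_mul_of_nonneg_left i2 (sq_nonneg ci)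
  nlinarith

lemma pd_sq_le_en {ci : ℝ} (hci : 0 < ci) (v : Fn) (p : Pt) :
    ∑ α : Fin 4, (pd α v p)^2 ≤ 2 * (1 + 1 / ci^2) * en ci v p := by
  rw [Fin.sum_univ_succ]
  simp only [pd_zero, pd_succ]
  have hG : 0 ≤ ∑ j : Fin 3, (px j v p)^2 := Finset.sum_nonneg fun _ _ => sq_nonneg _
  have : 2 * (1 + 1 / ci^2) * en ci v p = (pt v p)^2 + ∑ j : Fin 3, (px j v p)^2 +
      ((pt v p)^2 / ci^2 + ci^2 * ∑ j : Fin 3, (px j v p)^2) := by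
    unfold en; field_simp; ring
  rw [this]
  have : 0 ≤ (pt v p)^2 / ci^2 + ci^2 * ∑ j : Fin 3, (px j v p)^2 := by positivity
  linarith

lemma sm_esrc {ψ v : Fn} (hψ : Sm ψ) (hv : Sm v) (c : ℝ) : Sm (esrc c ψ v) := by
  have h := weighted_energy_identity hψ hv c
  have : esrc c ψ v = pt (ψ * en c v) + (-c^2) • ∑ j : Fin 3, px j (flux ψ v j) := by
    funext p; rw [h]; simp
  rw [this]
  exact (hψ.mul' (hv.en c)).pt.add' ((Sm.sum' _ fun j => (hψ.flux hv j).px j).smul' _)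

lemma VanOut.esrc {ψ : Fn} {O : Set ℝ} {R : ℝ} (v : Fn) (c : ℝ) (hO : IsOpen O)
    (h : VanOut O R ψ) : VanOut O R (esrc c ψ v) := fun s hs x hx => by
  have a0 : pt ψ (s, x) = 0 := h.pd hO 0 s hs x hx
  have aj : ∀ j, px j ψ (s, x) = 0 := fun j => h.pd hO j.succ s hs x hx
  simp [MultiSpeedWave.esrc, a0, aj, h s hs x hx]

lemma cspeed_le (c0 : ℝ) (i : Fin 3) : cspeed c0 i ≤ max 1 c0 := by
  fin_cases i <;> simp [cspeed]

lemma pt_eq_zero_of_far {c0 T : ℝ} (h0 : 0 < c0) {F : Coef} {Cub : Fin 3 → MvPolynomial (Fin 3 × Fin 4) ℝ}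
    (hCub : ∀ i, CubicLike (Cub i)) {u : Fin 3 → Fn} (hu : ∀ i, Sm (u i))
    (hsol : IsSolutionOn c0 F Cub u (Ioo 0 T)) {t1 n : ℝ} (ht1 : t1 ∈ Ioo 0 T) {O : Set ℝ}
    (hO : IsOpen O) (ht1O : t1 ∈ O) (hvan : ∀ i, VanOut O n (u i)) {t : ℝ} (ht : t ∈ Ioo 0 T) {y : Sp}
    (hy : n + 2 + max 1 c0 * T < ‖y‖) (i : Fin 3) : pt (u i) (t, y) = 0 := by
  set c := max 1 c0
  have hc : 0 < c := lt_of_lt_of_le one_pos (le_max_left _ _)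
  obtain ⟨s, hs, b, hb, htb⟩ : ∃ s : ℝ, s * s = 1 ∧ ∃ b : ℝ, 0 ≤ b ∧ t = t1 + s * b := by
    rcases le_total t1 t with h | h
    · exact ⟨1, by norm_num, t - t1, by linarith, by ring⟩
    · exact ⟨-1, by norm_num, t1 - t, by linarith, by ring⟩
  have hsabs : |s| = 1 := by
    have : |s| * |s| = 1 := by rw [← abs_mul, hs, abs_one]
    nlinarith [abs_nonneg s]
  have hbT : b ≤ T := by
    have : |t - t1| = b := by rw [htb]; simp [abs_mul, hsabs, abs_of_nonneg hb]
    rw [← this, abs_le]; constructor <;> linarith [ht.1, ht.2, ht1.1, ht1.2]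
  set ψ := coneW (1 + c * b) (c * s) t1 y
  have hψ : Sm ψ := coneW_smooth _ _ _ _
  have hψ0 : ∀ p, 0 ≤ ψ p := coneW_nonneg _ _ _ _
  have hOI : IsOpen (Ioo 0 T) := isOpen_Ioo
  set R := (1 + c * b) + 1 + c * T + ‖y‖
  have hvψ : VanOut (Ioo 0 T) R ψ := fun τ hτ x hx => by
    refine coneW_zero ?_
    have h1 := norm_sub_norm_le x y
    have h2 : -(c * s * (τ - t1)) ≤ c * T := by
      calc -(c * s * (τ - t1)) ≤ |c * s * (τ - t1)| := neg_le_abs _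
        _ = c * |τ - t1| := by rw [abs_mul, abs_mul, hsabs, abs_of_pos hc, mul_one]
        _ ≤ c * T := mul_le_mul_of_nonneg_left (by
            rw [abs_le]; constructor <;> linarith [hτ.1, hτ.2, ht1.1, ht1.2]) hc.le
    simp only [R] at hx
    change 1 + c * b + 1 - c * s * (τ - t1) ≤ ‖x - y‖
    linarith
  have hbd : ∃ M, ∀ i α, ∀ τ ∈ Ioo 0 T, ∀ x : Sp, ‖x‖ ≤ R → |pd α (u i) (τ, x)| ≤ M := by
    have : ∀ q : Fin 3 × Fin 4, ∃ M, ∀ p ∈ (Icc 0 T) ×ˢ (Metric.closedBall (0 : Sp) R), |pd q.2 (u q.1) p| ≤ M := fun q =>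
      (isCompact_Icc.prod (isCompact_closedBall _ _)).exists_bound_of_continuousOn
        (((hu q.1).pd q.2).continuous.continuousOn)
    choose M hM using this
    refine ⟨∑ q, |M q|, fun i α τ hτ x hx => (hM (i, α) (τ, x) ⟨Ioo_subset_Icc_self hτ, by simpa using hx⟩).trans ?_⟩
    exact (le_abs_self _).trans (Finset.single_le_sum (f := fun q => |M q|) (fun _ _ => abs_nonneg _) (Finset.mem_univ (i, α)))
  obtain ⟨M, hM⟩ := hbd
  obtain ⟨L, hL, hrhs⟩ := rhs_bound F hCub M
  set m : ℝ := ∑ i, 2 * (1 + 1 / (cspeed c0 i)^2)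
  have hcs := cspeed_pos h0
  have hm : ∀ i, 2 * (1 + 1 / (cspeed c0 i)^2) ≤ m := fun i =>
    Finset.single_le_sum (f := fun i => 2 * (1 + 1 / (cspeed c0 i)^2)) (fun i _ => by positivity) (Finset.mem_univ i)
  have hpt : ∀ τ ∈ Ioo 0 T, ∀ x, ∑ i, s * esrc (cspeed c0 i) ψ (u i) (τ, x)
      ≤ (12 * L * m) * ∑ i, ψ (τ, x) * en (cspeed c0 i) (u i) (τ, x) := fun τ hτ x => by
    obtain ⟨χ, hχ, hχ1, hχ2⟩ := coneW_deriv (1 + c * b) (c * s) t1 y (τ, x)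
    by_cases hx : ‖x‖ ≤ R
    · set p : Pt := (τ, x)
      set Sg := ∑ q : Fin 3 × Fin 4, |pd q.2 (u q.1) p| with hSg
      have hS0 : 0 ≤ Sg := Finset.sum_nonneg fun _ _ => abs_nonneg _
      have a1 : ∀ i, s * esrc (cspeed c0 i) ψ (u i) p ≤ ψ p * (|pt (u i) p| * (L * Sg)) := fun i => by
        refine (esrc_le hs hχ (hcs i) (cspeed_le c0 i) (hψ0 p) hχ1 hχ2).trans ?_
        rw [hsol i τ hτ x]
        exact mul_le_mul_of_nonneg_left (mul_le_mul_of_nonneg_left (hrhs u p (fun i α => hM i α τ hτ x hx) i)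
          (abs_nonneg _)) (hψ0 p)
      have a2 : ∑ i, |pt (u i) p| ≤ Sg := by
        rw [hSg, Fintype.sum_prod_type]
        exact Finset.sum_le_sum fun i _ => Finset.single_le_sum (f := fun α => |pd α (u i) p|)
          (fun _ _ => abs_nonneg _) (Finset.mem_univ 0)
      have a3 : Sg ^ 2 ≤ 12 * ∑ i, ∑ α : Fin 4, (pd α (u i) p)^2 := by
        have := sq_sum_le_card_mul_sum_sq (s := Finset.univ) (f := fun q : Fin 3 × Fin 4 => |pd q.2 (u q.1) p|)
        simp only [sq_abs, Finset.card_univ, Fintype.card_prod, Fintype.card_fin, ← hSg] at this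
        rw [← Fintype.sum_prod_type (f := fun q : Fin 3 × Fin 4 => (pd q.2 (u q.1) p) ^ 2)]
        norm_num at this
        exact this
      have a4 : ∑ i, ∑ α : Fin 4, (pd α (u i) p)^2 ≤ m * ∑ i, en (cspeed c0 i) (u i) p := by
        rw [Finset.mul_sum]
        exact Finset.sum_le_sum fun i _ => (pd_sq_le_en (hcs i) _ _).trans
          (mul_le_mul_of_nonneg_right (hm i) (en_nonneg _ _ _))
      calc ∑ i, s * esrc (cspeed c0 i) ψ (u i) p ≤ ∑ i, ψ p * (|pt (u i) p| * (L * Sg)) :=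
            Finset.sum_le_sum fun i _ => a1 i
        _ = (ψ p * L * Sg) * ∑ i, |pt (u i) p| := by
            rw [Finset.mul_sum (s := Finset.univ) (f := fun i => |pt (u i) p|)]
            exact Finset.sum_congr rfl fun i _ => by ring
        _ ≤ (ψ p * L * Sg) * Sg := mul_le_mul_of_nonneg_left a2 (mul_nonneg (mul_nonneg (hψ0 p) hL) hS0)
        _ = (ψ p * L) * Sg ^ 2 := by ring
        _ ≤ (ψ p * L) * (12 * (m * ∑ i, en (cspeed c0 i) (u i) p)) :=
            mul_le_mul_of_nonneg_left (a3.trans (by linarith)) (mul_nonneg (hψ0 p) hL)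
        _ = _ := by rw [← Finset.mul_sum]; ring
    · push Not at hx
      have e1 : ∀ i, esrc (cspeed c0 i) ψ (u i) (τ, x) = 0 := fun i => hvψ.esrc (u i) _ hOI τ hτ x hx
      simp [e1, hvψ τ hτ x hx]
  have htime : ∀ σ ∈ Icc 0 b, t1 + s * σ ∈ Ioo 0 T := fun σ hσ => by
    rcases eq_or_ne s 1 with h | h
    · subst h; constructor
      · linarith [hσ.1, ht1.1]
      · linarith [hσ.2, ht.2]
    · have h' : s = -1 := by
        have : (s - 1) * (s + 1) = 0 := by linarith
        rcases mul_eq_zero.1 this with h1 | h1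
        · exact absurd (by linarith) h
        · linarith
      subst h'; constructor
      · linarith [hσ.2, ht.1]
      · linarith [hσ.1, ht1.2]
  have hint : ∀ τ ∈ Ioo 0 T, ∀ i, Integrable fun x => (ψ * en (cspeed c0 i) (u i)) (τ, x) := fun τ hτ i =>
    ((hvψ.slice hτ).mul_right _).integrable ((hψ.mul' ((hu i).en _)).slice_cont τ)
  have hint' : ∀ τ ∈ Ioo 0 T, ∀ i, Integrable fun x => esrc (cspeed c0 i) ψ (u i) (τ, x) := fun τ hτ i =>
    ((hvψ.esrc (u i) _ hOI).slice hτ).integrable ((sm_esrc hψ (hu i) _).slice_cont τ)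
  set g : ℝ → ℝ := fun σ => ∑ i, ∫ x, (ψ * en (cspeed c0 i) (u i)) (t1 + s * σ, x)
  have hg : ∀ σ ∈ Icc 0 b, HasDerivAt g (∑ i, (∫ x, esrc (cspeed c0 i) ψ (u i) (t1 + s * σ, x)) * s) σ := fun σ hσ => by
    refine HasDerivAt.fun_sum fun i _ => ?_
    have hlin : HasDerivAt (fun σ => t1 + s * σ) s σ := by
      simpa using ((hasDerivAt_id σ).const_mul s).const_add t1
    exact HasDerivAt.comp (h := fun σ => t1 + s * σ) σ (hasDerivAt_weighted_energy (R := R) hψ (hu i) (cspeed c0 i) hOI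
      (fun τ hτ x hx => by simp [hvψ τ hτ x hx]) (fun j τ hτ x hx => by simp [flux, hvψ τ hτ x hx]) (htime σ hσ)) hlin
  have hgle : ∀ σ ∈ Icc 0 b, (∑ i, (∫ x, esrc (cspeed c0 i) ψ (u i) (t1 + s * σ, x)) * s) ≤ (12 * L * m) * g σ := fun σ hσ => by
    have hτ := htime σ hσ
    simp only [g]
    rw [← integral_finsetSum _ fun i _ => hint _ hτ i, ← integral_const_mul]
    have : ∑ i, (∫ x, esrc (cspeed c0 i) ψ (u i) (t1 + s * σ, x)) * s
        = ∫ x, ∑ i, s * esrc (cspeed c0 i) ψ (u i) (t1 + s * σ, x) := by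
      rw [integral_finsetSum _ fun i _ => (hint' _ hτ i).const_mul s]
      exact Finset.sum_congr rfl fun i _ => by rw [integral_const_mul, mul_comm]
    rw [this]
    exact integral_mono (integrable_finsetSum _ fun i _ => (hint' _ hτ i).const_mul s)
      ((integrable_finsetSum _ fun i _ => hint _ hτ i).const_mul _) (fun x => hpt _ hτ x)
  have hg0 : g 0 = 0 := by
    refine Finset.sum_eq_zero fun i _ => ?_
    have : ∀ x, (ψ * en (cspeed c0 i) (u i)) (t1 + s * 0, x) = 0 := fun x => by
      rw [mul_zero, add_zero]
      by_cases hx : n < ‖x‖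
      · have e0 : pt (u i) (t1, x) = 0 := (hvan i).pd hO 0 t1 ht1O x hx
        have ej : ∀ j, px j (u i) (t1, x) = 0 := fun j => (hvan i).pd hO j.succ t1 ht1O x hx
        simp [en, e0, ej]
      · have : ψ (t1, x) = 0 := coneW_zero (by
          have h1 := norm_sub_norm_le y x
          rw [norm_sub_rev] at h1
          have h2 : c * b ≤ c * T := mul_le_mul_of_nonneg_left hbT hc.le
          simp only [sub_self, mul_zero]
          linarith)
        simp [this]
    simp only [this, integral_zero]
  have hnn : ∀ i, 0 ≤ ∫ x, (ψ * en (cspeed c0 i) (u i)) (t1 + s * b, x) := fun i =>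
    integral_nonneg fun x => mul_nonneg (hψ0 _) (en_nonneg _ _ _)
  have hgb := gronwall_zero hb hg hgle hg0 (Finset.sum_nonneg fun i _ => hnn i)
  have hi := (Finset.sum_eq_zero_iff_of_nonneg (fun i _ => hnn i)).1 hgb i (Finset.mem_univ i)
  rw [← htb] at hi
  have hcont : Continuous fun x => (ψ * en (cspeed c0 i) (u i)) (t, x) := (hψ.mul' ((hu i).en _)).slice_cont t
  have hz := (integral_eq_zero_iff_of_nonneg (fun x => mul_nonneg (hψ0 _) (en_nonneg _ _ _)) (hint t ht i)).1 hi
  have hz' := (hcont.ae_eq_iff_eq volume continuous_const).1 hz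
  have hzy : ψ (t, y) * en (cspeed c0 i) (u i) (t, y) = 0 := congrFun hz' y
  have hpos : 0 < ψ (t, y) := coneW_pos (by
    have : c * s * (t - t1) = c * b * (s * s) := by rw [htb]; ring
    rw [this, hs]; linarith)
  have hen : en (cspeed c0 i) (u i) (t, y) = 0 := by
    rcases mul_eq_zero.1 hzy with h | h
    · exact absurd h hpos.ne'
    · exact h
  have h5 := pd_sq_le_en (hcs i) (u i) (t, y)
  rw [hen, mul_zero] at h5
  have h6 : (pd 0 (u i) (t, y))^2 ≤ 0 := (Finset.single_le_sum (f := fun α => (pd α (u i) (t, y))^2)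
    (fun _ _ => sq_nonneg _) (Finset.mem_univ 0)).trans h5
  exact pow_eq_zero_iff (two_ne_zero) |>.1 (le_antisymm h6 (sq_nonneg _))

/-- Local solutions are supported in a fixed ball. -/
lemma LocalSolution.uniform_support {c0 T : ℝ} (h0 : 0 < c0) {F : Coef}
    {Cub : Fin 3 → MvPolynomial (Fin 3 × Fin 4) ℝ} (hCub : ∀ i, CubicLike (Cub i)) {u : Fin 3 → Fn}
    (h : LocalSolution c0 F Cub T u) : ∃ R, ∀ i, VanOut (Ioo 0 T) R (u i) := by
  obtain ⟨hu, hcs, hsol⟩ := h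
  by_cases hT : 0 < T
  swap
  · exact ⟨0, fun i t ht => absurd (ht.1.trans ht.2) hT⟩
  set Cn : ℕ → Set ℝ := fun n => {t | ∀ x : Sp, (n : ℝ) < ‖x‖ → ∀ i, u i (t, x) = 0}
  have hclosed : ∀ n, IsClosed (Cn n) := fun n => by
    have : Cn n = ⋂ x : Sp, ⋂ _ : (n : ℝ) < ‖x‖, ⋂ i, {t | u i (t, x) = 0} := by
      ext t; simp [Cn]
    rw [this]
    exact isClosed_iInter fun x => isClosed_iInter fun _ => isClosed_iInter fun i =>
      isClosed_eq ((hu i).continuous.comp (continuous_id.prodMk continuous_const)) continuous_const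
  have huniv : ⋃ n, Cn n = univ := by
    refine eq_univ_of_forall fun t => ?_
    have : ∀ i, ∃ r, ∀ x : Sp, r < ‖x‖ → u i (t, x) = 0 := fun i => by
      obtain ⟨r, hr⟩ := (hcs i t).isBounded.subset_closedBall 0
      refine ⟨r, fun x hx => ?_⟩
      by_contra hne
      have := hr (subset_tsupport _ hne)
      rw [mem_closedBall_zero_iff] at this
      linarith
    choose r hr using this
    obtain ⟨n, hn⟩ := exists_nat_ge (∑ i, |r i|)
    refine mem_iUnion.2 ⟨n, fun x hx i => hr i x (lt_of_le_of_lt ?_ hx)⟩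
    exact (le_abs_self _).trans ((Finset.single_le_sum (f := fun i => |r i|) (fun _ _ => abs_nonneg _) (Finset.mem_univ i)).trans hn)
  have hdense := dense_iUnion_interior_of_closed hclosed huniv
  obtain ⟨t1, ht1, ht1'⟩ := hdense.exists_mem_open isOpen_Ioo (nonempty_Ioo.2 hT)
  obtain ⟨n, hn⟩ := mem_iUnion.1 ht1
  have hvan : ∀ i, VanOut (interior (Cn n)) n (u i) := fun i τ hτ x hx => interior_subset hτ x hx i
  refine ⟨n + 2 + max 1 c0 * T, fun i t ht y hy => ?_⟩
  have hd : ∀ τ, HasDerivAt (fun s => u i (s, y)) (pt (u i) (τ, y)) τ := fun τ => hasDerivAt_time (hu i) τ y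
  have hconst := IsOpen.is_const_of_deriv_eq_zero (isOpen_Ioo (a := (0:ℝ)) (b := T)) isPreconnected_Ioo
    (f := fun s => u i (s, y)) (fun τ _ => (hd τ).differentiableAt.differentiableWithinAt)
    (fun τ hτ => by
      rw [(hd τ).deriv]
      exact pt_eq_zero_of_far h0 hCub hu hsol ht1' isOpen_interior hn hvan hτ hy i) ht ht1'
  have hc : 0 ≤ max 1 c0 * T := mul_nonneg (zero_le_one.trans (le_max_left _ _)) hT.le
  rw [show u i (t, y) = u i (t1, y) from hconst]
  exact hvan i t1 hn y (by linarith)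

instance : IsFiniteMeasure sphMeas := by unfold sphMeas; infer_instance

lemma lintegral_polar {f : Sp → ENNReal} (hf : Measurable f) :
    ∫⁻ x, f x = ∫⁻ r in Ioi (0 : ℝ), ENNReal.ofReal (r ^ 2) * ∫⁻ ω : S2, f (r • (ω : Sp)) ∂sphMeas := by
  have h1 : ∫⁻ x, f x = ∫⁻ x : ({(0 : Sp)}ᶜ : Set Sp), f x.1 ∂((volume : Measure Sp).comap (↑)) := by
    rw [lintegral_subtype_comap (measurableSet_singleton _).compl]
    rw [Measure.restrict_eq_self_of_ae_mem]
    exact compl_mem_ae_iff.2 (measure_singleton _)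
  have hmp := (volume : Measure Sp).measurePreserving_homeomorphUnitSphereProd
  have hdim : Module.finrank ℝ Sp - 1 = 2 := by simp
  rw [hdim] at hmp
  set g : S2 × Ioi (0 : ℝ) → ENNReal := fun q => f (q.2.1 • (q.1 : Sp)) with hg
  have hgm : Measurable g := by
    refine hf.comp (Continuous.measurable ?_)
    exact (continuous_subtype_val.comp continuous_snd).smul (continuous_subtype_val.comp continuous_fst)
  have h2 : ∫⁻ x : ({(0 : Sp)}ᶜ : Set Sp), f x.1 ∂((volume : Measure Sp).comap (↑))
      = ∫⁻ q, g q ∂((volume : Measure Sp).toSphere.prod (Measure.volumeIoiPow 2)) := by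
    rw [← hmp.lintegral_comp hgm]
    refine lintegral_congr fun x => ?_
    simp only [hg, homeomorphUnitSphereProd_apply_snd_coe, homeomorphUnitSphereProd_apply_fst_coe]
    have : ‖x.1‖ ≠ 0 := norm_ne_zero_iff.2 x.2
    rw [smul_smul, mul_inv_cancel₀ this, one_smul]
  rw [h1, h2, lintegral_prod_symm' _ hgm, Measure.volumeIoiPow,
    lintegral_withDensity_eq_lintegral_mul _ (by fun_prop) hgm.lintegral_prod_left']
  rw [← lintegral_subtype_comap measurableSet_Ioi]
  rfl

/-- Angular derivatives of a function on space. -/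
def omx (i j : Fin 3) (h : Sp → ℝ) : Sp → ℝ := fun x =>
  x i * fderiv ℝ h x (EuclideanSpace.single j 1) - x j * fderiv ℝ h x (EuclideanSpace.single i 1)

/-- `h² + |Ωh|²`. -/
def angSq (h : Sp → ℝ) : Sp → ℝ := fun x => h x ^ 2 + ∑ i, ∑ j, (omx i j h x) ^ 2

lemma angSq_nonneg (h : Sp → ℝ) (x : Sp) : 0 ≤ angSq h x :=
  add_nonneg (sq_nonneg _) (Finset.sum_nonneg fun _ _ => Finset.sum_nonneg fun _ _ => sq_nonneg _)

lemma omx_cont {h : Sp → ℝ} (hh : ContDiff ℝ 1 h) (i j : Fin 3) : Continuous (omx i j h) := by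
  have hd : ∀ v, Continuous fun x => fderiv ℝ h x v := fun v =>
    (hh.continuous_fderiv (by simp)).clm_apply continuous_const
  have hc : ∀ i : Fin 3, Continuous fun x : Sp => x i := fun i => by fun_prop
  exact ((hc i).mul (hd _)).sub ((hc j).mul (hd _))

lemma angSq_cont {h : Sp → ℝ} (hh : ContDiff ℝ 1 h) : Continuous (angSq h) :=
  (hh.continuous.pow 2).add (continuous_finsetSum _ fun i _ => continuous_finsetSum _ fun j _ =>
    (omx_cont hh i j).pow 2)

lemma clm_expand (L : Sp →L[ℝ] ℝ) (v : Sp) : L v = ∑ j : Fin 3, v j * L (EuclideanSpace.single j 1) := by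
  have : v = ∑ j : Fin 3, v j • EuclideanSpace.single j (1 : ℝ) := by
    ext i; fin_cases i <;> simp [Fin.sum_univ_three]
  conv_lhs => rw [this]
  simp

lemma clm_norm_le (L : Sp →L[ℝ] ℝ) : ‖L‖ ≤ ∑ j : Fin 3, |L (EuclideanSpace.single j 1)| := by
  refine L.opNorm_le_bound (Finset.sum_nonneg fun _ _ => abs_nonneg _) fun v => ?_
  rw [clm_expand, Finset.sum_mul]
  refine (norm_sum_le _ _).trans (Finset.sum_le_sum fun j _ => ?_)
  rw [norm_mul, mul_comm]
  exact mul_le_mul_of_nonneg_left (abs_coord_le v j) (abs_nonneg _)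

lemma hasFDerivAt_normalize {y : Sp} (hy : y ≠ 0) :
    HasFDerivAt (fun y : Sp => ‖y‖⁻¹ • y)
      (‖y‖⁻¹ • ContinuousLinearMap.id ℝ Sp + (-(‖y‖⁻¹ ^ 3) • innerSL ℝ y).smulRight y) y := by
  have hn : ‖y‖ ≠ 0 := norm_ne_zero_iff.2 hy
  have h1 : HasFDerivAt (fun y : Sp => ‖y‖ ^ 2) (2 • innerSL ℝ y) y := (hasStrictFDerivAt_norm_sq y).hasFDerivAt
  have h2 : HasFDerivAt (fun y : Sp => ‖y‖) ((‖y‖⁻¹) • innerSL ℝ y) y := by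
    have := h1.sqrt (by positivity)
    simp only [Real.sqrt_sq (norm_nonneg _)] at this
    refine this.congr_fderiv ?_
    ext v; simp; field_simp
  have h3 : HasFDerivAt (fun y : Sp => ‖y‖⁻¹) (-(‖y‖⁻¹ ^ 3) • innerSL ℝ y) y := by
    have := HasDerivAt.comp_hasFDerivAt y (hasDerivAt_inv hn) h2
    refine this.congr_fderiv ?_
    ext v; simp; field_simp
  exact h3.smul (hasFDerivAt_id y)

lemma fderiv_normalized_bound {h : Sp → ℝ} (hh : ContDiff ℝ 1 h) {y : Sp} (hy : y ≠ 0) (j : Fin 3) :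
    |fderiv ℝ (fun y : Sp => h (‖y‖⁻¹ • y)) y (EuclideanSpace.single j 1)|
      ≤ ‖y‖⁻¹ * ∑ i, ∑ j, |omx i j h (‖y‖⁻¹ • y)| := by
  have hn : ‖y‖ ≠ 0 := norm_ne_zero_iff.2 hy
  set ω : Sp := ‖y‖⁻¹ • y with hω
  have hωn : ω 0 ^ 2 + ω 1 ^ 2 + ω 2 ^ 2 = 1 := by
    rw [← norm_sq_eq, hω, norm_smul, norm_inv, norm_norm, inv_mul_cancel₀ hn, one_pow]
  have hωi : ∀ i, y i = ‖y‖ * ω i := fun i => by simp [hω]; field_simp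
  have hc := HasFDerivAt.comp (g := h) y ((hh.differentiable (by simp)) ω).hasFDerivAt (hasFDerivAt_normalize hy)
  have hf : fderiv ℝ (fun y : Sp => h (‖y‖⁻¹ • y)) y = _ := hc.fderiv
  have key : fderiv ℝ (fun y : Sp => h (‖y‖⁻¹ • y)) y (EuclideanSpace.single j 1)
      = ‖y‖⁻¹ * ∑ k : Fin 3, ω k * omx k j h ω := by
    rw [hf]
    have hin : inner ℝ y (EuclideanSpace.single j (1 : ℝ)) = y j := by simp [EuclideanSpace.inner_single_right]
    have : (‖y‖⁻¹ • ContinuousLinearMap.id ℝ Sp + (-(‖y‖⁻¹ ^ 3) • innerSL ℝ y).smulRight y) (EuclideanSpace.single j (1 : ℝ))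
        = ‖y‖⁻¹ • (EuclideanSpace.single j (1 : ℝ) - ω j • ω) := by
      simp only [ContinuousLinearMap.add_apply, ContinuousLinearMap.smul_apply, ContinuousLinearMap.id_apply,
        ContinuousLinearMap.smulRight_apply, innerSL_apply_apply, hin, smul_sub, smul_smul, hω]
      rw [sub_eq_add_neg, ← neg_smul]
      congr 2
      simp; field_simp
    rw [ContinuousLinearMap.comp_apply, this, map_smul, map_sub, map_smul, clm_expand (fderiv ℝ h ω) ω]
    simp only [smul_eq_mul, omx, Fin.sum_univ_three]
    fin_cases j <;> simp <;> left <;> linear_combination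
      (-(fderiv ℝ h ω (EuclideanSpace.single _ 1))) * hωn
  rw [key, abs_mul, abs_of_nonneg (inv_nonneg.2 (norm_nonneg y))]
  refine mul_le_mul_of_nonneg_left ?_ (inv_nonneg.2 (norm_nonneg y))
  refine (Finset.abs_sum_le_sum_abs _ _).trans (Finset.sum_le_sum fun k _ => ?_)
  rw [abs_mul]
  have hk : |ω k| ≤ 1 := by
    have := abs_coord_le ω k
    rwa [hω, norm_smul, norm_inv, norm_norm, inv_mul_cancel₀ hn, ← hω] at this
  exact (mul_le_of_le_one_left (abs_nonneg _) hk).trans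
    (Finset.single_le_sum (f := fun j => |omx k j h ω|) (fun _ _ => abs_nonneg _) (Finset.mem_univ j))

/-- A smooth radial cutoff (as a function of `|y|²`) to an annulus around the unit sphere. -/
def annCut (q : ℝ) : ℝ := smoothTransition (4 * q - 1) * smoothTransition (4 - q)

lemma annCut_smooth : ContDiff ℝ (⊤ : ℕ∞) annCut :=
  (smoothTransition.contDiff.comp (by fun_prop)).mul (smoothTransition.contDiff.comp (by fun_prop))

lemma annCut_nonneg (q : ℝ) : 0 ≤ annCut q :=
  mul_nonneg (smoothTransition.nonneg _) (smoothTransition.nonneg _)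

lemma annCut_le_one (q : ℝ) : annCut q ≤ 1 :=
  mul_le_one₀ (smoothTransition.le_one _) (smoothTransition.nonneg _) (smoothTransition.le_one _)

lemma annCut_inner {q : ℝ} (h : q ≤ 1 / 4) : annCut q = 0 := by
  rw [annCut, smoothTransition.zero_of_nonpos (by linarith), zero_mul]

lemma annCut_outer {q : ℝ} (h : 4 ≤ q) : annCut q = 0 := by
  rw [annCut, smoothTransition.zero_of_nonpos (x := 4 - q) (by linarith), mul_zero]

lemma annCut_one {q : ℝ} (h : 1 / 2 ≤ q) (h' : q ≤ 3) : annCut q = 1 := by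
  rw [annCut, smoothTransition.one_of_one_le (by linarith), smoothTransition.one_of_one_le (by linarith), mul_one]

/-- Extension of the restriction of `h` to the unit sphere to an annulus. -/
def annExt (h : Sp → ℝ) (y : Sp) : ℝ := annCut (‖y‖ ^ 2) * h (‖y‖⁻¹ • y)

lemma annExt_eventually_zero (h : Sp → ℝ) {y : Sp} (hy : ‖y‖ < 1 / 2 ∨ 2 < ‖y‖) :
    annExt h =ᶠ[nhds y] fun _ => 0 := by
  rcases hy with hy | hy
  · filter_upwards [(isOpen_lt continuous_norm continuous_const).mem_nhds hy] with z hz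
    have hz : ‖z‖ < 1 / 2 := hz
    rw [annExt, annCut_inner (by nlinarith [norm_nonneg z]), zero_mul]
  · filter_upwards [(isOpen_lt continuous_const continuous_norm).mem_nhds hy] with z hz
    have hz : 2 < ‖z‖ := hz
    rw [annExt, annCut_outer (by nlinarith [norm_nonneg z]), zero_mul]

lemma annExt_contDiff {h : Sp → ℝ} (hh : ContDiff ℝ 1 h) : ContDiff ℝ 1 (annExt h) := by
  rw [contDiff_iff_contDiffAt]
  intro y
  rcases eq_or_ne y 0 with rfl | hy
  · exact (contDiffAt_const (c := (0 : ℝ))).congr_of_eventuallyEq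
      (annExt_eventually_zero h (Or.inl (by simp)))
  · refine ((annCut_smooth.of_le (by exact_mod_cast le_top)).contDiffAt.comp y
      (contDiff_norm_sq ℝ).contDiffAt).mul (hh.contDiffAt.comp y ?_)
    exact ((contDiffAt_norm ℝ hy).inv (norm_ne_zero_iff.2 hy)).smul contDiffAt_id

lemma exists_annExt_fderiv_bound : ∃ C : ℝ, 0 ≤ C ∧ ∀ h : Sp → ℝ, ContDiff ℝ 1 h → ∀ y,
    ‖fderiv ℝ (annExt h) y‖ ^ 2 ≤ (Icc (1 / 2 : ℝ) 2).indicator (fun _ => C * angSq h (‖y‖⁻¹ • y)) ‖y‖ := by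
  obtain ⟨D, hD⟩ : ∃ D, ∀ q ∈ Icc (0 : ℝ) 4, ‖deriv annCut q‖ ≤ D :=
    isCompact_Icc.exists_bound_of_continuousOn
      (annCut_smooth.continuous_deriv (by exact_mod_cast le_top)).continuousOn
  have hD0 : 0 ≤ D := (norm_nonneg _).trans (hD 0 (by simp))
  refine ⟨(3 * (4 * D + 2)) ^ 2 * 10, by positivity, fun h hh y => ?_⟩
  by_cases hy : ‖y‖ ∈ Icc (1 / 2 : ℝ) 2
  swap
  · rw [indicator_of_notMem hy]
    have : ‖y‖ < 1 / 2 ∨ 2 < ‖y‖ := by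
      simp only [mem_Icc, not_and_or, not_le] at hy; exact hy
    rw [(annExt_eventually_zero h this).fderiv_eq]
    simp
  rw [indicator_of_mem hy]
  have hy0 : y ≠ 0 := by
    rintro rfl
    have := hy.1
    norm_num at this
  have hn : 0 < ‖y‖ := norm_pos_iff.2 hy0
  set ω := ‖y‖⁻¹ • y with hω
  set W : ℝ := |h ω| + ∑ i, ∑ j, |omx i j h ω| with hW
  have hcoord : ∀ j : Fin 3, |fderiv ℝ (annExt h) y (EuclideanSpace.single j 1)| ≤ (4 * D + 2) * W := by
    intro j
    have h1 : HasFDerivAt (fun y : Sp => ‖y‖ ^ 2) (2 • innerSL ℝ y) y := (hasStrictFDerivAt_norm_sq y).hasFDerivAt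
    have h2 : HasFDerivAt (fun y : Sp => annCut (‖y‖ ^ 2)) (deriv annCut (‖y‖ ^ 2) • (2 • innerSL ℝ y)) y :=
      ((annCut_smooth.differentiable (by simp)) _).hasDerivAt.comp_hasFDerivAt y h1
    have h3 : DifferentiableAt ℝ (fun y : Sp => h (‖y‖⁻¹ • y)) y :=
      DifferentiableAt.comp y ((hh.differentiable (by simp)) _) (hasFDerivAt_normalize hy0).differentiableAt
    have h4 := h2.mul h3.hasFDerivAt
    have h5 : fderiv ℝ (annExt h) y = _ := h4.fderiv
    rw [h5]
    have hin : inner ℝ y (EuclideanSpace.single j (1 : ℝ)) = y j := by simp [EuclideanSpace.inner_single_right]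
    simp only [ContinuousLinearMap.add_apply, ContinuousLinearMap.smul_apply, smul_eq_mul, innerSL_apply_apply, hin]
    have hb := fderiv_normalized_bound hh hy0 j
    rw [← hω] at hb ⊢
    have hq := hD (‖y‖ ^ 2) ⟨by positivity, by nlinarith [hy.2]⟩
    have hyj := abs_coord_le y j
    have hS : (0 : ℝ) ≤ ∑ i, ∑ j, |omx i j h ω| :=
      Finset.sum_nonneg fun _ _ => Finset.sum_nonneg fun _ _ => abs_nonneg _
    have hinv : ‖y‖⁻¹ ≤ 2 := by
      rw [inv_le_comm₀ hn (by norm_num)]; linarith [hy.1]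
    refine (abs_add_le _ _).trans ?_
    rw [abs_mul, abs_mul, abs_mul, abs_of_nonneg (annCut_nonneg _)]
    have e1 : annCut (‖y‖ ^ 2) * |fderiv ℝ (fun y : Sp => h (‖y‖⁻¹ • y)) y (EuclideanSpace.single j 1)|
        ≤ 1 * (2 * ∑ i, ∑ j, |omx i j h ω|) :=
      mul_le_mul (annCut_le_one _) (hb.trans (mul_le_mul_of_nonneg_right hinv hS)) (abs_nonneg _) zero_le_one
    have e2 : |h ω| * (|deriv annCut (‖y‖ ^ 2)| * |2 • y j|) ≤ |h ω| * (D * 4) := by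
      refine mul_le_mul_of_nonneg_left (mul_le_mul hq ?_ (abs_nonneg _) hD0) (abs_nonneg _)
      rw [nsmul_eq_mul, abs_mul]
      norm_num
      linarith [hy.2]
    calc _ ≤ 1 * (2 * ∑ i, ∑ j, |omx i j h ω|) + |h ω| * (D * 4) := add_le_add e1 e2
      _ ≤ (4 * D + 2) * W := by
        rw [hW]
        nlinarith [mul_nonneg hD0 hS, abs_nonneg (h ω)]
  have hsum : ‖fderiv ℝ (annExt h) y‖ ≤ 3 * (4 * D + 2) * W := by
    refine (clm_norm_le _).trans ((Finset.sum_le_sum fun j _ => hcoord j).trans (le_of_eq ?_))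
    simp; ring
  have hW2 : W ^ 2 ≤ 10 * angSq h ω := by
    have : W = ∑ k : Option (Fin 3 × Fin 3), (k.elim |h ω| fun q => |omx q.1 q.2 h ω|) := by
      rw [Fintype.sum_option, hW, Fintype.sum_prod_type]; rfl
    rw [this]
    refine (sq_sum_le_card_mul_sum_sq).trans (le_of_eq ?_)
    rw [Fintype.sum_option, Fintype.sum_prod_type]
    simp only [Option.elim, sq_abs, angSq]
    norm_num
  calc _ ≤ (3 * (4 * D + 2) * W) ^ 2 := pow_le_pow_left₀ (norm_nonneg _) hsum 2
    _ = (3 * (4 * D + 2)) ^ 2 * W ^ 2 := by ring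
    _ ≤ (3 * (4 * D + 2)) ^ 2 * (10 * angSq h ω) := mul_le_mul_of_nonneg_left hW2 (by positivity)
    _ = _ := by ring

/-- Sobolev inequality on the unit sphere. -/
lemma sphere_sobolev : ∃ C : NNReal, ∀ h : Sp → ℝ, ContDiff ℝ 1 h →
    ∫⁻ ω : S2, ‖h ω‖ₑ ^ 4 ∂sphMeas ≤ C * (∫⁻ ω : S2, ENNReal.ofReal (angSq h ω) ∂sphMeas) ^ 2 := by
  obtain ⟨C, hC0, hC⟩ := exists_annExt_fderiv_bound
  set K := eLpNormLESNormFDerivOfLeConst ℝ (volume : Measure Sp) (Metric.ball 0 3) 2 4 with hK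
  refine ⟨2 * K ^ 4 * (8 * C.toNNReal) ^ 2, fun h hh => ?_⟩
  have hf := annExt_contDiff hh
  have hsup : Function.support (annExt h) ⊆ Metric.ball 0 3 := by
    intro y hy
    by_contra hc
    refine hy ?_
    have : 3 ≤ ‖y‖ := by simpa using hc
    rw [annExt, annCut_outer (by nlinarith), zero_mul]
  have hgns := eLpNorm_le_eLpNorm_fderiv_of_le (volume : Measure Sp) hf hsup (p := 2) (q := 4) (by norm_num)
    (by simp; norm_num) (by simp; norm_num) Metric.isBounded_ball
  rw [← hK] at hgns
  have h4 : eLpNorm (annExt h) ((4 : NNReal)) volume ^ 4 = ∫⁻ x, ‖annExt h x‖ₑ ^ 4 := by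
    have := eLpNorm_nnreal_pow_eq_lintegral (f := annExt h) (μ := (volume : Measure Sp)) (p := 4) (by norm_num)
    have e : ((4 : NNReal) : ℝ) = ((4 : ℕ) : ℝ) := by norm_num
    simpa only [e, ENNReal.rpow_natCast] using this
  have h2 : eLpNorm (fderiv ℝ (annExt h)) ((2 : NNReal)) volume ^ 2 = ∫⁻ x, ‖fderiv ℝ (annExt h) x‖ₑ ^ 2 := by
    have := eLpNorm_nnreal_pow_eq_lintegral (f := fderiv ℝ (annExt h)) (μ := (volume : Measure Sp)) (p := 2) (by norm_num)
    have e : ((2 : NNReal) : ℝ) = ((2 : ℕ) : ℝ) := by norm_num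
    simpa only [e, ENNReal.rpow_natCast] using this
  set A := ∫⁻ ω : S2, ENNReal.ofReal (angSq h ω) ∂sphMeas with hA
  have hω1 : ∀ ω : S2, ‖(ω : Sp)‖ = 1 := fun ω => by simpa using ω.2
  have hdir : ∀ (ω : S2) (r : ℝ), 0 < r → ‖r • (ω : Sp)‖⁻¹ • (r • (ω : Sp)) = ω := by
    intro ω r hr
    rw [norm_smul, hω1, mul_one, Real.norm_of_nonneg hr.le, smul_smul, inv_mul_cancel₀ hr.ne', one_smul]
  have hnrm : ∀ (ω : S2) (r : ℝ), 0 < r → ‖r • (ω : Sp)‖ = r := by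
    intro ω r hr
    rw [norm_smul, hω1, mul_one, Real.norm_of_nonneg hr.le]
  have hlow : ENNReal.ofReal (1 / 2) * ∫⁻ ω : S2, ‖h ω‖ₑ ^ 4 ∂sphMeas ≤ ∫⁻ x, ‖annExt h x‖ₑ ^ 4 := by
    rw [lintegral_polar (by have := hf.continuous; fun_prop)]
    calc ENNReal.ofReal (1 / 2) * ∫⁻ ω : S2, ‖h ω‖ₑ ^ 4 ∂sphMeas
        = ∫⁻ r in Icc (1 : ℝ) (3 / 2), ∫⁻ ω : S2, ‖h ω‖ₑ ^ 4 ∂sphMeas := by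
          rw [setLIntegral_const, Real.volume_Icc, mul_comm]; norm_num
      _ ≤ ∫⁻ r in Icc (1 : ℝ) (3 / 2), ENNReal.ofReal (r ^ 2) * ∫⁻ ω : S2, ‖annExt h (r • (ω : Sp))‖ₑ ^ 4 ∂sphMeas := by
          refine setLIntegral_mono' measurableSet_Icc fun r hr => ?_
          have hr0 : 0 < r := by linarith [hr.1]
          have e : ∀ ω : S2, annExt h (r • (ω : Sp)) = h ω := by
            intro ω
            rw [annExt, hdir ω r hr0, hnrm ω r hr0, annCut_one (by nlinarith [hr.1]) (by nlinarith [hr.1, hr.2]), one_mul]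
          simp only [e]
          refine le_mul_of_one_le_left zero_le ?_
          rw [ENNReal.one_le_ofReal]; nlinarith [hr.1]
      _ ≤ _ := lintegral_mono_set fun r hr => by
          have := hr.1
          exact (by linarith : (0 : ℝ) < r)
  have hup : ∫⁻ x, ‖fderiv ℝ (annExt h) x‖ₑ ^ 2 ≤ ENNReal.ofReal (8 * C) * A := by
    rw [lintegral_polar (by have := hf.continuous_fderiv (by simp); fun_prop)]
    calc _ ≤ ∫⁻ r in Ioi (0 : ℝ), (Icc (1 / 2 : ℝ) 2).indicator (fun _ => ENNReal.ofReal (4 * C) * A) r := by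
          refine setLIntegral_mono' measurableSet_Ioi fun r hr => ?_
          by_cases hr2 : r ∈ Icc (1 / 2 : ℝ) 2
          · rw [indicator_of_mem hr2]
            have e : ∀ ω : S2, ‖fderiv ℝ (annExt h) (r • (ω : Sp))‖ₑ ^ 2 ≤ ENNReal.ofReal C * ENNReal.ofReal (angSq h ω) := by
              intro ω
              have := hC h hh (r • (ω : Sp))
              rw [hdir ω r hr, hnrm ω r hr, indicator_of_mem hr2] at this
              rw [← ofReal_norm_eq_enorm, ← ENNReal.ofReal_pow (norm_nonneg _), ← ENNReal.ofReal_mul hC0]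
              exact ENNReal.ofReal_le_ofReal this
            calc _ ≤ ENNReal.ofReal 4 * (ENNReal.ofReal C * A) := by
                  refine mul_le_mul' (ENNReal.ofReal_le_ofReal (by nlinarith [hr2.1, hr2.2])) ?_
                  rw [hA, ← lintegral_const_mul _ (by
                    have := angSq_cont hh; fun_prop)]
                  exact lintegral_mono e
              _ = _ := by rw [← mul_assoc, ← ENNReal.ofReal_mul (by norm_num)]
          · rw [indicator_of_notMem hr2]
            have e : ∀ ω : S2, ‖fderiv ℝ (annExt h) (r • (ω : Sp))‖ₑ ^ 2 = 0 := by
              intro ω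
              have := hC h hh (r • (ω : Sp))
              rw [hnrm ω r hr, indicator_of_notMem hr2] at this
              have h0 : ‖fderiv ℝ (annExt h) (r • (ω : Sp))‖ = 0 := by
                nlinarith [norm_nonneg (fderiv ℝ (annExt h) (r • (ω : Sp)))]
              rw [← ofReal_norm_eq_enorm, h0]; simp
            simp [e]
      _ ≤ ∫⁻ r, (Icc (1 / 2 : ℝ) 2).indicator (fun _ => ENNReal.ofReal (4 * C) * A) r := setLIntegral_le_lintegral _ _
      _ = ENNReal.ofReal (4 * C) * A * ENNReal.ofReal (3 / 2) := by
          rw [lintegral_indicator measurableSet_Icc, setLIntegral_const, Real.volume_Icc]; norm_num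
      _ ≤ ENNReal.ofReal (8 * C) * A := by
          rw [mul_right_comm, ← ENNReal.ofReal_mul (by positivity)]
          exact mul_le_mul' (ENNReal.ofReal_le_ofReal (by linarith)) le_rfl
  have h5 : ∫⁻ x, ‖annExt h x‖ₑ ^ 4 ≤ K ^ 4 * (ENNReal.ofReal (8 * C) * A) ^ 2 := by
    rw [← h4]
    calc _ ≤ (K * eLpNorm (fderiv ℝ (annExt h)) ((2 : NNReal)) volume) ^ 4 := by gcongr
      _ = K ^ 4 * (eLpNorm (fderiv ℝ (annExt h)) ((2 : NNReal)) volume ^ 2) ^ 2 := by rw [mul_pow, ← pow_mul]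
      _ ≤ _ := by rw [h2]; gcongr
  have h6 : ∫⁻ ω : S2, ‖h ω‖ₑ ^ 4 ∂sphMeas = 2 * (ENNReal.ofReal (1 / 2) * ∫⁻ ω : S2, ‖h ω‖ₑ ^ 4 ∂sphMeas) := by
    have e : ENNReal.ofReal 2 * ENNReal.ofReal (1 / 2) = 1 := by
      rw [← ENNReal.ofReal_mul (by norm_num)]; norm_num
    rw [ENNReal.ofReal_ofNat] at e
    rw [← mul_assoc, e, one_mul]
  rw [h6]
  calc _ ≤ 2 * (K ^ 4 * (ENNReal.ofReal (8 * C) * A) ^ 2) := mul_le_mul_right (hlow.trans h5) _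
    _ = _ := by
      rw [mul_pow, ENNReal.ofReal_mul (by norm_num)]
      push_cast
      rw [show ENNReal.ofReal 8 = 8 by simp, show ENNReal.ofReal C = (C.toNNReal : ENNReal) from rfl]
      ring

lemma angSq_dilate {g : Sp → ℝ} (hg : ContDiff ℝ 1 g) (r : ℝ) (x : Sp) :
    angSq (fun y => g (r • y)) x = angSq g (r • x) := by
  have h1 : ∀ v, fderiv ℝ (fun y => g (r • y)) x v = r * fderiv ℝ g (r • x) v := by
    intro v
    have := HasFDerivAt.comp (g := g) x ((hg.differentiable (by simp)) (r • x)).hasFDerivAt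
      ((hasFDerivAt_id x).const_smul r)
    have e : fderiv ℝ (fun y => g (r • y)) x = _ := this.fderiv
    rw [e]; simp
  simp only [angSq, omx, h1, PiLp.smul_apply, smul_eq_mul]
  congr 1
  refine Finset.sum_congr rfl fun i _ => Finset.sum_congr rfl fun j _ => ?_
  ring

lemma exists_lintegral_angular_product : ∃ C : NNReal, ∀ f g : Sp → ℝ, Continuous f → ContDiff ℝ 1 g →
    ∀ Λ : NNReal, (∀ r : ℝ, 0 < r → ∫⁻ ω : S2, ‖f (r • (ω : Sp))‖ₑ ^ 4 ∂sphMeas ≤ Λ ^ 4) →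
      ∫⁻ x, (‖f x‖ₑ * ‖g x‖ₑ) ^ 2 ≤ C * Λ ^ 2 * ∫⁻ x, ENNReal.ofReal (angSq g x) := by
  obtain ⟨C, hC⟩ := sphere_sobolev
  refine ⟨C ^ (1 / 2 : ℝ), fun f g hf hg Λ hΛ => ?_⟩
  have hgc := hg.continuous
  have hac := angSq_cont hg
  rw [lintegral_polar (by fun_prop), lintegral_polar (by fun_prop),
    ← lintegral_const_mul' _ _ (by finiteness)]
  refine setLIntegral_mono' measurableSet_Ioi fun r hr => ?_
  rw [mul_left_comm]
  refine mul_le_mul_right ?_ _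
  have hsm : ContDiff ℝ 1 (fun y : Sp => g (r • y)) := hg.comp (contDiff_id.const_smul r)
  have h1 := hC _ hsm
  simp only [angSq_dilate hg] at h1
  have h2 := ENNReal.lintegral_mul_le_Lp_mul_Lq sphMeas Real.HolderConjugate.two_two
    (f := fun ω : S2 => ‖f (r • (ω : Sp))‖ₑ ^ 2) (g := fun ω : S2 => ‖g (r • (ω : Sp))‖ₑ ^ 2)
    (by fun_prop) (by fun_prop)
  simp only [Pi.mul_apply, ENNReal.rpow_two, ← pow_mul] at h2
  simp only [mul_pow]
  refine h2.trans ?_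
  refine (mul_le_mul' (ENNReal.rpow_le_rpow (hΛ r hr) (by norm_num)) (ENNReal.rpow_le_rpow h1 (by norm_num))).trans
    (le_of_eq ?_)
  rw [ENNReal.mul_rpow_of_nonneg _ _ (by norm_num : (0 : ℝ) ≤ 1 / 2)]
  have e : ∀ (a : ENNReal) (n : ℕ), (a ^ (2 * n)) ^ (1 / 2 : ℝ) = a ^ n := by
    intro a n
    rw [← ENNReal.rpow_natCast, ← ENNReal.rpow_mul, ← ENNReal.rpow_natCast]
    congr 1; push_cast; ring
  have e4 := e Λ 2
  have e2 := e (∫⁻ ω : S2, ENNReal.ofReal (angSq g (r • (ω : Sp))) ∂sphMeas) 1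
  norm_num at e4 e2
  norm_num
  rw [e4, e2, ← ENNReal.coe_rpow_of_nonneg _ (by norm_num)]
  ring

lemma enorm_pow_eq (a : ℝ) (n : ℕ) : ‖a‖ₑ ^ n = ENNReal.ofReal (|a| ^ n) := by
  rw [← ofReal_norm_eq_enorm, ← ENNReal.ofReal_pow (norm_nonneg _), Real.norm_eq_abs]

/-- A product estimate: `L^∞_r L⁴_ω` times an `L²` function with one angular derivative. -/
lemma exists_angular_product : ∃ C : ℝ, 0 ≤ C ∧ ∀ f g : Sp → ℝ, Continuous f → ContDiff ℝ 1 g →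
    HasCompactSupport g → ∀ Λ : ℝ, 0 ≤ Λ → (∀ r : ℝ, 0 < r → ∫ ω : S2, |f (r • (ω : Sp))| ^ 4 ∂sphMeas ≤ Λ ^ 4) →
      ∫ x, (f x * g x) ^ 2 ≤ C * Λ ^ 2 * ∫ x, angSq g x := by
  obtain ⟨C, hC⟩ := exists_lintegral_angular_product
  refine ⟨C, C.2, fun f g hf hg hgs Λ hΛ0 hΛ => ?_⟩
  have hgc := hg.continuous
  have hac := angSq_cont hg
  have hsupp : HasCompactSupport (angSq g) := by
    refine HasCompactSupport.of_support_subset_isCompact hgs fun x hx => ?_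
    by_contra hc
    refine hx ?_
    have h0 := image_eq_zero_of_notMem_tsupport hc
    have h1 : fderiv ℝ g x = 0 :=
      image_eq_zero_of_notMem_tsupport fun h => hc (tsupport_fderiv_subset ℝ h)
    simp [angSq, omx, h0, h1]
  have hi1 : Integrable fun x => (f x * g x) ^ 2 := by
    refine Continuous.integrable_of_hasCompactSupport (by fun_prop) ?_
    refine HasCompactSupport.of_support_subset_isCompact hgs fun x hx => ?_
    by_contra hc
    have h0 := image_eq_zero_of_notMem_tsupport hc
    exact hx (by simp [h0])
  have hi2 : Integrable (angSq g) := hac.integrable_of_hasCompactSupport hsupp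
  have key := hC f g hf hg ⟨Λ, hΛ0⟩ (fun r hr => by
    simp only [enorm_pow_eq]
    rw [← ofReal_integral_eq_lintegral_ofReal]
    · refine (ENNReal.ofReal_le_ofReal (hΛ r hr)).trans (le_of_eq ?_)
      rw [ENNReal.ofReal_pow hΛ0]
      congr 1
      exact ENNReal.ofReal_eq_coe_nnreal hΛ0
    · exact Continuous.integrable_of_hasCompactSupport (by fun_prop) (HasCompactSupport.of_compactSpace _)
    · exact Filter.Eventually.of_forall fun ω => by positivity)
  have e1 : ∫⁻ x, (‖f x‖ₑ * ‖g x‖ₑ) ^ 2 = ENNReal.ofReal (∫ x, (f x * g x) ^ 2) := by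
    rw [ofReal_integral_eq_lintegral_ofReal hi1 (Filter.Eventually.of_forall fun ω => by positivity)]
    refine lintegral_congr fun x => ?_
    rw [← enorm_mul, enorm_pow_eq, sq_abs]
  rw [e1, ← ofReal_integral_eq_lintegral_ofReal hi2 (Filter.Eventually.of_forall fun x => angSq_nonneg g x)] at key
  have hI : 0 ≤ ∫ x, angSq g x := integral_nonneg fun x => angSq_nonneg g x
  have e3 : (C : ENNReal) * ENNReal.ofNNReal ⟨Λ, hΛ0⟩ ^ 2 * ENNReal.ofReal (∫ x, angSq g x)
      = ENNReal.ofReal (C * Λ ^ 2 * ∫ x, angSq g x) := by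
    rw [ENNReal.ofReal_mul (by positivity), ENNReal.ofReal_mul (by positivity), ENNReal.ofReal_pow hΛ0,
      ENNReal.ofReal_coe_nnreal, ENNReal.ofReal_eq_coe_nnreal hΛ0]
    rfl
  rw [e3] at key
  exact (ENNReal.ofReal_le_ofReal_iff (by positivity)).1 key

lemma integral_cauchy_schwarz {α : Type*} [MeasurableSpace α] {μ : Measure α} {f g : α → ℝ} {A B : ℝ}
    (hA : 0 ≤ A) (hB : 0 ≤ B) (hf : Integrable (fun x => f x ^ 2) μ) (hg : Integrable (fun x => g x ^ 2) μ)
    (hfA : ∫ x, f x ^ 2 ∂μ ≤ A ^ 2) (hgB : ∫ x, g x ^ 2 ∂μ ≤ B ^ 2) :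
    ∫ x, |f x * g x| ∂μ ≤ A * B := by
  by_cases hi : Integrable (fun x => |f x * g x|) μ
  swap
  · rw [integral_undef hi]; positivity
  have key : ∀ ε > 0, ∫ x, |f x * g x| ∂μ ≤ (A + ε) * (B + ε) := by
    intro ε hε
    have hA' : 0 < A + ε := by linarith
    have hB' : 0 < B + ε := by linarith
    have h1 : ∫ x, |f x * g x| ∂μ ≤ ∫ x, ((B + ε) / (A + ε) / 2 * f x ^ 2 + (A + ε) / (B + ε) / 2 * g x ^ 2) ∂μ := by
      refine integral_mono hi ((hf.const_mul _).add (hg.const_mul _)) fun x => ?_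
      have : 0 ≤ ((B + ε) * |f x| - (A + ε) * |g x|) ^ 2 / (2 * (A + ε) * (B + ε)) := by positivity
      change |f x * g x| ≤ (B + ε) / (A + ε) / 2 * f x ^ 2 + (A + ε) / (B + ε) / 2 * g x ^ 2
      have e : (B + ε) / (A + ε) / 2 * f x ^ 2 + (A + ε) / (B + ε) / 2 * g x ^ 2 - |f x * g x|
          = ((B + ε) * |f x| - (A + ε) * |g x|) ^ 2 / (2 * (A + ε) * (B + ε)) := by
        rw [abs_mul, ← sq_abs (f x), ← sq_abs (g x)]
        field_simp
        ring
      linarith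
    rw [integral_add (hf.const_mul _) (hg.const_mul _), integral_const_mul, integral_const_mul] at h1
    have h2 : (B + ε) / (A + ε) / 2 * ∫ x, f x ^ 2 ∂μ ≤ (B + ε) / (A + ε) / 2 * (A + ε) ^ 2 :=
      mul_le_mul_of_nonneg_left (hfA.trans (by nlinarith)) (by positivity)
    have h3 : (A + ε) / (B + ε) / 2 * ∫ x, g x ^ 2 ∂μ ≤ (A + ε) / (B + ε) / 2 * (B + ε) ^ 2 :=
      mul_le_mul_of_nonneg_left (hgB.trans (by nlinarith)) (by positivity)
    have h4 : (B + ε) / (A + ε) / 2 * (A + ε) ^ 2 + (A + ε) / (B + ε) / 2 * (B + ε) ^ 2 = (A + ε) * (B + ε) := by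
      field_simp; ring
    linarith
  have hlim : Filter.Tendsto (fun ε : ℝ => (A + ε) * (B + ε)) (nhdsWithin 0 (Ioi 0)) (nhds (A * B)) := by
    have : Continuous fun ε : ℝ => (A + ε) * (B + ε) := by fun_prop
    simpa using (this.tendsto 0).mono_left nhdsWithin_le_nhds
  exact ge_of_tendsto hlim (by filter_upwards [self_mem_nhdsWithin] with ε hε using key ε hε)

lemma abs_deriv_jb_le (ρ : ℝ) : |deriv jb ρ| ≤ 1 := by
  have hl : LipschitzWith 1 jb := LipschitzWith.of_le_add fun a b => by
    rw [Real.dist_eq]; exact jb_lip a b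
  simpa using norm_deriv_le_of_lipschitz (x₀ := ρ) hl

lemma jb_jbnorm_comparable (s r : ℝ) (hr : 0 ≤ r) :
    jb (s - r) ≤ 2 * jb (s - jb r) ∧ jb (s - jb r) ≤ 2 * jb (s - r) := by
  have h1 := jb_le r
  have h2 := abs_le_jb r
  rw [abs_of_nonneg hr] at h1 h2
  have h3 : |(s - r) - (s - jb r)| ≤ 1 := by rw [abs_le]; constructor <;> linarith
  have h4 := jb_lip (s - r) (s - jb r)
  have h5 := jb_lip (s - jb r) (s - r)
  rw [abs_sub_comm] at h5
  exact ⟨by linarith [one_le_jb (s - jb r)], by linarith [one_le_jb (s - r)]⟩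

lemma hardy_div_bound (s : ℝ) (x : Sp) :
    -1 - jb (s - jb ‖x‖) / jb ‖x‖ ≤ fderiv ℝ (fun x : Sp => jb (s - jb ‖x‖) / jb ‖x‖) x x := by
  have hρ := jb_pos ‖x‖
  have h1 : HasFDerivAt (fun y : Sp => ‖y‖ ^ 2) (2 • innerSL ℝ x) x := (hasStrictFDerivAt_norm_sq x).hasFDerivAt
  have h2 : HasFDerivAt (fun y : Sp => jb ‖y‖) ((jb ‖x‖)⁻¹ • innerSL ℝ x) x := by
    have := (h1.const_add 1).sqrt (by positivity)
    refine this.congr_fderiv ?_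
    change (1 / (2 * jb ‖x‖)) • (2 • innerSL ℝ x) = _
    ext v; simp; field_simp
  have h3 : HasDerivAt (fun q => jb (s - q)) (-deriv jb (s - jb ‖x‖)) (jb ‖x‖) := by
    have := (jb_smooth.differentiable (by simp) (s - jb ‖x‖)).hasDerivAt.comp (jb ‖x‖) ((hasDerivAt_id (jb ‖x‖)).const_sub s)
    exact this.congr_deriv (by ring)
  have h4 := ((h3.div (hasDerivAt_id (jb ‖x‖)) hρ.ne').comp_hasFDerivAt x h2)
  have h5 : fderiv ℝ (fun x : Sp => jb (s - jb ‖x‖) / jb ‖x‖) x = _ := h4.fderiv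
  rw [h5]
  have hin : inner ℝ x x = ‖x‖ ^ 2 := real_inner_self_eq_norm_sq x
  simp only [ContinuousLinearMap.smul_apply, smul_eq_mul, innerSL_apply_apply, hin, id]
  set b := deriv jb (s - jb ‖x‖)
  set φ := jb (s - jb ‖x‖)
  have hb : |b| ≤ 1 := abs_deriv_jb_le _
  have hφ : 0 < φ := jb_pos _
  have hx : ‖x‖ ^ 2 ≤ jb ‖x‖ ^ 2 := by rw [jb_sq]; linarith
  set ρ := jb ‖x‖
  have e : (-b * ρ - φ * 1) / ρ ^ 2 * (ρ⁻¹ * ‖x‖ ^ 2) = -((b * ρ + φ) * (‖x‖ ^ 2 / ρ ^ 2)) / ρ := by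
    field_simp; ring
  rw [e]
  have hq : ‖x‖ ^ 2 / ρ ^ 2 ≤ 1 := by rw [div_le_one (by positivity)]; exact hx
  have hq0 : 0 ≤ ‖x‖ ^ 2 / ρ ^ 2 := by positivity
  rw [le_div_iff₀ hρ]
  have e2 : (-1 - φ / ρ) * ρ = -(ρ + φ) := by field_simp; ring
  rw [e2, neg_le_neg_iff]
  have hbρ : b * ρ ≤ ρ := by nlinarith [(abs_le.1 hb).2]
  nlinarith [mul_nonneg hq0 (sub_nonneg.2 hbρ)]

/-- A Hardy-type inequality with the weight `⟨s - |x|⟩ / ⟨x⟩`. -/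
lemma hardy {R : ℝ} {w : Sp → ℝ} (hs : SuppIn R w) (hw : ContDiff ℝ 1 w) (s : ℝ) {A D : ℝ} (hA : 0 ≤ A) (hD : 0 ≤ D)
    (h1 : ∫ x, w x ^ 2 ≤ A ^ 2)
    (h2 : ∀ j : Fin 3, ∫ x, (jb (s - ‖x‖) * fderiv ℝ w x (EuclideanSpace.single j 1)) ^ 2 ≤ D ^ 2) :
    ∫ x, jb (s - ‖x‖) * w x ^ 2 / jb ‖x‖ ≤ A ^ 2 + 12 * A * D := by
  have hwc := hw.continuous
  set m : Sp → ℝ := fun x => jb (s - jb ‖x‖) / jb ‖x‖ with hm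
  have hmsm : ContDiff ℝ (⊤ : ℕ∞) m :=
    (jb_smooth.comp (contDiff_const.sub jbnorm_smooth)).div jbnorm_smooth fun x => (jb_pos _).ne'
  have hm1 : ContDiff ℝ 1 m := hmsm.of_le (by exact_mod_cast le_top)
  set g : Sp → ℝ := fun x => m x * w x ^ 2 with hg
  have hgsm : ContDiff ℝ 1 g := hm1.mul (hw.pow 2)
  have hwd : ∀ x, HasFDerivAt w (fderiv ℝ w x) x := fun x => (hw.differentiable (by simp) x).hasFDerivAt
  have hdg : ∀ x, fderiv ℝ g x x = w x ^ 2 * fderiv ℝ m x x + 2 * m x * w x * fderiv ℝ w x x := by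
    intro x
    have : fderiv ℝ g x = _ := ((hm1.differentiable (by simp) x).hasFDerivAt.mul ((hwd x).pow 2)).fderiv
    rw [this]; simp; ring
  have hdw : ∀ v, Continuous fun x => fderiv ℝ w x v := fun v =>
    (hw.continuous_fderiv (by simp)).clm_apply continuous_const
  have hdiv : ∀ x, ∑ j : Fin 3, fderiv ℝ (fun x : Sp => x j * g x) x (EuclideanSpace.single j 1) = 3 * g x + fderiv ℝ g x x := by
    intro x
    have hj : ∀ j : Fin 3, fderiv ℝ (fun x : Sp => x j * g x) x (EuclideanSpace.single j 1)
        = g x + x j * fderiv ℝ g x (EuclideanSpace.single j 1) := by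
      intro j
      have hc : HasFDerivAt (fun x : Sp => x j) (EuclideanSpace.proj j : Sp →L[ℝ] ℝ) x :=
        (EuclideanSpace.proj j : Sp →L[ℝ] ℝ).hasFDerivAt
      have : fderiv ℝ (fun x : Sp => x j * g x) x = _ :=
        (hc.mul (hgsm.differentiable (by simp) x).hasFDerivAt).fderiv
      rw [this]; simp; ring
    simp only [hj, Finset.sum_add_distrib, ← clm_expand]
    simp
  have hgs : SuppIn R g := fun x hx => by simp [hg, hs x hx]
  have hint : ∀ j : Fin 3, Integrable fun x => fderiv ℝ (fun x : Sp => x j * g x) x (EuclideanSpace.single j 1) := by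
    intro j
    have hsm : ContDiff ℝ 1 (fun x : Sp => x j * g x) :=
      (EuclideanSpace.proj j : Sp →L[ℝ] ℝ).contDiff.mul hgsm
    refine SuppIn.integrable (R := R) ?_ ((hsm.continuous_fderiv (by simp)).clm_apply continuous_const)
    intro x hx
    change fderiv ℝ (fun x : Sp => x j * g x) x _ = 0
    rw [(hgs.mul_left fun x => x j).fderiv x hx]; simp
  have hzero : ∫ x, (3 * g x + fderiv ℝ g x x) = 0 := by
    simp only [← hdiv]
    rw [integral_finsetSum _ fun j _ => hint j]
    refine Finset.sum_eq_zero fun j _ => ?_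
    exact integral_dir_deriv_eq_zero (hgs.mul_left fun x => x j)
      ((EuclideanSpace.proj j : Sp →L[ℝ] ℝ).contDiff.mul hgsm) _
  have hJc : Continuous fun x : Sp => jb (s - ‖x‖) := jb_cont.comp (by fun_prop)
  have hρc : Continuous fun x : Sp => jb ‖x‖ := jb_cont.comp (by fun_prop)
  set P : Fin 3 → Sp → ℝ := fun j x => |w x * (jb (s - ‖x‖) * fderiv ℝ w x (EuclideanSpace.single j 1))| with hP
  have hPi : ∀ j, Integrable (P j) := fun j =>
    SuppIn.integrable (R := R) (fun x hx => by simp [hP, hs x hx]) (by have := hdw (EuclideanSpace.single j 1); fun_prop)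
  have hwi : Integrable fun x => w x ^ 2 := SuppIn.integrable (R := R) (fun x hx => by simp [hs x hx]) (by fun_prop)
  have hQi : Integrable fun x => jb (s - ‖x‖) * w x ^ 2 / jb ‖x‖ := by
    refine SuppIn.integrable (R := R) (fun x hx => by simp [hs x hx]) ?_
    exact (hJc.mul (hwc.pow 2)).div hρc fun x => (jb_pos _).ne'
  have hpt : ∀ x, jb (s - ‖x‖) * w x ^ 2 / jb ‖x‖ ≤ (3 * g x + fderiv ℝ g x x) + w x ^ 2 + 4 * ∑ j, P j x := by
    intro x
    have hdb := hardy_div_bound s x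
    change -1 - m x ≤ fderiv ℝ m x x at hdb
    have hρ := jb_pos ‖x‖
    obtain ⟨hc1, hc2⟩ := jb_jbnorm_comparable s ‖x‖ (norm_nonneg x)
    have hm0 : 0 ≤ m x := div_nonneg (jb_pos _).le (jb_pos _).le
    have hlow : jb (s - ‖x‖) * w x ^ 2 / jb ‖x‖ ≤ 2 * g x := by
      rw [hg, hm, div_le_iff₀ hρ]
      have : 2 * (jb (s - jb ‖x‖) / jb ‖x‖ * w x ^ 2) * jb ‖x‖ = 2 * jb (s - jb ‖x‖) * w x ^ 2 := by field_simp
      simp only [this]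
      exact mul_le_mul_of_nonneg_right hc1 (sq_nonneg _)
    have hmx : m x * ‖x‖ ≤ 2 * jb (s - ‖x‖) := by
      refine le_trans ?_ hc2
      rw [hm]
      have : jb (s - jb ‖x‖) / jb ‖x‖ * ‖x‖ = jb (s - jb ‖x‖) * (‖x‖ / jb ‖x‖) := by field_simp
      simp only [this]
      refine mul_le_of_le_one_right (jb_pos _).le ?_
      rw [div_le_one hρ]
      exact (le_abs_self _).trans (abs_le_jb _)
    have hcross : |2 * m x * w x * fderiv ℝ w x x| ≤ 4 * ∑ j, P j x := by
      have hf : |fderiv ℝ w x x| ≤ (∑ j : Fin 3, |fderiv ℝ w x (EuclideanSpace.single j 1)|) * ‖x‖ :=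
        ((fderiv ℝ w x).le_opNorm x).trans (mul_le_mul_of_nonneg_right (clm_norm_le _) (norm_nonneg x))
      have hPe : ∑ j, P j x = |w x| * jb (s - ‖x‖) * ∑ j : Fin 3, |fderiv ℝ w x (EuclideanSpace.single j 1)| := by
        rw [Finset.mul_sum]
        refine Finset.sum_congr rfl fun j _ => ?_
        rw [hP]; simp only [abs_mul, abs_of_pos (jb_pos (s - ‖x‖))]; ring
      rw [hPe, abs_mul, abs_mul, abs_mul, abs_of_nonneg hm0, abs_two]
      set Dw := ∑ j : Fin 3, |fderiv ℝ w x (EuclideanSpace.single j 1)|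
      have hDw : 0 ≤ Dw := Finset.sum_nonneg fun _ _ => abs_nonneg _
      calc 2 * m x * |w x| * |fderiv ℝ w x x| ≤ 2 * m x * |w x| * (Dw * ‖x‖) :=
            mul_le_mul_of_nonneg_left hf (by positivity)
        _ = 2 * |w x| * Dw * (m x * ‖x‖) := by ring
        _ ≤ 2 * |w x| * Dw * (2 * jb (s - ‖x‖)) := mul_le_mul_of_nonneg_left hmx (by positivity)
        _ = _ := by ring
    rw [hdg]
    have h9 := mul_le_mul_of_nonneg_left hdb (sq_nonneg (w x))
    have h10 := (abs_le.1 hcross).1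
    have hgx : g x = m x * w x ^ 2 := rfl
    nlinarith
  have hdivi : Integrable fun x => 3 * g x + fderiv ℝ g x x := by
    simp only [← hdiv]
    exact integrable_finsetSum _ fun j _ => hint j
  have hsum : Integrable fun x => ∑ j, P j x := integrable_finsetSum _ fun j _ => hPi j
  have hfin := integral_mono hQi ((hdivi.add hwi).add (hsum.const_mul 4)) hpt
  simp only [Pi.add_apply] at hfin
  have e1 : ∫ x, ((3 * g x + fderiv ℝ g x x + w x ^ 2) + 4 * ∑ j, P j x)
      = (∫ x, (3 * g x + fderiv ℝ g x x)) + (∫ x, w x ^ 2) + 4 * ∑ j, ∫ x, P j x := by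
    have hadd : Integrable fun x => 3 * g x + fderiv ℝ g x x + w x ^ 2 := hdivi.add hwi
    rw [integral_add hadd (hsum.const_mul 4), integral_add hdivi hwi, integral_const_mul,
      integral_finsetSum _ fun j _ => hPi j]
  rw [e1, hzero] at hfin
  have hPb : ∀ j, ∫ x, P j x ≤ A * D := fun j =>
    integral_cauchy_schwarz hA hD hwi (SuppIn.integrable (R := R) (fun x hx => by
      simp [hs.fderiv x hx]) (by have := hdw (EuclideanSpace.single j 1); fun_prop)) h1 (h2 j)
  have hPs : ∑ j, ∫ x, P j x ≤ 3 * (A * D) := (Finset.sum_le_sum fun j _ => hPb j).trans (by simp)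
  linarith

/-- Smooth scalar fields. -/
abbrev SFn : Type := {v : Fn // Sm v}

/-- Real combinations of the operators given by words of length at most `n`. -/
def WSpan (n : ℕ) : Submodule ℝ (SFn → Fn) :=
  Submodule.span ℝ {Φ | ∃ l : List (Fin 7), l.length ≤ n ∧ Φ = fun v => Zw l v.1}

/-- Real combinations of the operators `Z^b` with `|b| ≤ n`. -/
def ZSpan (n : ℕ) : Submodule ℝ (SFn → Fn) :=
  Submodule.span ℝ {Φ | ∃ b : Fin 7 → ℕ, ∑ i, b i ≤ n ∧ Φ = fun v => Zw (wordOf b) v.1}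

lemma WSpan_sm {n : ℕ} {Φ : SFn → Fn} (h : Φ ∈ WSpan n) (v : SFn) : Sm (Φ v) := by
  induction h using Submodule.span_induction with
  | mem Φ h => obtain ⟨l, -, rfl⟩ := h; exact v.2.zw l
  | zero => exact contDiff_const
  | add Φ Ψ _ _ h1 h2 => exact h1.add' h2
  | smul c Φ _ h1 => exact h1.smul' c

lemma ZSpan_mono {m n : ℕ} (h : m ≤ n) : ZSpan m ≤ ZSpan n :=
  Submodule.span_mono fun _ ⟨l, hl, e⟩ => ⟨l, hl.trans h, e⟩

lemma WSpan_Zop {n : ℕ} {Φ : SFn → Fn} (h : Φ ∈ WSpan n) (i : Fin 7) :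
    (fun v => Zop i (Φ v)) ∈ WSpan (n + 1) := by
  induction h using Submodule.span_induction with
  | mem Φ h =>
    obtain ⟨l, hl, rfl⟩ := h
    exact Submodule.subset_span ⟨i :: l, by simpa using hl, rfl⟩
  | zero =>
    convert (WSpan (n + 1)).zero_mem using 1
    funext v; exact Zop_zero i
  | add Φ Ψ h1 h2 e1 e2 =>
    convert (WSpan (n + 1)).add_mem e1 e2 using 1
    funext v; exact Zop_add (WSpan_sm h1 v) (WSpan_sm h2 v) i
  | smul c Φ h1 e1 =>
    convert (WSpan (n + 1)).smul_mem c e1 using 1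
    funext v; exact Zop_smul (WSpan_sm h1 v) c i

lemma word_perm {l l' : List (Fin 7)} (h : l.Perm l') :
    (fun v : SFn => Zw l v.1 - Zw l' v.1) ∈ WSpan (l.length - 1) := by
  induction h with
  | nil =>
    convert (WSpan _).zero_mem using 1
    funext v; exact sub_self _
  | @cons i l l' h ih =>
    have h1 := WSpan_Zop ih i
    by_cases hl : l.length = 0
    · have e : l = [] := List.length_eq_zero_iff.1 hl
      subst e
      have e' : l' = [] := by simpa using h
      subst e'
      convert (WSpan _).zero_mem using 1
      funext v; exact sub_self _
    · have e : l.length - 1 + 1 = (i :: l).length - 1 := by simp; omega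
      rw [e] at h1
      convert h1 using 1
      funext v
      change Zop i (Zw l v.1) - Zop i (Zw l' v.1) = _
      have := Zop_add ((v.2.zw l)) ((v.2.zw l').smul' (-1)) i
      rw [Zop_smul (v.2.zw l')] at this
      rw [sub_eq_add_neg, sub_eq_add_neg, ← neg_one_smul ℝ (Zw l' v.1), this, neg_one_smul]
  | swap i j l =>
    have e : (fun v : SFn => Zw (j :: i :: l) v.1 - Zw (i :: j :: l) v.1)
        = ∑ m, sc j i m • fun v : SFn => Zw (m :: l) v.1 := by
      funext v
      change Zop j (Zop i (Zw l v.1)) - Zop i (Zop j (Zw l v.1)) = _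
      rw [Zop_comm (v.2.zw l), add_sub_cancel_left, Finset.sum_apply]
      rfl
    rw [e]
    exact Submodule.sum_mem _ fun m _ => Submodule.smul_mem _ _
      (Submodule.subset_span ⟨m :: l, by simp, rfl⟩)
  | trans h1 h2 ih1 ih2 =>
    rw [← h1.length_eq] at ih2
    convert (WSpan _).add_mem ih1 ih2 using 1
    funext v; simp

lemma WSpan_le_ZSpan (n : ℕ) : WSpan n ≤ ZSpan n := by
  induction n using Nat.strong_induction_on with
  | _ n ih =>
    refine Submodule.span_le.2 ?_
    rintro Φ ⟨l, hl, rfl⟩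
    have hp : l.Perm (l.insertionSort (· ≤ ·)) := (List.perm_insertionSort _ l).symm
    have hs : (l.insertionSort (· ≤ ·)).Pairwise (· ≤ ·) := List.pairwise_insertionSort _ l
    have hw := eq_wordOf_of_sorted hs
    have h1 : (fun v : SFn => Zw (l.insertionSort (· ≤ ·)) v.1) ∈ ZSpan n := by
      refine Submodule.subset_span
        ⟨fun i => (l.insertionSort (· ≤ ·)).count i, ?_, by rw [← hw]⟩
      rw [← length_wordOf, ← hw, ← hp.length_eq]; exact hl
    have h2 : (fun v : SFn => Zw l v.1 - Zw (l.insertionSort (· ≤ ·)) v.1) ∈ ZSpan n := by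
      rcases Nat.eq_zero_or_pos l.length with h0 | h0
      · have e : l = [] := List.length_eq_zero_iff.1 h0
        subst e
        convert (ZSpan _).zero_mem using 1
        funext v; exact sub_self _
      · exact ZSpan_mono (by omega) (ih (l.length - 1) (by omega) (word_perm hp))
    have h3 := (ZSpan n).add_mem h2 h1
    have e : ((fun v : SFn => Zw l v.1 - Zw (l.insertionSort (· ≤ ·)) v.1)
        + fun v : SFn => Zw (l.insertionSort (· ≤ ·)) v.1) = fun v => Zw l v.1 := by
      funext v; simp
    rwa [e] at h3

/-- The sum of `|∂Z^b v|²` over `|b| ≤ n`. -/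
def DN (n : ℕ) (v : Fn) (p : Pt) : ℝ := ∑ b ∈ idxSet 7 n, ∑ β, (pd β (Zmulti b v) p) ^ 2

lemma DN_nonneg (n : ℕ) (v : Fn) (p : Pt) : 0 ≤ DN n v p := by unfold DN; positivity

lemma DN_mem {n : ℕ} {b : Fin 7 → ℕ} (hb : b ∈ idxSet 7 n) (v : Fn) (p : Pt) :
    ∑ β, (pd β (Zmulti b v) p) ^ 2 ≤ DN n v p :=
  Finset.single_le_sum (f := fun b => ∑ β, (pd β (Zmulti b v) p) ^ 2)
    (fun _ _ => by positivity) hb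

lemma word_pd_sq_le (l : List (Fin 7)) : ∃ C : ℝ, 0 ≤ C ∧ ∀ v, Sm v → ∀ p,
    ∑ α, (pd α (Zw l v) p) ^ 2 ≤ C * DN l.length v p := by
  have key : ∀ Φ ∈ ZSpan l.length, (∀ v, Sm (Φ v)) ∧ ∃ C : ℝ, 0 ≤ C ∧ ∀ v : SFn, ∀ p,
      ∑ α, (pd α (Φ v) p) ^ 2 ≤ C * DN l.length v.1 p := by
    intro Φ h
    induction h using Submodule.span_induction with
    | mem Φ h =>
      obtain ⟨b, hb, rfl⟩ := h
      refine ⟨fun v => v.2.zw _, 1, zero_le_one, fun v p => ?_⟩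
      rw [one_mul]
      simp only [← Zmulti_eq]
      exact DN_mem (mem_idxSet.2 hb) v.1 p
    | zero =>
      refine ⟨fun v => contDiff_const, 0, le_rfl, fun v p => ?_⟩
      have : ∀ α, pd α ((0 : SFn → Fn) v) p = 0 := fun α => by
        change pd α (0 : Fn) p = 0
        rw [pd_zero_fn]; rfl
      rw [zero_mul]
      exact (Finset.sum_eq_zero fun α _ => by rw [this α]; norm_num).le
    | add Φ Ψ _ _ h1 h2 =>
      obtain ⟨s1, C1, hC1, h1⟩ := h1
      obtain ⟨s2, C2, hC2, h2⟩ := h2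
      refine ⟨fun v => (s1 v).add' (s2 v), 2 * C1 + 2 * C2, by positivity, fun v p => ?_⟩
      have : ∑ α, (pd α ((Φ + Ψ) v) p) ^ 2
          ≤ ∑ α, (2 * (pd α (Φ v) p) ^ 2 + 2 * (pd α (Ψ v) p) ^ 2) := by
        refine Finset.sum_le_sum fun α _ => ?_
        change (pd α (Φ v + Ψ v) p) ^ 2 ≤ _
        rw [pd_add (s1 v) (s2 v)]
        simp only [Pi.add_apply]
        nlinarith [sq_nonneg (pd α (Φ v) p - pd α (Ψ v) p)]
      rw [Finset.sum_add_distrib, ← Finset.mul_sum, ← Finset.mul_sum] at this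
      linarith [h1 v p, h2 v p]
    | smul c Φ _ h1 =>
      obtain ⟨s1, C1, hC1, h1⟩ := h1
      refine ⟨fun v => (s1 v).smul' c, c ^ 2 * C1, by positivity, fun v p => ?_⟩
      have : ∑ α, (pd α ((c • Φ) v) p) ^ 2 = c ^ 2 * ∑ α, (pd α (Φ v) p) ^ 2 := by
        rw [Finset.mul_sum]
        refine Finset.sum_congr rfl fun α _ => ?_
        change (pd α (c • Φ v) p) ^ 2 = _
        rw [pd_smul (s1 v)]
        simp only [Pi.smul_apply, smul_eq_mul]
        ring
      rw [this, mul_assoc]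
      exact mul_le_mul_of_nonneg_left (h1 v p) (sq_nonneg c)
  have h := key _ (WSpan_le_ZSpan _ (Submodule.subset_span ⟨l, le_rfl, rfl⟩))
  obtain ⟨-, C, hC, h⟩ := h
  exact ⟨C, hC, fun v hv p => h ⟨v, hv⟩ p⟩

lemma omx_sl {f : Fn} (hf : Sm f) (i j : Fin 3) (t : ℝ) (x : Sp) :
    omx i j (sl f t) x = om i j f (t, x) := by
  unfold omx om
  rw [fderiv_sl hf, fderiv_sl hf]

lemma DN_mono {m n : ℕ} (h : m ≤ n) (v : Fn) (p : Pt) : DN m v p ≤ DN n v p := by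
  refine Finset.sum_le_sum_of_subset_of_nonneg (fun b hb => ?_) fun _ _ _ => by positivity
  rw [mem_idxSet] at *; omega

lemma angSq_word_le (l : List (Fin 7)) : ∃ C : ℝ, 0 ≤ C ∧ ∀ v, Sm v → ∀ (α : Fin 4) (t : ℝ) (x : Sp),
    angSq (sl (pd α (Zw l v)) t) x ≤ C * DN (l.length + 1) v (t, x) := by
  obtain ⟨C0, hC0, h0⟩ := word_pd_sq_le l
  have hk : ∀ k : Fin 7, ∃ C : ℝ, 0 ≤ C ∧ ∀ v, Sm v → ∀ (α : Fin 4) (p : Pt),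
      (Zop k (pd α (Zw l v)) p) ^ 2 ≤ C * DN (l.length + 1) v p := by
    intro k
    obtain ⟨C1, hC1, h1⟩ := word_pd_sq_le (k :: l)
    refine ⟨2 * C1 + 2 * (∑ α, ∑ β, kk k α β ^ 2) * C0, by positivity, fun v hv α p => ?_⟩
    have e : Zop k (pd α (Zw l v)) p = pd α (Zw (k :: l) v) p - ∑ β, kk k α β * pd β (Zw l v) p := by
      have := congrFun (pd_Zop (hv.zw l) α k) p
      simp only [Pi.add_apply, Finset.sum_apply, Pi.smul_apply, smul_eq_mul] at this
      rw [Zw_cons, this]; ring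
    have a1 : (pd α (Zw (k :: l) v) p) ^ 2 ≤ C1 * DN (l.length + 1) v p :=
      (Finset.single_le_sum (f := fun α => (pd α (Zw (k :: l) v) p) ^ 2)
        (fun _ _ => sq_nonneg _) (Finset.mem_univ α)).trans (h1 v hv p)
    have a2 : (∑ β, kk k α β * pd β (Zw l v) p) ^ 2
        ≤ (∑ α, ∑ β, kk k α β ^ 2) * (C0 * DN (l.length + 1) v p) := by
      refine (Finset.sum_mul_sq_le_sq_mul_sq _ _ _).trans ?_
      refine mul_le_mul (Finset.single_le_sum (f := fun α => ∑ β, kk k α β ^ 2)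
        (fun _ _ => by positivity) (Finset.mem_univ α)) ?_ (by positivity) (by positivity)
      exact (h0 v hv p).trans (mul_le_mul_of_nonneg_left (DN_mono (by omega) v p) hC0)
    rw [e]
    nlinarith [sq_nonneg (pd α (Zw (k :: l) v) p + ∑ β, kk k α β * pd β (Zw l v) p)]
  choose C1 hC1 h1 using hk
  refine ⟨C0 + 9 * (7 * ∑ k, C1 k), by have := Finset.sum_nonneg fun k (_ : k ∈ Finset.univ) => hC1 k; positivity,
    fun v hv α t x => ?_⟩
  have hom : ∀ i j, (omx i j (sl (pd α (Zw l v)) t) x) ^ 2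
      ≤ (7 * ∑ k, C1 k) * DN (l.length + 1) v (t, x) := by
    intro i j
    rw [omx_sl ((hv.zw l).pd α)]
    have b1 : (om i j (pd α (Zw l v)) (t, x)) ^ 2 ≤ ZN (pd α (Zw l v)) (t, x) ^ 2 :=
      sq_le_sq.2 ((om_bounds _ _ i j).trans (le_abs_self _))
    refine b1.trans ?_
    unfold ZN
    refine (sq_sum_le_card_mul_sum_sq).trans ?_
    simp only [sq_abs, Finset.card_univ, Fintype.card_fin]
    rw [mul_assoc, Finset.sum_mul]
    push_cast
    exact mul_le_mul_of_nonneg_left (Finset.sum_le_sum fun k _ => h1 k v hv α (t, x)) (by norm_num)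
  have h9 : ∑ i : Fin 3, ∑ j : Fin 3, (omx i j (sl (pd α (Zw l v)) t) x) ^ 2
      ≤ ∑ i : Fin 3, ∑ j : Fin 3, (7 * ∑ k, C1 k) * DN (l.length + 1) v (t, x) :=
    Finset.sum_le_sum fun i _ => Finset.sum_le_sum fun j _ => hom i j
  simp only [Finset.sum_const, Finset.card_univ, Fintype.card_fin, nsmul_eq_mul] at h9
  have h2 : (sl (pd α (Zw l v)) t x) ^ 2 ≤ C0 * DN (l.length + 1) v (t, x) :=
    ((Finset.single_le_sum (f := fun α => (pd α (Zw l v) (t, x)) ^ 2)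
      (fun _ _ => sq_nonneg _) (Finset.mem_univ α)).trans (h0 v hv _)).trans
      (mul_le_mul_of_nonneg_left (DN_mono (by omega) v _) hC0)
  unfold angSq
  push_cast at h9
  linarith

lemma energy_nonneg (c : ℝ) (v : Fn) (t : ℝ) : 0 ≤ energy c v t := by
  rw [energy_eq]; exact integral_nonneg fun x => en_nonneg c v _

lemma Nnorm_nonneg (κ : ℕ) (c : ℝ) (v : Fn) (t : ℝ) : 0 ≤ Nnorm κ c v t := Real.sqrt_nonneg _

lemma Nnorm_sq (κ : ℕ) (c : ℝ) (v : Fn) (t : ℝ) :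
    Nnorm κ c v t ^ 2 = ∑ a ∈ idxSet 7 (κ - 1), energy c (Zmulti a v) t :=
  Real.sq_sqrt (Finset.sum_nonneg fun _ _ => energy_nonneg _ _ _)

lemma Sm.dn {v : Fn} (hv : Sm v) (n : ℕ) : Sm (DN n v) := by
  unfold DN
  exact ContDiff.sum fun b _ => ContDiff.sum fun β _ => ((hv.zmulti b).pd β).pow 2

lemma VanOut.zmulti {O : Set ℝ} {R : ℝ} {f : Fn} (h : VanOut O R f) (hO : IsOpen O)
    (a : Fin 7 → ℕ) : VanOut O R (Zmulti a f) := by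
  rw [Zmulti_eq]; exact h.zw hO _

lemma VanOut.en {O : Set ℝ} {R : ℝ} {f : Fn} (h : VanOut O R f) (hO : IsOpen O) (c : ℝ) :
    VanOut O R (en c f) := fun t ht x hx => by
  have h0 : pt f (t, x) = 0 := h.pd hO 0 t ht x hx
  have h1 : ∀ j : Fin 3, px j f (t, x) = 0 := fun j => h.pd hO j.succ t ht x hx
  simp [MultiSpeedWave.en, h0, h1]

lemma DN_integral {v : Fn} (hv : Sm v) {ci : ℝ} (hci : 0 < ci) {O : Set ℝ} (hO : IsOpen O) {R : ℝ}
    (h : VanOut O R v) {t : ℝ} (ht : t ∈ O) (n : ℕ) :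
    Integrable (fun x => DN n v (t, x)) ∧
    ∫ x, DN n v (t, x) ≤ 2 * (1 + 1 / ci ^ 2) * Nnorm (n + 1) ci v t ^ 2 := by
  have hen : ∀ b, Integrable fun x => en ci (Zmulti b v) (t, x) := fun b =>
    ((VanOut.en (h.zmulti hO b) hO ci).slice ht).integrable (((hv.zmulti b).en ci).slice_cont t)
  have hle : ∀ x, DN n v (t, x)
      ≤ 2 * (1 + 1 / ci ^ 2) * ∑ b ∈ idxSet 7 n, en ci (Zmulti b v) (t, x) := fun x => by
    unfold DN
    rw [Finset.mul_sum]
    exact Finset.sum_le_sum fun b _ => pd_sq_le_en hci _ _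
  have hI : Integrable fun x => 2 * (1 + 1 / ci ^ 2) * ∑ b ∈ idxSet 7 n, en ci (Zmulti b v) (t, x) :=
    (integrable_finsetSum _ fun b _ => hen b).const_mul _
  have hD : Integrable fun x => DN n v (t, x) := by
    refine hI.mono' ((hv.dn n).slice_cont t).aestronglyMeasurable (Filter.Eventually.of_forall fun x => ?_)
    rw [Real.norm_of_nonneg (DN_nonneg _ _ _)]
    exact hle x
  refine ⟨hD, (integral_mono hD hI hle).trans ?_⟩
  rw [integral_const_mul, integral_finsetSum _ fun b _ => hen b, Nnorm_sq]
  simp only [energy_eq, Nat.add_sub_cancel]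
  exact le_rfl

/-- The growth factor allowed for the energy of each component. -/
def epz (θ : ℝ) : Fin 3 → ℝ := ![θ, 1, 1]

lemma epz_bounds {θ : ℝ} (h : 1 ≤ θ) (i : Fin 3) : 1 ≤ epz θ i ∧ epz θ i ≤ θ := by
  fin_cases i <;> simp [epz, h]

/-- Fixed-time bounds on a triple of fields. -/
structure Setup (c0 t q θ K H B R : ℝ) (u : SU) : Prop where
  t_nonneg : 0 ≤ t
  jb_eq : jb t = q ^ 4
  one_le_q : 1 ≤ q
  one_le_θ : 1 ≤ θ
  θ_le : θ ^ 6 ≤ q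
  K_nonneg : 0 ≤ K
  H_nonneg : 0 ≤ H
  B_nonneg : 0 ≤ B
  B_le : B ≤ 1
  van : ∃ O : Set ℝ, IsOpen O ∧ t ∈ O ∧ ∀ i, VanOut O R (u.1 i)
  energy_low : ∀ i, Nnorm 3 (cspeed c0 i) (u.1 i) t ≤ epz θ i * K
  energy_high : ∀ i, Nnorm 4 (cspeed c0 i) (u.1 i) t ≤ θ ^ 2 * H
  weighted_high : ∀ i, Mmu 4 (cspeed c0 i) (u.1 i) t ≤ θ ^ 2 * H
  sup_norm : ∀ i x, ‖x‖ * pdNorm (u.1 i) (t, x) ≤ epz θ i * B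
  sup_mixed : ∀ i, ∀ a ∈ idxSet 7 1, ∀ x, ‖x‖ * Real.sqrt (jb (cspeed c0 i * t - ‖x‖))
    * pdNorm (Zmulti a (u.1 i)) (t, x) ≤ θ ^ 2 * B
  sup_cone : ∀ i, ∀ a ∈ idxSet 7 1, ∀ x, jb (cspeed c0 i * t - ‖x‖)
    * pdNorm (Zmulti a (u.1 i)) (t, x) ≤ θ ^ 2 * B
  sph_norm : ∀ i, ∀ a ∈ idxSet 7 1, ∀ r : ℝ, 0 < r →
    ∫ ω : S2, |r * pdNorm (Zmulti a (u.1 i)) (t, r • (ω : Sp))| ^ 4 ∂sphMeas ≤ (epz θ i * B) ^ 4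
  sph_cone : ∀ i, ∀ a ∈ idxSet 7 2, ∀ r : ℝ, 0 < r →
    ∫ ω : S2, |Real.sqrt r * jb (cspeed c0 i * t - r)
      * pdNorm (Zmulti a (u.1 i)) (t, r • (ω : Sp))| ^ 4 ∂sphMeas ≤ (θ ^ 2 * B) ^ 4
  sph_field : ∀ i, ∀ a ∈ idxSet 7 2, ∀ j, ∀ r : ℝ, 0 < r →
    ∫ ω : S2, |Real.sqrt r * Zop j (Zmulti a (u.1 i)) (t, r • (ω : Sp))| ^ 4 ∂sphMeas
      ≤ (θ ^ 2 * B) ^ 4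

/-- Bounds satisfied at a fixed time by a first derivative of `Z^b u` with `|b| = lev`. -/
structure Factor (c t θ ε K H B R M : ℝ) (lev : ℕ) (w : Sp → ℝ) : Prop where
  sm : ContDiff ℝ 1 w
  supp : SuppIn R w
  l2 : ∫ x, w x ^ 2 ≤ (M * (ε * K)) ^ 2
  ang : ∫ x, angSq w x ≤ (M * (θ ^ 2 * H)) ^ 2
  sph : ∀ r : ℝ, 0 < r →
    ∫ ω : S2, |Real.sqrt r * jb (c * t - r) * w (r • (ω : Sp))| ^ 4 ∂sphMeas ≤ (θ ^ 2 * B) ^ 4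
  hardy : ∫ x, jb (c * t - ‖x‖) * w x ^ 2 / jb ‖x‖ ≤ 13 * M ^ 2 * (θ ^ 3 * K * H)
  sup_mixed : lev ≤ 1 → ∀ x, ‖x‖ * Real.sqrt (jb (c * t - ‖x‖)) * |w x| ≤ θ ^ 2 * B
  sup_cone : lev ≤ 1 → ∀ x, jb (c * t - ‖x‖) * |w x| ≤ θ ^ 2 * B
  sph_norm : lev ≤ 1 → ∀ r : ℝ, 0 < r → ∫ ω : S2, |r * w (r • (ω : Sp))| ^ 4 ∂sphMeas ≤ (ε * B) ^ 4
  ang_low : lev ≤ 1 → ∫ x, angSq w x ≤ (M * (ε * K)) ^ 2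
  sup_norm : lev = 0 → ∀ x, ‖x‖ * |w x| ≤ ε * B

lemma sph_integrable {f : Sp → ℝ} (hf : Continuous f) (r : ℝ) :
    Integrable (fun ω : S2 => |f (r • (ω : Sp))| ^ 4) sphMeas := by
  have hc : Continuous fun ω : S2 => |f (r • (ω : Sp))| ^ 4 := by fun_prop
  exact hc.integrable_of_hasCompactSupport (HasCompactSupport.of_compactSpace _)

lemma pdNorm_cont {v : Fn} (hv : Sm v) (t : ℝ) : Continuous fun x : Sp => pdNorm v (t, x) := by
  unfold pdNorm
  exact (continuous_finsetSum _ fun α _ => ((hv.pd α).slice_cont t).pow 2).sqrt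

lemma sph_mono {f g : Sp → ℝ} (hf : Continuous f) (hg : Continuous g) {r X : ℝ}
    (h : ∀ ω : S2, |f (r • (ω : Sp))| ≤ |g (r • (ω : Sp))|)
    (hX : ∫ ω : S2, |g (r • (ω : Sp))| ^ 4 ∂sphMeas ≤ X) :
    ∫ ω : S2, |f (r • (ω : Sp))| ^ 4 ∂sphMeas ≤ X :=
  (integral_mono (sph_integrable hf r) (sph_integrable hg r)
    fun ω => pow_le_pow_left₀ (abs_nonneg _) (h ω) 4).trans hX

lemma integral_le_of_L2_le {f : Sp → ℝ} {X : ℝ} (hX : 0 ≤ X) (h : L2 f ≤ X) :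
    ∫ x, f x ^ 2 ≤ X ^ 2 := (Real.sqrt_le_left hX).1 h

lemma M2_nonneg (c : ℝ) (v : Fn) (t : ℝ) : 0 ≤ M2 c v t :=
  Finset.sum_nonneg fun _ _ => Finset.sum_nonneg fun _ _ => Real.sqrt_nonneg _

lemma L2_le_Mmu {κ : ℕ} {c : ℝ} {v : Fn} {t : ℝ} {b : Fin 7 → ℕ} (hb : b ∈ idxSet 7 (κ - 2))
    (α : Fin 4) (j : Fin 3) :
    L2 (fun x => jb (c * t - ‖x‖) * pd α (px j (Zmulti b v)) (t, x)) ≤ Mmu κ c v t := by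
  have h1 : L2 (fun x => jb (c * t - ‖x‖) * pd α (px j (Zmulti b v)) (t, x)) ≤ M2 c (Zmulti b v) t := by
    unfold M2
    refine le_trans ?_ (Finset.single_le_sum (f := fun α => ∑ j : Fin 3,
      L2 fun x => jb (c * t - ‖x‖) * pd α (px j (Zmulti b v)) (t, x))
      (fun _ _ => Finset.sum_nonneg fun _ _ => Real.sqrt_nonneg _) (Finset.mem_univ α))
    exact Finset.single_le_sum (f := fun j =>
      L2 fun x => jb (c * t - ‖x‖) * pd α (px j (Zmulti b v)) (t, x))
      (fun _ _ => Real.sqrt_nonneg _) (Finset.mem_univ j)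
  exact h1.trans (Finset.single_le_sum (f := fun b => M2 c (Zmulti b v) t)
    (fun _ _ => M2_nonneg _ _ _) hb)

set_option maxHeartbeats 1000000 in
lemma exists_factor {c0 : ℝ} (h0 : 0 < c0) : ∃ M : ℝ, 1 ≤ M ∧
    ∀ {t q θ K H B R : ℝ} {u : SU}, Setup c0 t q θ K H B R u → ∀ (p : Fin 3) (b : Fin 7 → ℕ),
      ∑ i, b i ≤ 2 → ∀ α : Fin 4, Factor (cspeed c0 p) t θ (epz θ p) K H B R M (∑ i, b i)
        (sl (pd α (Zw (wordOf b) (u.1 p))) t) := by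
  choose C hC hCb using fun b : Fin 7 → ℕ => angSq_word_le (wordOf b)
  set CA := ∑ b ∈ idxSet 7 2, C b with hCA
  have hCA0 : 0 ≤ CA := Finset.sum_nonneg fun b _ => hC b
  set E := ∑ p : Fin 3, 2 * (1 + 1 / cspeed c0 p ^ 2) with hE
  have hEp : ∀ p, 2 * (1 + 1 / cspeed c0 p ^ 2) ≤ E := fun p =>
    Finset.single_le_sum (f := fun p => 2 * (1 + 1 / cspeed c0 p ^ 2))
      (fun _ _ => by positivity) (Finset.mem_univ p)
  have hE0 : 0 ≤ E := Finset.sum_nonneg fun _ _ => by positivity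
  have hM1 : 1 ≤ 1 + E + CA * E := by nlinarith [mul_nonneg hCA0 hE0]
  refine ⟨1 + E + CA * E, hM1, ?_⟩
  intro t q θ K H B R u S p b hb α
  set M := 1 + E + CA * E with hM
  have hM0 : 0 ≤ M := by linarith
  have hMM : M ≤ M ^ 2 := by nlinarith
  have hCE := mul_nonneg hCA0 hE0
  have hEM : E ≤ M ^ 2 := by linarith
  have hCEM : CA * E ≤ M ^ 2 := by linarith
  obtain ⟨O, hO, htO, hvan⟩ := S.van
  obtain ⟨e1, e2⟩ := epz_bounds S.one_le_θ p
  have hθ0 : 0 ≤ θ := by linarith [S.one_le_θ]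
  have hK := S.K_nonneg
  have hH := S.H_nonneg
  have hB := S.B_nonneg
  have hup := u.2 p
  have hcp := cspeed_pos h0 p
  have hV : Sm (Zw (wordOf b) (u.1 p)) := hup.zw _
  have hw := hV.pd α
  have hfd : ∀ x (j : Fin 3), fderiv ℝ (sl (pd α (Zw (wordOf b) (u.1 p))) t) x (EuclideanSpace.single j 1)
      = pd α (px j (Zmulti b (u.1 p))) (t, x) := fun x j => by
    rw [fderiv_sl hw, ← pd_succ, ← pd_succ, pd_comm hV, Zmulti_eq]
  have hsm : ContDiff ℝ 1 (sl (pd α (Zw (wordOf b) (u.1 p))) t) :=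
    (hw.slice t).of_le (by exact_mod_cast le_top)
  have hsupp : SuppIn R (sl (pd α (Zw (wordOf b) (u.1 p))) t) := (((hvan p).zw hO _).pd hO α).slice htO
  have hb2 : b ∈ idxSet 7 2 := mem_idxSet.2 hb
  have hCb2 : C b ≤ CA := Finset.single_le_sum (f := C) (fun b _ => hC b) hb2
  have hlen := length_wordOf b
  have habs : ∀ x, |sl (pd α (Zw (wordOf b) (u.1 p))) t x| ≤ pdNorm (Zmulti b (u.1 p)) (t, x) := fun x => by
    rw [Zmulti_eq]; exact abs_pd_le _ _ α
  have hbound : ∀ n, (∑ i, b i) + 1 ≤ n → ∀ x, angSq (sl (pd α (Zw (wordOf b) (u.1 p))) t) x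
      ≤ CA * DN n (u.1 p) (t, x) := fun n hn x =>
    (hCb b _ hup α t x).trans
      (mul_le_mul hCb2 (DN_mono (by omega) _ _) (DN_nonneg _ _ _) hCA0)
  have hsqle : ∀ x, (sl (pd α (Zw (wordOf b) (u.1 p))) t x) ^ 2 ≤ DN 2 (u.1 p) (t, x) := fun x => by
    refine le_trans ?_ (DN_mem hb2 (u.1 p) (t, x))
    rw [Zmulti_eq]
    exact Finset.single_le_sum (f := fun α => (pd α (Zw (wordOf b) (u.1 p)) (t, x)) ^ 2)
      (fun _ _ => sq_nonneg _) (Finset.mem_univ α)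
  clear hw hV
  generalize sl (pd α (Zw (wordOf b) (u.1 p))) t = w at *
  have hDN : ∀ n, ∫ x, DN n (u.1 p) (t, x) ≤ E * Nnorm (n + 1) (cspeed c0 p) (u.1 p) t ^ 2 := fun n =>
    (DN_integral hup hcp hO (hvan p) htO n).2.trans
      (mul_le_mul_of_nonneg_right (hEp p) (sq_nonneg _))
  have hDNi : ∀ n, Integrable fun x => DN n (u.1 p) (t, x) := fun n =>
    (DN_integral hup hcp hO (hvan p) htO n).1
  have hangi : Integrable (angSq w) := by
    refine SuppIn.integrable (R := R) (fun x hx => ?_) (angSq_cont hsm)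
    have h1 := hsupp x hx
    have h2 := hsupp.fderiv x hx
    simp [angSq, omx, h1, h2]
  have hangn : ∀ n, (∑ i, b i) + 1 ≤ n → ∫ x, angSq w x
      ≤ CA * (E * Nnorm (n + 1) (cspeed c0 p) (u.1 p) t ^ 2) := by
    intro n hn
    refine le_trans ?_ (mul_le_mul_of_nonneg_left (hDN n) hCA0)
    rw [← integral_const_mul]
    refine integral_mono hangi ((hDNi n).const_mul _) fun x => ?_
    exact hbound n hn x
  have hN3 : Nnorm 3 (cspeed c0 p) (u.1 p) t ^ 2 ≤ (epz θ p * K) ^ 2 :=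
    pow_le_pow_left₀ (Nnorm_nonneg _ _ _ _) (S.energy_low p) 2
  have hN4 : Nnorm 4 (cspeed c0 p) (u.1 p) t ^ 2 ≤ (θ ^ 2 * H) ^ 2 :=
    pow_le_pow_left₀ (Nnorm_nonneg _ _ _ _) (S.energy_high p) 2
  have hl2a : ∫ x, (w x) ^ 2 ≤ ∫ x, DN 2 (u.1 p) (t, x) := by
    refine integral_mono ?_ (hDNi 2) fun x => ?_
    · refine SuppIn.integrable (R := R) (fun x hx => ?_) (hsm.continuous.pow 2)
      simp [hsupp x hx]
    · exact hsqle x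
  have hl2 : ∫ x, (w x) ^ 2 ≤ (M * (epz θ p * K)) ^ 2 := by
    refine hl2a.trans ((hDN 2).trans ?_)
    rw [mul_pow]
    exact mul_le_mul hEM hN3 (sq_nonneg _) (sq_nonneg _)
  have hang : ∫ x, angSq w x ≤ (M * (θ ^ 2 * H)) ^ 2 := by
    refine (hangn 3 (by omega)).trans ?_
    rw [mul_pow, ← mul_assoc]
    exact mul_le_mul hCEM hN4 (sq_nonneg _) (sq_nonneg _)
  have hwc := hsm.continuous
  have hpc : Continuous fun x : Sp => pdNorm (Zmulti b (u.1 p)) (t, x) := pdNorm_cont (hup.zmulti b) t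
  have hsq : ∀ X : ℝ, 0 ≤ X → ∀ x, X * |w x|
      ≤ X * pdNorm (Zmulti b (u.1 p)) (t, x) := fun X hX x => mul_le_mul_of_nonneg_left (habs x) hX
  refine ⟨hsm, hsupp, hl2, hang, ?_, ?_, ?_, ?_, ?_, ?_, ?_⟩
  · intro r hr
    refine sph_mono (f := fun x => Real.sqrt r * jb (cspeed c0 p * t - r) * w x)
      (g := fun x => Real.sqrt r * jb (cspeed c0 p * t - r) * pdNorm (Zmulti b (u.1 p)) (t, x))
      (by fun_prop) (by fun_prop) (fun ω => ?_) (S.sph_cone p b hb2 r hr)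
    rw [abs_mul, abs_mul (Real.sqrt r * _)]
    exact mul_le_mul_of_nonneg_left ((habs _).trans (le_abs_self _)) (abs_nonneg _)
  · have hD : ∀ j : Fin 3, ∫ x, (jb (cspeed c0 p * t - ‖x‖)
        * fderiv ℝ w x (EuclideanSpace.single j 1)) ^ 2
          ≤ (θ ^ 2 * H) ^ 2 := by
      intro j
      have h1 := (L2_le_Mmu (κ := 4) (c := cspeed c0 p) (v := u.1 p) (t := t) hb2 α j).trans
        (S.weighted_high p)
      have h2 := integral_le_of_L2_le (by positivity) h1
      simp only [hfd]
      exact h2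
    have hA : ∫ x, (w x) ^ 2
        ≤ (min (M * (epz θ p * K)) (M * (θ ^ 2 * H))) ^ 2 := by
      rcases min_choice (M * (epz θ p * K)) (M * (θ ^ 2 * H)) with h | h <;> rw [h]
      · exact hl2
      · refine le_trans (integral_mono ?_ hangi fun x => ?_) hang
        · refine SuppIn.integrable (R := R) (fun x hx => ?_) (hsm.continuous.pow 2)
          simp [hsupp x hx]
        · simp only [angSq]
          have : 0 ≤ ∑ i, ∑ j, (omx i j w x) ^ 2 := by positivity
          linarith
    have hA1 : 0 ≤ M * (epz θ p * K) := by have : 0 ≤ epz θ p := by linarith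
                                           positivity
    have hA2 : 0 ≤ M * (θ ^ 2 * H) := by positivity
    have hA0 := le_min hA1 hA2
    refine (MultiSpeedWave.hardy hsupp hsm (cspeed c0 p * t) hA0 (D := θ ^ 2 * H) (by positivity) hA hD).trans ?_
    have g1 : (min (M * (epz θ p * K)) (M * (θ ^ 2 * H))) ^ 2 ≤ M * (epz θ p * K) * (M * (θ ^ 2 * H)) := by
      rw [sq]; exact mul_le_mul (min_le_left _ _) (min_le_right _ _) hA0 hA1
    have g2 : 12 * min (M * (epz θ p * K)) (M * (θ ^ 2 * H)) * (θ ^ 2 * H)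
        ≤ 12 * (M * (epz θ p * K)) * (M * (θ ^ 2 * H)) := by
      have := min_le_left (M * (epz θ p * K)) (M * (θ ^ 2 * H))
      have h3 : θ ^ 2 * H ≤ M * (θ ^ 2 * H) := le_mul_of_one_le_left (by positivity) hM1
      exact mul_le_mul (by linarith) h3 (by positivity) (by linarith)
    have g3 : 13 * (M * (epz θ p * K) * (M * (θ ^ 2 * H))) ≤ 13 * M ^ 2 * (θ ^ 3 * K * H) := by
      have : epz θ p * (M ^ 2 * θ ^ 2 * K * H) ≤ θ * (M ^ 2 * θ ^ 2 * K * H) :=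
        mul_le_mul_of_nonneg_right e2 (by positivity)
      linarith
    linarith
  · intro hl x
    exact (hsq _ (by positivity) x).trans (S.sup_mixed p b (mem_idxSet.2 hl) x)
  · intro hl x
    exact (hsq _ (jb_pos _).le x).trans (S.sup_cone p b (mem_idxSet.2 hl) x)
  · intro hl r hr
    refine sph_mono (f := fun x => r * w x)
      (g := fun x => r * pdNorm (Zmulti b (u.1 p)) (t, x))
      (by fun_prop) (by fun_prop) (fun ω => ?_) (S.sph_norm p b (mem_idxSet.2 hl) r hr)
    rw [abs_mul, abs_mul r]
    exact mul_le_mul_of_nonneg_left ((habs _).trans (le_abs_self _)) (abs_nonneg _)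
  · intro hl
    refine (hangn 2 (by omega)).trans ?_
    rw [mul_pow, ← mul_assoc]
    exact mul_le_mul hCEM hN3 (sq_nonneg _) (sq_nonneg _)
  · intro hl x
    have hb0 : b = 0 := by
      funext i
      exact (Finset.sum_eq_zero_iff.1 hl) i (Finset.mem_univ i)
    refine (hsq _ (norm_nonneg _) x).trans ?_
    have e : Zmulti b (u.1 p) = u.1 p := by
      subst hb0
      rw [Zmulti_eq]
      have : wordOf 0 = [] := List.length_eq_zero_iff.1 (by rw [length_wordOf]; simp)
      rw [this]; rfl
    rw [e]
    exact S.sup_norm p x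

/-- `|g|` is bounded on `D` by a nonnegative function whose integral is at most `X`. -/
def Dom (g : Sp → ℝ) (D : Set Sp) (X : ℝ) : Prop :=
  ∃ E : Sp → ℝ, Integrable E ∧ (∀ x, 0 ≤ E x) ∧ (∀ x ∈ D, |g x| ≤ E x) ∧ ∫ x, E x ≤ X

lemma Dom.union {g : Sp → ℝ} {D D' : Set Sp} {X X' : ℝ} (h : Dom g D X) (h' : Dom g D' X') :
    Dom g (D ∪ D') (X + X') := by
  obtain ⟨E, e1, e2, e3, e4⟩ := h
  obtain ⟨E', e1', e2', e3', e4'⟩ := h'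
  refine ⟨fun x => E x + E' x, e1.add e1', fun x => add_nonneg (e2 x) (e2' x), ?_, ?_⟩
  · rintro x (hx | hx)
    · linarith [e3 x hx, e2' x]
    · linarith [e3' x hx, e2 x]
  · rw [integral_add e1 e1']; linarith

lemma Dom.mono {g g' : Sp → ℝ} {D D' : Set Sp} {X X' : ℝ} (h : Dom g D X) (hD : D' ⊆ D)
    (hX : X ≤ X') (hg : ∀ x, |g' x| ≤ |g x|) : Dom g' D' X' := by
  obtain ⟨E, e1, e2, e3, e4⟩ := h
  exact ⟨E, e1, e2, fun x hx => (hg x).trans (e3 x (hD hx)), e4.trans hX⟩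

lemma Dom.congr {g g' : Sp → ℝ} {D : Set Sp} {X : ℝ} (h : Dom g D X) (hg : ∀ x, g' x = g x) :
    Dom g' D X := h.mono subset_rfl le_rfl fun x => by rw [hg]

lemma Dom.integral_le {g : Sp → ℝ} {X : ℝ} (h : Dom g univ X) : ∫ x, |g x| ≤ X := by
  obtain ⟨E, e1, e2, e3, e4⟩ := h
  exact (integral_mono_of_nonneg (Filter.Eventually.of_forall fun x => abs_nonneg _) e1
    (Filter.Eventually.of_forall fun x => e3 x (mem_univ x))).trans e4

lemma Dom.zero (D : Set Sp) : Dom (fun _ => 0) D 0 :=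
  ⟨fun _ => 0, integrable_zero _ _ _, fun _ => le_rfl, fun x _ => by simp, by simp⟩

lemma Dom.add {g g' : Sp → ℝ} {D : Set Sp} {X X' : ℝ} (h : Dom g D X) (h' : Dom g' D X') :
    Dom (fun x => g x + g' x) D (X + X') := by
  obtain ⟨E, e1, e2, e3, e4⟩ := h
  obtain ⟨E', e1', e2', e3', e4'⟩ := h'
  refine ⟨fun x => E x + E' x, e1.add e1', fun x => add_nonneg (e2 x) (e2' x), fun x hx => ?_, ?_⟩
  · exact (abs_add_le _ _).trans (add_le_add (e3 x hx) (e3' x hx))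
  · rw [integral_add e1 e1']; linarith

lemma Dom.const_mul {g : Sp → ℝ} {D : Set Sp} {X : ℝ} (h : Dom g D X) (c : ℝ) :
    Dom (fun x => c * g x) D (|c| * X) := by
  obtain ⟨E, e1, e2, e3, e4⟩ := h
  refine ⟨fun x => |c| * E x, e1.const_mul _, fun x => mul_nonneg (abs_nonneg _) (e2 x), fun x hx => ?_, ?_⟩
  · rw [abs_mul]; exact mul_le_mul_of_nonneg_left (e3 x hx) (abs_nonneg _)
  · rw [integral_const_mul]; exact mul_le_mul_of_nonneg_left e4 (abs_nonneg _)

lemma Dom.sum {ι : Type*} (s : Finset ι) {g : ι → Sp → ℝ} {D : Set Sp} {X : ι → ℝ}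
    (h : ∀ i ∈ s, Dom (g i) D (X i)) : Dom (fun x => ∑ i ∈ s, g i x) D (∑ i ∈ s, X i) := by
  classical
  induction s using Finset.induction_on with
  | empty => simpa using Dom.zero D
  | insert i s hi ih =>
    simp only [Finset.sum_insert hi]
    exact (h i (Finset.mem_insert_self i s)).add (ih fun j hj => h j (Finset.mem_insert_of_mem hj))

/-- The product of two functions with bounded `L²` norms is dominated. -/
lemma Dom.of_l2 {f g : Sp → ℝ} {A B R : ℝ} (hf : Continuous f) (hg : Continuous g)
    (sf : SuppIn R f) (sg : SuppIn R g) (hA : 0 ≤ A) (hB : 0 ≤ B)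
    (h1 : ∫ x, f x ^ 2 ≤ A ^ 2) (h2 : ∫ x, g x ^ 2 ≤ B ^ 2) :
    Dom (fun x => f x * g x) univ (A * B) := by
  have i1 : Integrable fun x => f x ^ 2 :=
    SuppIn.integrable (R := R) (fun x hx => by simp [sf x hx]) (hf.pow 2)
  have i2 : Integrable fun x => g x ^ 2 :=
    SuppIn.integrable (R := R) (fun x hx => by simp [sg x hx]) (hg.pow 2)
  have i3 : Integrable fun x => |f x * g x| :=
    SuppIn.integrable (R := R) (fun x hx => by simp [sf x hx]) (hf.mul hg).abs
  exact ⟨fun x => |f x * g x|, i3, fun x => abs_nonneg _, fun x _ => le_rfl,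
    integral_cauchy_schwarz hA hB i1 i2 h1 h2⟩

/-- `Factor` for the component `p` of the system. -/
abbrev Fct (c0 t θ K H B R M : ℝ) (p : Fin 3) (lev : ℕ) (w : Sp → ℝ) : Prop :=
  Factor (cspeed c0 p) t θ (epz θ p) K H B R M lev w

lemma Setup.gain {c0 t q θ K H B R : ℝ} {u : SU} (S : Setup c0 t q θ K H B R u) :
    θ ^ 5 * (B * K * H) / q ^ 6 ≤ B * K * H / q ^ 5 := by
  have hq : 0 < q := by linarith [S.one_le_q]
  have := S.B_nonneg
  have := S.K_nonneg
  have := S.H_nonneg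
  have h1 : θ ^ 5 ≤ q := (pow_le_pow_right₀ S.one_le_θ (by norm_num)).trans S.θ_le
  rw [div_le_div_iff₀ (by positivity) (by positivity)]
  have : θ ^ 5 * (B * K * H) ≤ q * (B * K * H) := mul_le_mul_of_nonneg_right h1 (by positivity)
  calc θ ^ 5 * (B * K * H) * q ^ 5 ≤ q * (B * K * H) * q ^ 5 := mul_le_mul_of_nonneg_right this (by positivity)
    _ = _ := by ring

lemma weight_integrable {w : Sp → ℝ} {R : ℝ} (hw : Continuous w) (hs : SuppIn R w) (s : ℝ) :
    Integrable fun x => jb (s - ‖x‖) * w x ^ 2 / jb ‖x‖ := by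
  refine SuppIn.integrable (R := R) (fun x hx => by simp [hs x hx]) ?_
  exact ((jb_cont.comp (continuous_const.sub continuous_norm)).mul (hw.pow 2)).div
    (jb_cont.comp continuous_norm) fun x => (jb_pos _).ne'

lemma trilinear_interior {c0 M : ℝ} (h0 : 0 < c0) (hne : c0 ≠ 1) :
    ∃ C : ℝ, 0 ≤ C ∧ ∀ {t q θ K H B R : ℝ} {u : SU}, Setup c0 t q θ K H B R u →
      ∀ {pa pb pc : Fin 3} {la lb lc : ℕ} {wa wb wc : Sp → ℝ}, Fct c0 t θ K H B R M pa la wa →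
        Fct c0 t θ K H B R M pb lb wb → Fct c0 t θ K H B R M pc lc wc → la ≤ 1 →
        Dom (fun x => wa x * wb x * wc x) {x | ‖x‖ ≤ kap c0 * q ^ 4} (C * (B * K * H / q ^ 5)) := by
  set κ := kap c0 with hκd
  have hκ : 0 < κ := kap_pos h0 hne
  have hκ4 : κ ≤ 1 / 4 := kap_le c0
  refine ⟨26 * M ^ 2 / κ ^ 2, by positivity, ?_⟩
  intro t q θ K H B R u S pa pb pc la lb lc wa wb wc ha hb hc hla
  have hq : 0 < q := by linarith [S.one_le_q]
  have hq1 := S.one_le_q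
  have hB := S.B_nonneg
  have hθ : 0 < θ := by linarith [S.one_le_θ]
  have hi2 := weight_integrable hb.sm.continuous hb.supp (cspeed c0 pb * t)
  have hi3 := weight_integrable hc.sm.continuous hc.supp (cspeed c0 pc * t)
  refine ⟨fun x => θ ^ 2 * B / (κ ^ 2 * q ^ 6) * (jb (cspeed c0 pb * t - ‖x‖) * wb x ^ 2 / jb ‖x‖
    + jb (cspeed c0 pc * t - ‖x‖) * wc x ^ 2 / jb ‖x‖), (hi2.add hi3).const_mul _, fun x => ?_,
    fun x hx => ?_, ?_⟩
  · have := jb_pos ‖x‖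
    have := jb_pos (cspeed c0 pb * t - ‖x‖)
    have := jb_pos (cspeed c0 pc * t - ‖x‖)
    positivity
  · have hx' : ‖x‖ ≤ κ * jb t := by rw [S.jb_eq]; exact hx
    have Ja := interior_far h0 hne S.t_nonneg hx' pa
    have Jb := interior_far h0 hne S.t_nonneg hx' pb
    have Jc := interior_far h0 hne S.t_nonneg hx' pc
    rw [S.jb_eq, ← hκd] at Ja Jb Jc
    have hj := jb_pos ‖x‖
    have hκq : 0 < κ * q ^ 4 := by positivity
    have s1 : κ * q ^ 4 * |wa x| ≤ θ ^ 2 * B :=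
      (mul_le_mul_of_nonneg_right Ja (abs_nonneg _)).trans (ha.sup_cone hla x)
    have s2 : κ * q ^ 2 ≤ Real.sqrt (jb (cspeed c0 pa * t - ‖x‖)) := by
      refine Real.le_sqrt_of_sq_le (le_trans ?_ Ja)
      have : κ ^ 2 ≤ κ := by nlinarith
      calc (κ * q ^ 2) ^ 2 = κ ^ 2 * q ^ 4 := by ring
        _ ≤ κ * q ^ 4 := mul_le_mul_of_nonneg_right this (by positivity)
    have s3 : κ * q ^ 2 * (‖x‖ * |wa x|) ≤ θ ^ 2 * B := by
      refine le_trans (mul_le_mul_of_nonneg_right s2 (by positivity)) ?_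
      have := ha.sup_mixed hla x
      calc _ = ‖x‖ * Real.sqrt (jb (cspeed c0 pa * t - ‖x‖)) * |wa x| := by ring
        _ ≤ _ := this
    have s4 : κ * q ^ 2 * |wa x| ≤ θ ^ 2 * B := by
      refine le_trans (mul_le_mul_of_nonneg_right ?_ (abs_nonneg _)) s1
      exact mul_le_mul_of_nonneg_left (pow_le_pow_right₀ hq1 (by norm_num)) hκ.le
    have s5 : κ * q ^ 2 * (jb ‖x‖ * |wa x|) ≤ 2 * (θ ^ 2 * B) := by
      have h1 := jb_le ‖x‖
      rw [abs_of_nonneg (norm_nonneg x)] at h1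
      have h2 : κ * q ^ 2 * (jb ‖x‖ * |wa x|) ≤ κ * q ^ 2 * ((1 + ‖x‖) * |wa x|) := by gcongr
      nlinarith
    have s6 : κ * q ^ 4 * (|wb x| * |wc x|) ≤
        (jb (cspeed c0 pb * t - ‖x‖) * wb x ^ 2 + jb (cspeed c0 pc * t - ‖x‖) * wc x ^ 2) / 2 := by
      have h1 : κ * q ^ 4 * wb x ^ 2 ≤ jb (cspeed c0 pb * t - ‖x‖) * wb x ^ 2 :=
        mul_le_mul_of_nonneg_right Jb (sq_nonneg _)
      have h2 : κ * q ^ 4 * wc x ^ 2 ≤ jb (cspeed c0 pc * t - ‖x‖) * wc x ^ 2 :=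
        mul_le_mul_of_nonneg_right Jc (sq_nonneg _)
      have h3 : |wb x| * |wc x| ≤ (wb x ^ 2 + wc x ^ 2) / 2 := by
        rw [← sq_abs (wb x), ← sq_abs (wc x)]
        nlinarith [sq_nonneg (|wb x| - |wc x|)]
      nlinarith [mul_le_mul_of_nonneg_left h3 hκq.le]
    set Y := jb (cspeed c0 pb * t - ‖x‖) * wb x ^ 2 + jb (cspeed c0 pc * t - ‖x‖) * wc x ^ 2 with hY
    have e : θ ^ 2 * B / (κ ^ 2 * q ^ 6) * (jb (cspeed c0 pb * t - ‖x‖) * wb x ^ 2 / jb ‖x‖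
      + jb (cspeed c0 pc * t - ‖x‖) * wc x ^ 2 / jb ‖x‖) = (2 * (θ ^ 2 * B)) * (Y / 2) / (κ ^ 2 * q ^ 6 * jb ‖x‖) := by
      rw [hY]; field_simp
    beta_reduce
    rw [e, le_div_iff₀ (by positivity), abs_mul, abs_mul]
    calc |wa x| * |wb x| * |wc x| * (κ ^ 2 * q ^ 6 * jb ‖x‖)
        = (κ * q ^ 2 * (jb ‖x‖ * |wa x|)) * (κ * q ^ 4 * (|wb x| * |wc x|)) := by ring
      _ ≤ _ := mul_le_mul s5 s6 (by positivity) (by positivity)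
  · rw [integral_const_mul, integral_add hi2 hi3]
    have h1 : θ ^ 2 * B / (κ ^ 2 * q ^ 6) * (13 * M ^ 2 * (θ ^ 3 * K * H) + 13 * M ^ 2 * (θ ^ 3 * K * H))
        = 26 * M ^ 2 / κ ^ 2 * (θ ^ 5 * (B * K * H) / q ^ 6) := by field_simp; ring
    refine (mul_le_mul_of_nonneg_left (add_le_add hb.hardy hc.hardy) (by positivity)).trans ?_
    rw [h1]
    exact mul_le_mul_of_nonneg_left S.gain (by positivity)

/-- The angular product estimate, with a third factor in `L²`. -/
lemma exists_angular_trilinear : ∃ C : ℝ, 1 ≤ C ∧ ∀ {f g h : Sp → ℝ} {R Λ G L : ℝ}, Continuous f →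
    ContDiff ℝ 1 g → Continuous h → SuppIn R g → SuppIn R h → 0 ≤ Λ → 0 ≤ G → 0 ≤ L →
    (∀ r : ℝ, 0 < r → ∫ ω : S2, |f (r • (ω : Sp))| ^ 4 ∂sphMeas ≤ Λ ^ 4) →
    ∫ x, angSq g x ≤ G ^ 2 → ∫ x, h x ^ 2 ≤ L ^ 2 →
    Dom (fun x => f x * g x * h x) univ (C * (Λ * G * L)) := by
  obtain ⟨C, hC, hp⟩ := exists_angular_product
  refine ⟨C + 1, by linarith, ?_⟩
  intro f g h R Λ G L hf hg hh sg sh hΛ hG hL hs ha hl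
  have h1 : ∫ x, (f x * g x) ^ 2 ≤ ((C + 1) * (Λ * G)) ^ 2 := by
    refine (hp f g hf hg sg.compact Λ hΛ hs).trans ?_
    have : C * Λ ^ 2 * ∫ x, angSq g x ≤ C * Λ ^ 2 * G ^ 2 := mul_le_mul_of_nonneg_left ha (by positivity)
    refine this.trans ?_
    rw [mul_pow, mul_pow, ← mul_assoc]
    gcongr
    nlinarith
  have := Dom.of_l2 (R := R) (hf.mul hg.continuous) hh (fun x hx => by simp [sg x hx]) sh
    (by positivity) hL h1 hl
  exact this.mono subset_rfl (by rw [← mul_assoc, ← mul_assoc, ← mul_assoc]) fun x => le_rfl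

lemma sqrt_norm_gain {κ q : ℝ} (hκ : 0 < κ) (hκ1 : κ ≤ 1) (hq : 0 < q) {r : ℝ} (h : κ * q ^ 4 ≤ r) :
    κ * q ^ 2 ≤ Real.sqrt r := by
  refine Real.le_sqrt_of_sq_le (le_trans ?_ h)
  have : κ ^ 2 ≤ κ := by nlinarith
  calc (κ * q ^ 2) ^ 2 = κ ^ 2 * q ^ 4 := by ring
    _ ≤ κ * q ^ 4 := mul_le_mul_of_nonneg_right this (by positivity)

lemma Dom.scale {g g' : Sp → ℝ} {D : Set Sp} {X m : ℝ} (h : Dom g univ X) (hm : 0 < m)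
    (hg : ∀ x ∈ D, m * |g' x| ≤ |g x|) : Dom g' D (X / m) := by
  obtain ⟨E, e1, e2, e3, e4⟩ := h
  refine ⟨fun x => E x / m, e1.div_const _, fun x => div_nonneg (e2 x) hm.le, fun x hx => ?_, ?_⟩
  · rw [le_div_iff₀ hm, mul_comm]
    exact (hg x hx).trans (e3 x (mem_univ x))
  · rw [integral_div]; gcongr

lemma norm_smul_sphere {r : ℝ} (hr : 0 < r) (ω : S2) : ‖r • (ω : Sp)‖ = r := by
  rw [norm_smul, norm_eq_of_mem_sphere ω, mul_one, Real.norm_of_nonneg hr.le]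

lemma trilinear_off_cone {c0 M : ℝ} (h0 : 0 < c0) (hne : c0 ≠ 1) (hM : 0 ≤ M) :
    ∃ C : ℝ, 0 ≤ C ∧ ∀ {t q θ K H B R : ℝ} {u : SU}, Setup c0 t q θ K H B R u →
      ∀ {pa pb pc : Fin 3} {la lb lc : ℕ} {wa wb wc : Sp → ℝ}, Fct c0 t θ K H B R M pa la wa →
        Fct c0 t θ K H B R M pb lb wb → Fct c0 t θ K H B R M pc lc wc →
        Dom (fun x => wa x * wb x * wc x)
          {x | kap c0 * q ^ 4 ≤ ‖x‖ ∧ kap c0 * q ^ 4 ≤ jb (cspeed c0 pa * t - ‖x‖)}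
          (C * (B * K * H / q ^ 5)) := by
  obtain ⟨C, hC, hang⟩ := exists_angular_trilinear
  set κ := kap c0 with hκd
  have hκ : 0 < κ := kap_pos h0 hne
  have hκ4 : κ ≤ 1 / 4 := kap_le c0
  refine ⟨C * M ^ 2 / κ ^ 2, by positivity, ?_⟩
  intro t q θ K H B R u S pa pb pc la lb lc wa wb wc ha hb hc
  have hq : 0 < q := by linarith [S.one_le_q]
  have hB := S.B_nonneg
  have hK := S.K_nonneg
  have hH := S.H_nonneg
  have hθ : 0 < θ := by linarith [S.one_le_θ]
  obtain ⟨e1, e2⟩ := epz_bounds S.one_le_θ pc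
  have e0 : 0 ≤ epz θ pc := by linarith
  have hac := ha.sm.continuous
  have hf : Continuous fun x : Sp => Real.sqrt ‖x‖ * jb (cspeed c0 pa * t - ‖x‖) * wa x :=
    ((continuous_norm.sqrt).mul (jb_cont.comp (continuous_const.sub continuous_norm))).mul hac
  have hd := hang (L := M * (epz θ pc * K)) (Λ := θ ^ 2 * B) (G := M * (θ ^ 2 * H)) hf hb.sm hc.sm.continuous hb.supp hc.supp
    (by positivity) (by positivity) (by positivity)
    (fun r hr => by
      simp only [norm_smul_sphere hr]
      exact ha.sph r hr) hb.ang hc.l2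
  have hd2 := hd.scale (g' := fun x => wa x * wb x * wc x) (m := κ ^ 2 * q ^ 6)
    (D := {x | κ * q ^ 4 ≤ ‖x‖ ∧ κ * q ^ 4 ≤ jb (cspeed c0 pa * t - ‖x‖)}) (by positivity) (by
    rintro x ⟨h1, h2⟩
    have h3 := sqrt_norm_gain hκ (by linarith) hq h1
    have h4 : κ ^ 2 * q ^ 6 ≤ Real.sqrt ‖x‖ * jb (cspeed c0 pa * t - ‖x‖) := by
      calc κ ^ 2 * q ^ 6 = (κ * q ^ 2) * (κ * q ^ 4) := by ring
        _ ≤ _ := mul_le_mul h3 h2 (by positivity) (by positivity)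
    have e : Real.sqrt ‖x‖ * jb (cspeed c0 pa * t - ‖x‖) * wa x * wb x * wc x
        = Real.sqrt ‖x‖ * jb (cspeed c0 pa * t - ‖x‖) * (wa x * wb x * wc x) := by ring
    rw [e, abs_mul (Real.sqrt ‖x‖ * jb (cspeed c0 pa * t - ‖x‖)),
      abs_of_nonneg (mul_nonneg (Real.sqrt_nonneg _) (jb_pos _).le)]
    exact mul_le_mul_of_nonneg_right h4 (abs_nonneg _))
  refine hd2.mono subset_rfl ?_ fun x => le_rfl
  have h1 : C * (θ ^ 2 * B * (M * (θ ^ 2 * H)) * (M * (epz θ pc * K))) / (κ ^ 2 * q ^ 6)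
      ≤ C * (θ ^ 2 * B * (M * (θ ^ 2 * H)) * (M * (θ * K))) / (κ ^ 2 * q ^ 6) := by gcongr
  refine h1.trans ?_
  have h2 : C * (θ ^ 2 * B * (M * (θ ^ 2 * H)) * (M * (θ * K))) / (κ ^ 2 * q ^ 6)
      = C * M ^ 2 / κ ^ 2 * (θ ^ 5 * (B * K * H) / q ^ 6) := by field_simp
  rw [h2]
  exact mul_le_mul_of_nonneg_left S.gain (by positivity)

lemma trilinear_interior_any {c0 M : ℝ} (h0 : 0 < c0) (hne : c0 ≠ 1) :
    ∃ C : ℝ, 0 ≤ C ∧ ∀ {t q θ K H B R : ℝ} {u : SU}, Setup c0 t q θ K H B R u →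
      ∀ {pa pb pc : Fin 3} {la lb lc : ℕ} {wa wb wc : Sp → ℝ}, Fct c0 t θ K H B R M pa la wa →
        Fct c0 t θ K H B R M pb lb wb → Fct c0 t θ K H B R M pc lc wc → lb + lc ≤ 2 →
        Dom (fun x => wa x * wb x * wc x) {x | ‖x‖ ≤ kap c0 * q ^ 4} (C * (B * K * H / q ^ 5)) := by
  obtain ⟨C, hC, h⟩ := trilinear_interior (M := M) h0 hne
  refine ⟨C, hC, ?_⟩
  intro t q θ K H B R u S pa pb pc la lb lc wa wb wc ha hb hc hl
  by_cases hb1 : lb ≤ 1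
  · exact (h S hb ha hc hb1).congr fun x => by ring
  · exact (h S hc ha hb (by omega)).congr fun x => by ring

lemma trilinear_nonresonant {c0 M : ℝ} (h0 : 0 < c0) (hne : c0 ≠ 1) (hM : 0 ≤ M) :
    ∃ C : ℝ, 0 ≤ C ∧ ∀ {t q θ K H B R : ℝ} {u : SU}, Setup c0 t q θ K H B R u →
      ∀ {pa pb pc : Fin 3} {la lb lc : ℕ} {wa wb wc : Sp → ℝ}, Fct c0 t θ K H B R M pa la wa →
        Fct c0 t θ K H B R M pb lb wb → Fct c0 t θ K H B R M pc lc wc → lb + lc ≤ 2 →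
        ¬ (cspeed c0 pa = cspeed c0 pb ∧ cspeed c0 pa = cspeed c0 pc) →
        Dom (fun x => wa x * wb x * wc x) univ (C * (B * K * H / q ^ 5)) := by
  obtain ⟨C1, hC1, hI⟩ := trilinear_interior_any (M := M) h0 hne
  obtain ⟨C2, hC2, hO⟩ := trilinear_off_cone h0 hne hM
  refine ⟨C1 + (C2 + C2), by positivity, ?_⟩
  intro t q θ K H B R u S pa pb pc la lb lc wa wb wc ha hb hc hl hs
  have key : ∀ {p p' : Fin 3}, cspeed c0 p ≠ cspeed c0 p' →
      Dom (fun x => wa x * wb x * wc x)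
        {x | kap c0 * q ^ 4 ≤ ‖x‖ ∧ kap c0 * q ^ 4 ≤ jb (cspeed c0 p * t - ‖x‖)}
        (C2 * (B * K * H / q ^ 5)) →
      Dom (fun x => wa x * wb x * wc x)
        {x | kap c0 * q ^ 4 ≤ ‖x‖ ∧ kap c0 * q ^ 4 ≤ jb (cspeed c0 p' * t - ‖x‖)}
        (C2 * (B * K * H / q ^ 5)) →
      Dom (fun x => wa x * wb x * wc x) univ ((C1 + (C2 + C2)) * (B * K * H / q ^ 5)) := by
    intro p p' hpp h1 h2
    refine ((hI S ha hb hc hl).union (h1.union h2)).mono (fun x _ => ?_) (by rw [add_mul, add_mul])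
      fun x => le_rfl
    rcases le_total ‖x‖ (kap c0 * q ^ 4) with h | h
    · exact Or.inl h
    · right
      have := cones_separate h0 hne S.t_nonneg (r := ‖x‖) hpp
      rw [S.jb_eq] at this
      exact this.imp (fun h' => ⟨h, h'⟩) fun h' => ⟨h, h'⟩
  have oa := hO S ha hb hc
  have ob := (hO S hb ha hc).congr (g' := fun x => wa x * wb x * wc x) fun x => by ring
  have oc := (hO S hc ha hb).congr (g' := fun x => wa x * wb x * wc x) fun x => by ring
  by_cases hab : cspeed c0 pa = cspeed c0 pb
  · exact key (fun hac => hs ⟨hab, hac⟩) oa oc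
  · exact key hab oa ob

lemma trilinear_resonant {c0 M : ℝ} (h0 : 0 < c0) (hne : c0 ≠ 1) (hM : 0 ≤ M) :
    ∃ C : ℝ, 0 ≤ C ∧ ∀ {t q θ K H B R : ℝ} {u : SU}, Setup c0 t q θ K H B R u →
      ∀ {pa pb pc : Fin 3} {la lb lc : ℕ} {wa wb wc : Sp → ℝ} {Y : ℝ}, Fct c0 t θ K H B R M pa la wa →
        Fct c0 t θ K H B R M pb lb wb → Fct c0 t θ K H B R M pc lc wc → lb + lc ≤ 2 →
        epz θ pb * epz θ pc ≤ θ → 0 ≤ Y → ∫ x, wa x ^ 2 ≤ Y ^ 2 →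
        Dom (fun x => wa x * wb x * wc x) univ
          (C * (B * K * H / q ^ 5 + θ * (B * K) * Y / q ^ 4)) := by
  obtain ⟨C1, hC1, hI⟩ := trilinear_interior_any (M := M) h0 hne
  obtain ⟨C2, hC2, hang⟩ := exists_angular_trilinear
  set κ := kap c0 with hκd
  have hκ : 0 < κ := kap_pos h0 hne
  refine ⟨C1 + (C2 * M) / κ, by positivity, ?_⟩
  intro t q θ K H B R u S pa pb pc la lb lc wa wb wc Y ha hb hc hl hε hY hwa
  have hq : 0 < q := by linarith [S.one_le_q]
  have hB := S.B_nonneg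
  have hK := S.K_nonneg
  have hH := S.H_nonneg
  have hθ : 0 < θ := by linarith [S.one_le_θ]
  have eb := (epz_bounds S.one_le_θ pb).1
  have ec := (epz_bounds S.one_le_θ pc).1
  have hfin : ∀ X : ℝ, X ≤ C2 * M * (epz θ pb * epz θ pc * (B * K) * Y) →
      X / (κ * q ^ 4) ≤ C2 * M / κ * (θ * (B * K) * Y / q ^ 4) := by
    intro X hX
    have : X ≤ C2 * M * (θ * (B * K) * Y) := hX.trans (by gcongr)
    calc X / (κ * q ^ 4) ≤ C2 * M * (θ * (B * K) * Y) / (κ * q ^ 4) := by gcongr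
      _ = _ := by field_simp
  have low : ∀ {p p' : Fin 3} {l l' : ℕ} {w w' : Sp → ℝ}, Fct c0 t θ K H B R M p l w →
      Fct c0 t θ K H B R M p' l' w' → l = 0 → epz θ p * epz θ p' = epz θ pb * epz θ pc →
      Dom (fun x => w x * w' x * wa x) {x | κ * q ^ 4 ≤ ‖x‖} (C2 * M / κ * (θ * (B * K) * Y / q ^ 4)) := by
    intro p p' l l' w w' hw hw' hl0 hee
    have ep := (epz_bounds S.one_le_θ p).1
    have ep' := (epz_bounds S.one_le_θ p').1
    have h1 := ((Dom.of_l2 hw'.sm.continuous ha.sm.continuous hw'.supp ha.supp (by positivity) hY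
      hw'.l2 hwa).const_mul (epz θ p * B)).scale (g' := fun x => w x * w' x * wa x) (m := κ * q ^ 4)
      (D := {x | κ * q ^ 4 ≤ ‖x‖}) (by positivity) (by
        intro x hx
        rw [abs_mul (epz θ p * B), abs_of_nonneg (a := epz θ p * B) (by positivity), mul_assoc (w x),
          abs_mul (w x), ← mul_assoc]
        refine mul_le_mul_of_nonneg_right ?_ (abs_nonneg _)
        exact (mul_le_mul_of_nonneg_right hx (abs_nonneg _)).trans (hw.sup_norm hl0 x))
    refine h1.mono subset_rfl (hfin _ ?_) fun x => le_rfl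
    rw [abs_of_nonneg (a := epz θ p * B) (by positivity), ← hee]
    calc epz θ p * B * (M * (epz θ p' * K) * Y) = 1 * M * (epz θ p * epz θ p' * (B * K) * Y) := by ring
      _ ≤ _ := by gcongr
  have far : Dom (fun x => wa x * wb x * wc x) {x | κ * q ^ 4 ≤ ‖x‖}
      (C2 * M / κ * (θ * (B * K) * Y / q ^ 4)) := by
    by_cases hb0 : lb = 0
    · exact (low hb hc hb0 rfl).congr fun x => by ring
    by_cases hc0 : lc = 0
    · exact (low hc hb hc0 (mul_comm _ _)).congr fun x => by ring
    have h1 := (hang (f := fun x => ‖x‖ * wb x) (Λ := epz θ pb * B) (G := M * (epz θ pc * K))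
      (continuous_norm.mul hb.sm.continuous) hc.sm ha.sm.continuous hc.supp ha.supp
      (by positivity) (by positivity) hY (fun r hr => by
        simp only [norm_smul_sphere hr]
        exact hb.sph_norm (by omega) r hr) (hc.ang_low (by omega)) hwa).scale
      (g' := fun x => wa x * wb x * wc x) (m := κ * q ^ 4)
      (D := {x | κ * q ^ 4 ≤ ‖x‖}) (by positivity) (by
        intro x hx
        have e : ‖x‖ * wb x * wc x * wa x = ‖x‖ * (wa x * wb x * wc x) := by ring
        rw [e, abs_mul ‖x‖, abs_of_nonneg (norm_nonneg x)]
        exact mul_le_mul_of_nonneg_right hx (abs_nonneg _))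
    refine h1.mono subset_rfl (hfin _ (le_of_eq ?_)) fun x => le_rfl
    ring
  refine ((hI S ha hb hc hl).union far).mono (fun x _ => ?_) ?_ fun x => le_rfl
  · exact le_total ‖x‖ (κ * q ^ 4)
  · have h1 : 0 ≤ B * K * H / q ^ 5 := by positivity
    have h2 : 0 ≤ θ * (B * K) * Y / q ^ 4 := by positivity
    have h3 : 0 ≤ C2 * M / κ := by positivity
    nlinarith [mul_nonneg hC1 h2, mul_nonneg h3 h1]

lemma Dom.mono_on {g g' : Sp → ℝ} {D D' : Set Sp} {X X' : ℝ} (h : Dom g D X) (hD : D' ⊆ D)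
    (hX : X ≤ X') (hg : ∀ x ∈ D', |g' x| ≤ |g x|) : Dom g' D' X' := by
  obtain ⟨E, e1, e2, e3, e4⟩ := h
  exact ⟨E, e1, e2, fun x hx => (hg x hx).trans (e3 x (hD hx)), e4.trans hX⟩

lemma pdNorm_le_sum (v : Fn) (p : Pt) : pdNorm v p ≤ ∑ β : Fin 4, |pd β v p| := by
  refine Real.sqrt_le_iff.2 ⟨Finset.sum_nonneg fun _ _ => abs_nonneg _, ?_⟩
  refine le_trans (le_of_eq ?_) (Finset.sum_sq_le_sq_sum_of_nonneg fun β _ => abs_nonneg (pd β v p))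
  simp

lemma far_product {c0 M : ℝ} (h0 : 0 < c0) (hne : c0 ≠ 1) (hM : 0 ≤ M) :
    ∃ C : ℝ, 0 ≤ C ∧ ∀ {t q θ K H B R : ℝ} {u : SU}, Setup c0 t q θ K H B R u →
      ∀ {pa pb : Fin 3} {la lb : ℕ} {wa wb f : Sp → ℝ}, Fct c0 t θ K H B R M pa la wa →
        Fct c0 t θ K H B R M pb lb wb → Continuous f →
        (∀ r : ℝ, 0 < r → ∫ ω : S2, |Real.sqrt r * f (r • (ω : Sp))| ^ 4 ∂sphMeas ≤ (θ ^ 2 * B) ^ 4) →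
        Dom (fun x => |f x| * |wb x| * |wa x|) {x | kap c0 * q ^ 4 ≤ ‖x‖}
          (C * (θ ^ 5 * (B * K * H) / q ^ 2)) := by
  obtain ⟨C, hC, hang⟩ := exists_angular_trilinear
  set κ := kap c0 with hκd
  have hκ : 0 < κ := kap_pos h0 hne
  have hκ4 : κ ≤ 1 / 4 := kap_le c0
  refine ⟨C * M ^ 2 / κ, by positivity, ?_⟩
  intro t q θ K H B R u S pa pb la lb wa wb f ha hb hf hs
  have hq : 0 < q := by linarith [S.one_le_q]
  have hB := S.B_nonneg
  have hK := S.K_nonneg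
  have hH := S.H_nonneg
  have hθ : 0 < θ := by linarith [S.one_le_θ]
  obtain ⟨e1, e2⟩ := epz_bounds S.one_le_θ pa
  have e0 : 0 ≤ epz θ pa := by linarith
  have hd := (hang (f := fun x => Real.sqrt ‖x‖ * f x) (L := M * (epz θ pa * K)) (Λ := θ ^ 2 * B)
    (G := M * (θ ^ 2 * H)) (continuous_norm.sqrt.mul hf) hb.sm ha.sm.continuous hb.supp ha.supp
    (by positivity) (by positivity) (by positivity)
    (fun r hr => by simp only [norm_smul_sphere hr]; exact hs r hr) hb.ang ha.l2).scale
    (g' := fun x => |f x| * |wb x| * |wa x|) (m := κ * q ^ 2) (D := {x | κ * q ^ 4 ≤ ‖x‖})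
    (by positivity) (by
      intro x hx
      have h3 := sqrt_norm_gain hκ (by linarith) hq hx
      rw [← abs_mul, ← abs_mul, abs_abs, mul_assoc (Real.sqrt ‖x‖ * f x), mul_assoc (Real.sqrt ‖x‖),
        abs_mul (Real.sqrt ‖x‖), abs_of_nonneg (Real.sqrt_nonneg _), ← mul_assoc (f x)]
      exact mul_le_mul_of_nonneg_right h3 (abs_nonneg _))
  refine hd.mono subset_rfl ?_ fun x => le_rfl
  calc C * (θ ^ 2 * B * (M * (θ ^ 2 * H)) * (M * (epz θ pa * K))) / (κ * q ^ 2)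
      ≤ C * (θ ^ 2 * B * (M * (θ ^ 2 * H)) * (M * (θ * K))) / (κ * q ^ 2) := by gcongr
    _ = _ := by field_simp

/-- The cone-weighted field together with its generators, tested against two factors. -/
lemma far_field {c0 M : ℝ} (h0 : 0 < c0) (hne : c0 ≠ 1) (hM : 0 ≤ M) :
    ∃ C : ℝ, 0 ≤ C ∧ ∀ {t q θ K H B R : ℝ} {u : SU}, Setup c0 t q θ K H B R u →
      ∀ {pa pb : Fin 3} {la lb : ℕ} {wa wb : Sp → ℝ}, Fct c0 t θ K H B R M pa la wa →
        Fct c0 t θ K H B R M pb lb wb → ∀ (j : Fin 3) (b : Fin 7 → ℕ), ∑ i, b i ≤ 2 →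
        Dom (fun x => (jb (cspeed c0 j * t - ‖x‖) * pdNorm (Zw (wordOf b) (u.1 j)) (t, x)
          + ZN (Zw (wordOf b) (u.1 j)) (t, x)) * |wb x| * |wa x|) {x | kap c0 * q ^ 4 ≤ ‖x‖}
          (C * (θ ^ 5 * (B * K * H) / q ^ 2)) := by
  obtain ⟨C, hC, hP⟩ := far_product h0 hne hM
  refine ⟨8 * C, by positivity, ?_⟩
  intro t q θ K H B R u S pa pb la lb wa wb ha hb j b hbs
  have hb2 : b ∈ idxSet 7 2 := mem_idxSet.2 hbs
  have hv : Sm (Zmulti b (u.1 j)) := (u.2 j).zmulti b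
  have h1 := hP S ha hb (f := fun x => jb (cspeed c0 j * t - ‖x‖) * pdNorm (Zmulti b (u.1 j)) (t, x))
    ((jb_cont.comp (continuous_const.sub continuous_norm)).mul (pdNorm_cont hv t)) (fun r hr => by
      simp only [norm_smul_sphere hr, ← mul_assoc]
      exact S.sph_cone j b hb2 r hr)
  have h2 := Dom.sum Finset.univ fun k (_ : k ∈ Finset.univ) =>
    hP S ha hb (f := fun x => Zop k (Zmulti b (u.1 j)) (t, x)) ((hv.zop k).slice_cont t)
      (S.sph_field j b hb2 k)
  refine (h1.add h2).mono subset_rfl ?_ fun x => ?_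
  · simp only [Finset.sum_const, Finset.card_univ, Fintype.card_fin, nsmul_eq_mul]
    push_cast
    linarith
  · refine le_of_eq ?_
    congr 1
    rw [← Zmulti_eq, ← Finset.sum_mul, ← Finset.sum_mul, abs_of_nonneg (a := jb _ * pdNorm _ _)
      (mul_nonneg (jb_pos _).le (pdNorm_nonneg _ _))]
    unfold ZN
    ring

lemma trilinear_null {c0 M : ℝ} (h0 : 0 < c0) (hne : c0 ≠ 1) (hM : 0 ≤ M)
    {j k : Fin 3} (hjk : cspeed c0 j = cspeed c0 k) {A : Fin 4 → Fin 4 → ℝ}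
    (hA : nullCond (cspeed c0 j) A) :
    ∃ C : ℝ, 0 ≤ C ∧ ∀ {t q θ K H B R : ℝ} {u : SU}, Setup c0 t q θ K H B R u →
      (∀ (p : Fin 3) (b : Fin 7 → ℕ), ∑ i, b i ≤ 2 → ∀ α : Fin 4,
        Fct c0 t θ K H B R M p (∑ i, b i) (sl (pd α (Zw (wordOf b) (u.1 p))) t)) →
      ∀ {pa : Fin 3} {la : ℕ} {wa : Sp → ℝ}, Fct c0 t θ K H B R M pa la wa →
      ∀ b b' : Fin 7 → ℕ, ∑ i, b i + ∑ i, b' i ≤ 2 →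
        Dom (fun x => wa x * nullQ A (Zw (wordOf b) (u.1 j)) (Zw (wordOf b') (u.1 k)) (t, x)) univ
          (C * (B * K * H / q ^ 5)) := by
  obtain ⟨C1, hC1, hI⟩ := trilinear_interior_any (M := M) h0 hne
  obtain ⟨C2, hC2, hF⟩ := far_field h0 hne hM
  set κ := kap c0 with hκd
  have hκ : 0 < κ := kap_pos h0 hne
  obtain ⟨C3, hC3, hN⟩ := nullQ_decay (cspeed_pos h0 j) hκ hA
  refine ⟨(∑ α : Fin 4, ∑ β : Fin 4, |A α β| * C1) + C3 * (8 * C2), by positivity, ?_⟩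
  intro t q θ K H B R u S hfac pa la wa ha b b' hbb
  have hq : 0 < q := by linarith [S.one_le_q]
  have hb : ∑ i, b i ≤ 2 := by omega
  have hb' : ∑ i, b' i ≤ 2 := by omega
  set v := Zw (wordOf b) (u.1 j) with hv
  set w := Zw (wordOf b') (u.1 k) with hw
  have hint := Dom.sum Finset.univ fun α (_ : α ∈ Finset.univ) => Dom.sum Finset.univ fun β (_ : β ∈ Finset.univ) =>
    (hI S ha (hfac j b hb α) (hfac k b' hb' β) hbb).const_mul (A α β)
  have hint' : Dom (fun x => wa x * nullQ A v w (t, x)) {x | ‖x‖ ≤ κ * q ^ 4}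
      ((∑ α : Fin 4, ∑ β : Fin 4, |A α β| * C1) * (B * K * H / q ^ 5)) := by
    refine hint.mono subset_rfl (le_of_eq ?_) fun x => le_of_eq ?_
    · simp only [Finset.sum_mul, mul_assoc]
    · congr 1
      simp only [nullQ, Finset.mul_sum]
      refine Finset.sum_congr rfl fun α _ => Finset.sum_congr rfl fun β _ => ?_
      simp only [sl]
      ring
  have f1 := Dom.sum Finset.univ fun β (_ : β ∈ Finset.univ) => hF S ha (hfac k b' hb' β) j b hb
  have f2 := Dom.sum Finset.univ fun β (_ : β ∈ Finset.univ) => hF S ha (hfac j b hb β) k b' hb'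
  have hfar : Dom (fun x => wa x * nullQ A v w (t, x)) {x | κ * q ^ 4 ≤ ‖x‖}
      (C3 * (8 * C2) * (B * K * H / q ^ 5)) := by
    refine ((f1.add f2).const_mul (C3 / q ^ 4)).mono_on subset_rfl ?_ fun x hx => ?_
    · rw [abs_of_nonneg (by positivity)]
      have : C3 / q ^ 4 * (∑ _β : Fin 4, C2 * (θ ^ 5 * (B * K * H) / q ^ 2) + ∑ _β : Fin 4, C2 * (θ ^ 5 * (B * K * H) / q ^ 2))
          = C3 * (8 * C2) * (θ ^ 5 * (B * K * H) / q ^ 6) := by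
        simp only [Finset.sum_const, Finset.card_univ, Fintype.card_fin, nsmul_eq_mul]
        push_cast
        field_simp
        ring
      rw [this]
      exact mul_le_mul_of_nonneg_left S.gain (by positivity)
    · have h1 := hN v w t x S.t_nonneg (by rw [S.jb_eq]; exact hx)
      rw [S.jb_eq] at h1
      have pv := pdNorm_le_sum v (t, x)
      have pw := pdNorm_le_sum w (t, x)
      set Jv := jb (cspeed c0 j * t - ‖x‖) * pdNorm v (t, x) + ZN v (t, x) with hJv
      set Jw := jb (cspeed c0 k * t - ‖x‖) * pdNorm w (t, x) + ZN w (t, x) with hJw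
      have jv : 0 ≤ Jv := add_nonneg (mul_nonneg (jb_pos _).le (pdNorm_nonneg _ _)) (ZN_nonneg _ _)
      have jw : 0 ≤ Jw := add_nonneg (mul_nonneg (jb_pos _).le (pdNorm_nonneg _ _)) (ZN_nonneg _ _)
      rw [hjk, ← hJw] at h1
      simp only [sl, ← hv, ← hw]
      rw [← Finset.sum_mul, ← Finset.sum_mul, ← Finset.mul_sum, ← Finset.mul_sum, abs_mul (wa x)]
      set Dv := ∑ β : Fin 4, |pd β v (t, x)|
      set Dw := ∑ β : Fin 4, |pd β w (t, x)|
      refine le_trans ?_ (le_abs_self _)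
      calc |wa x| * |nullQ A v w (t, x)|
          ≤ |wa x| * (C3 / q ^ 4 * (Jv * pdNorm w (t, x) + pdNorm v (t, x) * Jw)) :=
            mul_le_mul_of_nonneg_left h1 (abs_nonneg _)
        _ ≤ |wa x| * (C3 / q ^ 4 * (Jv * Dw + Dv * Jw)) := by gcongr
        _ = _ := by ring
  refine (hint'.union hfar).mono (fun x _ => ?_) (by rw [add_mul]) fun x => le_rfl
  exact le_total ‖x‖ (κ * q ^ 4)

lemma factor_sup {c0 M : ℝ} (h0 : 0 < c0) (hne : c0 ≠ 1) {t q θ K H B R : ℝ} {u : SU}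
    (S : Setup c0 t q θ K H B R u) {p : Fin 3} {l : ℕ} {w : Sp → ℝ}
    (hw : Fct c0 t θ K H B R M p l w) (hl : l ≤ 1) (x : Sp) : |w x| ≤ θ ^ 2 * B / (kap c0 * q ^ 4) := by
  have hκ : 0 < kap c0 := kap_pos h0 hne
  have hq : 0 < q := by linarith [S.one_le_q]
  rw [le_div_iff₀ (by positivity), mul_comm]
  rcases le_total ‖x‖ (kap c0 * q ^ 4) with h | h
  · have h1 := interior_far h0 hne S.t_nonneg (r := ‖x‖) (by rw [S.jb_eq]; exact h) p
    rw [S.jb_eq] at h1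
    exact (mul_le_mul_of_nonneg_right h1 (abs_nonneg _)).trans (hw.sup_cone hl x)
  · refine le_trans ?_ (hw.sup_mixed hl x)
    refine mul_le_mul_of_nonneg_right ?_ (abs_nonneg _)
    have : 1 ≤ Real.sqrt (jb (cspeed c0 p * t - ‖x‖)) := by
      rw [Real.le_sqrt' one_pos, one_pow]; exact one_le_jb _
    nlinarith [norm_nonneg x]

lemma evp_cons (f : Fac) (q : List Fac) (u : SU) : evp (f :: q) u = ev u f * evp q u := by simp [evp]

lemma evp_perm {q q' : List Fac} (h : q.Perm q') : evp q = evp q' := by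
  funext u; exact (h.map (ev u)).prod_eq

lemma abs_evp_le {u : SU} {p : Pt} {X : ℝ} (q : List Fac) (h : ∀ f ∈ q, |ev u f p| ≤ X) :
    |evp q u p| ≤ X ^ q.length := by
  induction q with
  | nil => simp [evp]
  | cons f q ih =>
    have h1 := h f (by simp)
    rw [evp_cons, Pi.mul_apply, abs_mul, List.length_cons, pow_succ, mul_comm]
    have h2 := ih fun g hg => h g (by simp [hg])
    exact mul_le_mul h2 h1 (abs_nonneg _) ((abs_nonneg _).trans h2)

lemma exists_perm_cons_low {q : List Fac} (hq : q ≠ []) (h : (q.map fun f => f.1.length).sum ≤ 2) :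
    ∃ f r, q.Perm (f :: r) ∧ ∀ g ∈ r, g.1.length ≤ 1 := by
  by_cases h2 : ∃ f ∈ q, 2 ≤ f.1.length
  · obtain ⟨f, hf, hf2⟩ := h2
    have hp := List.perm_cons_erase hf
    refine ⟨f, q.erase f, hp, fun g hg => ?_⟩
    have e := (hp.map fun f : Fac => f.1.length).sum_eq
    rw [List.map_cons, List.sum_cons] at e
    have := List.single_le_sum (l := (q.erase f).map fun f : Fac => f.1.length) (by simp) g.1.length
      (List.mem_map.2 ⟨g, hg, rfl⟩)
    omega
  · push Not at h2
    cases q with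
    | nil => exact absurd rfl hq
    | cons f r => exact ⟨f, r, List.Perm.refl _, fun g hg => by have := h2 g (by simp [hg]); omega⟩

/-- The rate at which the source terms of the component `i` may increase the energy. -/
def srcRate (i : Fin 3) (q θ K H B N : ℝ) : ℝ :=
  (B * K * H + B ^ 2 * K ^ 2) / q ^ 5 + if i = 0 then θ * (B * K) * N / q ^ 4 else 0

/-- A source term is admissible for the energy estimate of `Z^a u_i`. -/
def Good (c0 : ℝ) (i : Fin 3) (a : Fin 7 → ℕ) (Φ : SU → Fn) : Prop :=
  ∃ C : ℝ, 0 ≤ C ∧ ∀ {t q θ K H B R : ℝ} {u : SU}, Setup c0 t q θ K H B R u →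
    Dom (fun x => pd 0 (Zw (wordOf a) (u.1 i)) (t, x) * Φ u (t, x)) univ
      (C * srcRate i q θ K H B (Nnorm 3 (cspeed c0 i) (u.1 i) t))

lemma Good.zero (c0 : ℝ) (i : Fin 3) (a : Fin 7 → ℕ) : Good c0 i a 0 :=
  ⟨0, le_rfl, fun _ => by
    rw [zero_mul]
    exact (Dom.zero univ).congr fun x => by simp⟩

lemma Good.add {c0 : ℝ} {i : Fin 3} {a : Fin 7 → ℕ} {Φ Ψ : SU → Fn} (h : Good c0 i a Φ)
    (h' : Good c0 i a Ψ) : Good c0 i a (Φ + Ψ) := by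
  obtain ⟨C, hC, h⟩ := h
  obtain ⟨C', hC', h'⟩ := h'
  refine ⟨C + C', by positivity, fun S => ?_⟩
  rw [add_mul]
  exact ((h S).add (h' S)).congr fun x => by simp only [Pi.add_apply]; ring

lemma Good.smul {c0 : ℝ} {i : Fin 3} {a : Fin 7 → ℕ} {Φ : SU → Fn} (h : Good c0 i a Φ) (s : ℝ) :
    Good c0 i a (s • Φ) := by
  obtain ⟨C, hC, h⟩ := h
  refine ⟨|s| * C, by positivity, fun S => ?_⟩
  rw [mul_assoc]
  exact ((h S).const_mul s).congr fun x => by simp only [Pi.smul_apply, smul_eq_mul]; ring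

lemma Good.sum {c0 : ℝ} {i : Fin 3} {a : Fin 7 → ℕ} {ι : Type*} (s : Finset ι) {Φ : ι → SU → Fn}
    (h : ∀ k ∈ s, Good c0 i a (Φ k)) : Good c0 i a (∑ k ∈ s, Φ k) := by
  classical
  induction s using Finset.induction_on with
  | empty => exact Good.zero c0 i a
  | insert k s hk ih =>
    rw [Finset.sum_insert hk]
    exact (h k (Finset.mem_insert_self k s)).add (ih fun j hj => h j (Finset.mem_insert_of_mem hj))

lemma Good.span {c0 : ℝ} {i : Fin 3} {a : Fin 7 → ℕ} {X : Set (SU → Fn)} (h : ∀ Φ ∈ X, Good c0 i a Φ)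
    {Φ : SU → Fn} (hΦ : Φ ∈ Submodule.span ℝ X) : Good c0 i a Φ :=
  Submodule.span_induction (p := fun Φ _ => Good c0 i a Φ) h (Good.zero c0 i a)
    (fun _ _ _ _ h1 h2 => h1.add h2) (fun s _ _ h1 => h1.smul s) hΦ

lemma Setup.srcRate_bounds {c0 t q θ K H B R : ℝ} {u : SU} (S : Setup c0 t q θ K H B R u) (i : Fin 3)
    {N : ℝ} (hN : 0 ≤ N) : B * K * H / q ^ 5 ≤ srcRate i q θ K H B N ∧
      B ^ 2 * K ^ 2 / q ^ 5 ≤ srcRate i q θ K H B N ∧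
      (i = 0 → B * K * H / q ^ 5 + θ * (B * K) * N / q ^ 4 ≤ srcRate i q θ K H B N) := by
  have hq : 0 < q := by linarith [S.one_le_q]
  have hB := S.B_nonneg
  have hK := S.K_nonneg
  have hH := S.H_nonneg
  have hθ : 0 < θ := by linarith [S.one_le_θ]
  have h1 : 0 ≤ B * K * H / q ^ 5 := by positivity
  have h2 : 0 ≤ B ^ 2 * K ^ 2 / q ^ 5 := by positivity
  have h3 : 0 ≤ θ * (B * K) * N / q ^ 4 := by positivity
  unfold srcRate
  rw [add_div]
  split_ifs with hi
  · exact ⟨by linarith, by linarith, fun _ => by linarith⟩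
  · exact ⟨by linarith, by linarith, fun h => absurd h hi⟩

lemma good_product {c0 : ℝ} (h0 : 0 < c0) (hne : c0 ≠ 1) {i : Fin 3} {a : Fin 7 → ℕ}
    (ha : ∑ k, a k ≤ 2) {l : List Fac} (hl : 3 ≤ l.length) (hsub : ∀ f ∈ l, f.1.Sublist (wordOf a))
    (hlen : (l.map fun f => f.1.length).sum ≤ (wordOf a).length) : Good c0 i a (evp l) := by
  obtain ⟨M, hM1, hfac⟩ := exists_factor h0
  rw [length_wordOf] at hlen
  obtain ⟨f, r, hp, hr⟩ := exists_perm_cons_low (q := l) (by rintro rfl; simp at hl) (hlen.trans ha)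
  have hκ : 0 < kap c0 := kap_pos h0 hne
  have hκ4 : kap c0 ≤ 1 / 4 := kap_le c0
  have hrl : 2 ≤ r.length := by have := hp.length_eq; simp at this; omega
  refine ⟨M ^ 2 * (1 / kap c0) ^ r.length, by positivity, ?_⟩
  intro t q θ K H B R u S
  have hq1 := S.one_le_q
  have hq : 0 < q := by linarith
  have hB := S.B_nonneg
  have hB1 := S.B_le
  have hK := S.K_nonneg
  have hH := S.H_nonneg
  have hθ1 := S.one_le_θ
  have hθ : 0 < θ := by linarith
  have hF : ∀ f ∈ l, ∃ n, f.1.length = n ∧ Fct c0 t θ K H B R M f.2.1 n (sl (ev u f) t) := by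
    intro f hf
    obtain ⟨b, hb, hbl⟩ := exists_wordOf_of_sublist (hsub f hf)
    refine ⟨_, hbl.symm, ?_⟩
    have h2 : f.1.length ≤ 2 := by
      have := (hsub f hf).length_le; rw [length_wordOf] at this; omega
    have := hfac S f.2.1 b (by omega) f.2.2
    rw [← hb] at this
    exact this
  obtain ⟨nf, -, hff⟩ := hF f (hp.symm.subset (by simp))
  have hwa := hfac S i a ha 0
  have ei := epz_bounds hθ1 i
  have ef := epz_bounds hθ1 f.2.1
  have hpi : 0 ≤ epz θ i := by linarith
  have hpf : 0 ≤ epz θ f.2.1 := by linarith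
  set X := θ ^ 2 * B / (kap c0 * q ^ 4) with hX
  have hd := (Dom.of_l2 hwa.sm.continuous hff.sm.continuous hwa.supp hff.supp (by positivity)
    (by positivity) hwa.l2 hff.l2).const_mul (X ^ r.length)
  refine hd.mono subset_rfl ?_ fun x => ?_
  · have hX0 : 0 ≤ X := by positivity
    rw [abs_of_nonneg (by positivity)]
    refine le_trans ?_ (mul_le_mul_of_nonneg_left (S.srcRate_bounds i (Nnorm_nonneg 3 _ _ t)).2.1
      (by positivity))
    have hz1 : θ ^ 2 * B / q ^ 4 ≤ 1 := by
      rw [div_le_one (by positivity)]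
      calc θ ^ 2 * B ≤ θ ^ 6 * 1 := mul_le_mul (pow_le_pow_right₀ hθ1 (by norm_num)) hB1 hB (by positivity)
        _ ≤ q := by rw [mul_one]; exact S.θ_le
        _ ≤ q ^ 4 := le_self_pow₀ hq1 (by norm_num)
    have hXz : X = θ ^ 2 * B / q ^ 4 * (1 / kap c0) := by rw [hX]; field_simp
    have hXr : X ^ r.length ≤ (θ ^ 2 * B / q ^ 4) ^ 2 * (1 / kap c0) ^ r.length := by
      rw [hXz, mul_pow]
      exact mul_le_mul_of_nonneg_right (pow_le_pow_of_le_one (by positivity) hz1 hrl) (by positivity)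
    have hq8 : (θ ^ 2 * B / q ^ 4) ^ 2 * (θ * K) ^ 2 ≤ B ^ 2 * K ^ 2 / q ^ 5 := by
      rw [div_pow, div_mul_eq_mul_div, div_le_div_iff₀ (by positivity) (by positivity)]
      calc (θ ^ 2 * B) ^ 2 * (θ * K) ^ 2 * q ^ 5 = θ ^ 6 * (B ^ 2 * K ^ 2 * q ^ 5) := by ring
        _ ≤ q * (B ^ 2 * K ^ 2 * q ^ 5) := mul_le_mul_of_nonneg_right S.θ_le (by positivity)
        _ = B ^ 2 * K ^ 2 * q ^ 6 := by ring
        _ ≤ B ^ 2 * K ^ 2 * q ^ 8 := mul_le_mul_of_nonneg_left (pow_le_pow_right₀ hq1 (by norm_num)) (by positivity)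
        _ = _ := by ring
    calc X ^ r.length * (M * (epz θ i * K) * (M * (epz θ f.2.1 * K)))
        ≤ ((θ ^ 2 * B / q ^ 4) ^ 2 * (1 / kap c0) ^ r.length) * (M * (θ * K) * (M * (θ * K))) := by
          gcongr
          · exact ei.2
          · exact ef.2
      _ = M ^ 2 * (1 / kap c0) ^ r.length * ((θ ^ 2 * B / q ^ 4) ^ 2 * (θ * K) ^ 2) := by ring
      _ ≤ _ := mul_le_mul_of_nonneg_left hq8 (by positivity)
  · have h1 : |evp r u (t, x)| ≤ X ^ r.length := abs_evp_le r fun g hg => by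
      obtain ⟨n, hn, hg'⟩ := hF g (hp.symm.subset (by simp [hg]))
      exact factor_sup h0 hne S hg' (by rw [← hn]; exact hr g hg) x
    have hX0 : 0 ≤ X := by positivity
    rw [evp_perm hp, evp_cons, Pi.mul_apply, abs_mul (X ^ r.length), abs_of_nonneg (a := X ^ r.length) (by positivity),
      ← mul_assoc, abs_mul, mul_comm]
    exact mul_le_mul_of_nonneg_right h1 (abs_nonneg _)

lemma good_null {c0 : ℝ} (h0 : 0 < c0) (hne : c0 ≠ 1) {i j k : Fin 3} {a : Fin 7 → ℕ}
    (ha : ∑ k, a k ≤ 2) (hjk : cspeed c0 j = cspeed c0 k) {A : Fin 4 → Fin 4 → ℝ}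
    (hA : nullCond (cspeed c0 j) A) :
    Good c0 i a (fun u => Ztw (wordOf a) (nullQ A (u.1 j) (u.1 k))) := by
  obtain ⟨M, hM1, hfac⟩ := exists_factor h0
  have hmem := QSpan_Ztw (A := {H | nullCond (cspeed c0 j) H})
    (fun i H hH => act_nullCond (cspeed_pos h0 j).ne' i H hH) (j := j) (k := k) hA (wordOf a)
  refine Good.span ?_ hmem
  rintro _ ⟨A', hA', l₁, l₂, h1, h2, hl, rfl⟩
  obtain ⟨b, rfl, hb⟩ := exists_wordOf_of_sublist h1
  obtain ⟨b', rfl, hb'⟩ := exists_wordOf_of_sublist h2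
  rw [length_wordOf] at hl hb hb'
  rw [length_wordOf, length_wordOf] at hl
  obtain ⟨C, hC, h⟩ := trilinear_null (M := M) h0 hne (by linarith) hjk hA'
  refine ⟨C, hC, fun S => ?_⟩
  exact (h S (hfac S) (hfac S i a ha 0) b b' (by omega)).mono subset_rfl
    (mul_le_mul_of_nonneg_left (S.srcRate_bounds i (Nnorm_nonneg 3 _ _ _)).1 hC) fun x => le_rfl

lemma good_bilinear_aux {c0 : ℝ} {i j k : Fin 3} {a : Fin 7 → ℕ} (ha : ∑ k, a k ≤ 2)
    (A : Fin 4 → Fin 4 → ℝ)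
    (h : ∀ b b' : Fin 7 → ℕ, ∑ k, b k + ∑ k, b' k ≤ 2 → ∀ α β, Good c0 i a fun u =>
      pd α (Zw (wordOf b) (u.1 j)) * pd β (Zw (wordOf b') (u.1 k))) :
    Good c0 i a (fun u => Ztw (wordOf a) (nullQ A (u.1 j) (u.1 k))) := by
  refine Good.span ?_ (QSpan_Ztw (A := univ) (fun _ _ _ => mem_univ _) (j := j) (k := k) (mem_univ A) (wordOf a))
  rintro _ ⟨A', -, l₁, l₂, h1, h2, hl, rfl⟩
  obtain ⟨b, rfl, hb⟩ := exists_wordOf_of_sublist h1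
  obtain ⟨b', rfl, hb'⟩ := exists_wordOf_of_sublist h2
  rw [length_wordOf, length_wordOf, length_wordOf] at hl
  have := Good.sum Finset.univ fun α (_ : α ∈ Finset.univ) => Good.sum Finset.univ
    fun β (_ : β ∈ Finset.univ) => (h b b' (by omega) α β).smul (A' α β)
  convert this using 1
  funext u p
  simp [nullQ, mul_assoc]

lemma good_nonresonant {c0 : ℝ} (h0 : 0 < c0) (hne : c0 ≠ 1) {i j k : Fin 3} {a : Fin 7 → ℕ}
    (ha : ∑ k, a k ≤ 2) (hs : ¬ (cspeed c0 i = cspeed c0 j ∧ cspeed c0 i = cspeed c0 k))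
    (A : Fin 4 → Fin 4 → ℝ) :
    Good c0 i a (fun u => Ztw (wordOf a) (nullQ A (u.1 j) (u.1 k))) := by
  obtain ⟨M, hM1, hfac⟩ := exists_factor h0
  obtain ⟨C, hC, h⟩ := trilinear_nonresonant (M := M) h0 hne (by linarith)
  refine good_bilinear_aux ha A fun b b' hbb α β => ⟨C, hC, fun S => ?_⟩
  refine (h S (hfac S i a ha 0) (hfac S j b (by omega) α) (hfac S k b' (by omega) β) hbb hs).mono
    subset_rfl (mul_le_mul_of_nonneg_left (S.srcRate_bounds i (Nnorm_nonneg 3 _ _ _)).1 hC)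
    fun x => le_of_eq ?_
  simp only [sl, Pi.mul_apply, mul_assoc]

lemma integral_pt_sq_le {u : SU} {O : Set ℝ} {R t : ℝ} {i : Fin 3} (hO : IsOpen O) (ht : t ∈ O)
    (hv : VanOut O R (u.1 i)) (c : ℝ) {a : Fin 7 → ℕ} (ha : ∑ k, a k ≤ 2) :
    ∫ x, (sl (pd 0 (Zw (wordOf a) (u.1 i))) t x) ^ 2 ≤ (2 * Nnorm 3 c (u.1 i) t) ^ 2 := by
  have hsm : Sm (Zmulti a (u.1 i)) := (u.2 i).zmulti a
  have h1 : ∫ x, (sl (pd 0 (Zw (wordOf a) (u.1 i))) t x) ^ 2 ≤ ∫ x, 2 * en c (Zmulti a (u.1 i)) (t, x) := by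
    have hv' := hv.zmulti hO a
    refine integral_mono ?_ ?_ fun x => ?_
    · refine SuppIn.integrable (R := R) (fun x hx => ?_) ?_
      · have := hv'.pd hO 0 t ht x hx
        rw [Zmulti_eq] at this
        simp [sl, this]
      · exact ((((u.2 i).zw _).pd 0).slice_cont t).pow 2
    · refine Integrable.const_mul (SuppIn.integrable (R := R) (fun x hx => ?_) ((hsm.en c).slice_cont t)) 2
      exact hv'.en hO c t ht x hx
    · simp only [en, sl, Zmulti_eq, pd_zero]
      have : 0 ≤ c ^ 2 * ∑ j : Fin 3, (px j (Zw (wordOf a) (u.1 i)) (t, x)) ^ 2 :=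
        mul_nonneg (sq_nonneg _) (Finset.sum_nonneg fun _ _ => sq_nonneg _)
      linarith
  refine h1.trans ?_
  rw [integral_const_mul, ← energy_eq, mul_pow, Nnorm_sq]
  have h2 : energy c (Zmulti a (u.1 i)) t ≤ ∑ a ∈ idxSet 7 (3 - 1), energy c (Zmulti a (u.1 i)) t :=
    Finset.single_le_sum (f := fun a => energy c (Zmulti a (u.1 i)) t)
      (fun _ _ => energy_nonneg _ _ _) (mem_idxSet.2 ha)
  have := energy_nonneg c (Zmulti a (u.1 i)) t
  linarith

lemma good_resonant {c0 : ℝ} (h0 : 0 < c0) (hne : c0 ≠ 1) {j k : Fin 3} {a : Fin 7 → ℕ}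
    (ha : ∑ k, a k ≤ 2) (hjk : j ≠ 0 ∨ k ≠ 0) (A : Fin 4 → Fin 4 → ℝ) :
    Good c0 0 a (fun u => Ztw (wordOf a) (nullQ A (u.1 j) (u.1 k))) := by
  obtain ⟨M, hM1, hfac⟩ := exists_factor h0
  obtain ⟨C, hC, h⟩ := trilinear_resonant (M := M) h0 hne (by linarith)
  refine good_bilinear_aux ha A fun b b' hbb α β => ⟨2 * C, by positivity, fun {t q θ K H B R u} S => ?_⟩
  have hq : 0 < q := by linarith [S.one_le_q]
  have hB := S.B_nonneg
  have hK := S.K_nonneg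
  have hH := S.H_nonneg
  have hθ1 := S.one_le_θ
  have hN := Nnorm_nonneg 3 (cspeed c0 0) (u.1 0) t
  obtain ⟨O, hO, htO, hv⟩ := S.van
  have hε : epz θ j * epz θ k ≤ θ := by
    have hnz : ∀ p : Fin 3, p ≠ 0 → epz θ p = 1 := fun p hp => by fin_cases p <;> simp_all [epz]
    rcases hjk with hj | hk
    · rw [hnz j hj, one_mul]; exact (epz_bounds hθ1 k).2
    · rw [hnz k hk, mul_one]; exact (epz_bounds hθ1 j).2
  refine (h S (hfac S 0 a ha 0) (hfac S j b (by omega) α) (hfac S k b' (by omega) β) hbb hε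
    (by positivity) (integral_pt_sq_le hO htO (hv 0) (cspeed c0 0) ha)).mono subset_rfl ?_ fun x => le_of_eq ?_
  · rw [mul_comm 2 C, mul_assoc C 2]
    refine mul_le_mul_of_nonneg_left ?_ hC
    refine le_trans ?_ (mul_le_mul_of_nonneg_left ((S.srcRate_bounds 0 hN).2.2 rfl) (by norm_num))
    have : 0 ≤ B * K * H / q ^ 5 := by positivity
    have e : θ * (B * K) * (2 * Nnorm 3 (cspeed c0 0) (u.1 0) t) / q ^ 4
      = 2 * (θ * (B * K) * Nnorm 3 (cspeed c0 0) (u.1 0) t / q ^ 4) := by ring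
    rw [e]
    linarith
  · simp only [sl, Pi.mul_apply, mul_assoc]

lemma Ztw_smul {v : Fn} (hv : Sm v) (s : ℝ) (l : List (Fin 7)) : Ztw l (s • v) = s • Ztw l v := by
  induction l with
  | nil => rfl
  | cons i l ih =>
    rw [Ztw_cons, Ztw_cons, ih, Zt, Zt, Zop_smul (hv.ztw l)]
    module

lemma good_cubic {c0 : ℝ} (h0 : 0 < c0) (hne : c0 ≠ 1) {i : Fin 3} {a : Fin 7 → ℕ}
    (ha : ∑ k, a k ≤ 2) {P : MvPolynomial (Fin 3 × Fin 4) ℝ} (hP : CubicLike P) :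
    Good c0 i a (fun u => Ztw (wordOf a) (cubicEval P u.1)) := by
  have hmono : ∀ m : (Fin 3 × Fin 4) →₀ ℕ, 3 ≤ (m.sum fun _ e => e) → Good c0 i a (fun u => Ztw (wordOf a)
      (evp (m.toMultiset.toList.map fun f => (([] : List (Fin 7)), f)) u)) := by
    intro m hm
    have hmem := PSpan_Ztw (js := (m.toMultiset.toList.map fun f => (([] : List (Fin 7)), f)).map fun f => f.2.1)
      (Submodule.subset_span ⟨m.toMultiset.toList.map fun f => (([] : List (Fin 7)), f), rfl,
        by rintro f hf; obtain ⟨g, -, rfl⟩ := List.mem_map.1 hf; simp, by simp, rfl⟩) (wordOf a)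
    refine Good.span ?_ hmem
    rintro _ ⟨l, hjs, hsub, hlen, rfl⟩
    refine good_product h0 hne ha ?_ hsub hlen
    have h1 := congrArg List.length hjs
    simp only [List.length_map, Multiset.length_toList, Finsupp.card_toMultiset] at h1
    have h2 : (m.sum fun _ => id) = m.sum fun _ e => e := rfl
    omega
  have hsum := Good.sum P.support fun m hm => (hmono m (hP m hm)).smul (P.coeff m)
  convert hsum using 1
  funext u
  have he : cubicEval P u.1 = ∑ m ∈ P.support, P.coeff m •
      evp (m.toMultiset.toList.map fun f => (([] : List (Fin 7)), f)) u := by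
    funext p
    simp only [cubicEval, MvPolynomial.eval_eq, Finset.sum_apply, Pi.smul_apply, smul_eq_mul]
    refine Finset.sum_congr rfl fun m _ => ?_
    congr 1
    have h1 : (evp (m.toMultiset.toList.map fun f => (([] : List (Fin 7)), f)) u) p
        = (m.toMultiset.toList.map fun f => pd f.2 (u.1 f.1) p).prod := by
      generalize m.toMultiset.toList = l
      induction l with
      | nil => simp [evp]
      | cons f l ih =>
        rw [List.map_cons, evp_cons, Pi.mul_apply, ih]
        simp [ev, Zw_nil]
    rw [h1, ← Multiset.prod_coe, ← Multiset.map_coe, Multiset.coe_toList,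
      Finsupp.toMultiset_map, Finsupp.prod_toMultiset,
      Finsupp.prod_mapDomain_index (fun _ => pow_zero _) fun _ _ _ => pow_add _ _ _]
    rfl
  rw [he, Ztw_sum _ fun m => (evp_sm _ u).smul' _]
  simp only [Finset.sum_apply, Pi.smul_apply, Ztw_smul (evp_sm _ u)]

lemma good_quadratic {c0 : ℝ} (h0 : 0 < c0) (hne : c0 ≠ 1) {F : Coef} (hTri : LowerTri F)
    (hC1 : CondC1 F) (hC2 : CondC2 F) (hC3 : CondC3 c0 F) (i j k : Fin 3) {a : Fin 7 → ℕ}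
    (ha : ∑ k, a k ≤ 2) :
    Good c0 i a (fun u => Ztw (wordOf a) (nullQ (F i j k) (u.1 j) (u.1 k))) := by
  have s0 : cspeed c0 0 = 1 := rfl
  have s1 : cspeed c0 1 = 1 := rfl
  have s2 : cspeed c0 2 = c0 := rfl
  by_cases hs : cspeed c0 i = cspeed c0 j ∧ cspeed c0 i = cspeed c0 k
  swap
  · exact good_nonresonant h0 hne ha hs _
  have hjk : cspeed c0 j = cspeed c0 k := hs.1.symm.trans hs.2
  by_cases hi : i = 0 ∧ (j ≠ 0 ∨ k ≠ 0)
  · obtain ⟨rfl, h⟩ := hi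
    exact good_resonant h0 hne ha h _
  refine good_null h0 hne ha hjk ?_
  have hn := hne.symm
  have hz : nullCond 1 (F 1 1 0) := fun X _ => by
    simp [hTri 1 1 0 (by decide)]
  obtain ⟨h1, h2, h3⟩ := hC2
  fin_cases i <;> fin_cases j <;> fin_cases k <;> simp [s0, s1, s2, hne, hn] at hs hi ⊢ <;> assumption

lemma rhs_eq (F : Coef) (Cub : Fin 3 → MvPolynomial (Fin 3 × Fin 4) ℝ) (u : Fin 3 → Fn) (i : Fin 3) :
    rhs F Cub u i = (∑ j : Fin 3, ∑ k : Fin 3, nullQ (F i j k) (u j) (u k)) + cubicEval (Cub i) u := by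
  funext p
  simp [rhs, nullQ]

lemma cubicEval_sm {u : Fin 3 → Fn} (hu : ∀ i, Sm (u i)) (P : MvPolynomial (Fin 3 × Fin 4) ℝ) :
    Sm (cubicEval P u) := by
  have : cubicEval P u = fun p => ∑ m ∈ P.support, P.coeff m * ∏ q ∈ m.support, pd q.2 (u q.1) p ^ m q := by
    funext p
    simp only [cubicEval, MvPolynomial.eval_eq]
  rw [this]
  exact ContDiff.sum fun m _ => contDiff_const.mul (contDiff_prod fun q _ => ((hu q.1).pd q.2).pow _)

lemma good_rhs {c0 : ℝ} (h0 : 0 < c0) (hne : c0 ≠ 1) {F : Coef}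
    {Cub : Fin 3 → MvPolynomial (Fin 3 × Fin 4) ℝ} (hTri : LowerTri F) (hCub : ∀ i, CubicLike (Cub i))
    (hC1 : CondC1 F) (hC2 : CondC2 F) (hC3 : CondC3 c0 F) (i : Fin 3) {a : Fin 7 → ℕ}
    (ha : ∑ k, a k ≤ 2) : Good c0 i a (fun u => Ztw (wordOf a) (rhs F Cub u.1 i)) := by
  have h := (Good.sum Finset.univ fun j (_ : j ∈ Finset.univ) => Good.sum Finset.univ
    fun k (_ : k ∈ Finset.univ) => good_quadratic h0 hne hTri hC1 hC2 hC3 i j k ha).add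
    (good_cubic h0 hne (i := i) ha (hCub i))
  convert h using 1
  funext u
  have hq : ∀ j k, Sm (nullQ (F i j k) (u.1 j) (u.1 k)) := fun j k => Sm.nullQ (u.2 j) (u.2 k) _
  rw [rhs_eq, Ztw_add (Sm.sum' _ fun j => Sm.sum' _ fun k => hq j k) (cubicEval_sm u.2 _),
    Ztw_sum _ fun j => Sm.sum' _ fun k => hq j k]
  simp only [Ztw_sum _ fun k => hq _ k, Pi.add_apply, Finset.sum_apply]

/-- The energy of a local solution grows at most at the admissible rate. -/
lemma exists_energy_rate {c0 : ℝ} (h0 : 0 < c0) (hne : c0 ≠ 1) {F : Coef}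
    {Cub : Fin 3 → MvPolynomial (Fin 3 × Fin 4) ℝ} (hTri : LowerTri F) (hCub : ∀ i, CubicLike (Cub i))
    (hC1 : CondC1 F) (hC2 : CondC2 F) (hC3 : CondC3 c0 F) :
    ∃ C : ℝ, 0 ≤ C ∧ ∀ {t q θ K H B R T : ℝ} {u : SU}, Setup c0 t q θ K H B R u → t ∈ Ioo 0 T →
      LocalSolution c0 F Cub T u.1 → ∀ i : Fin 3, ∃ y' : ℝ,
        HasDerivAt (fun s => Nnorm 3 (cspeed c0 i) (u.1 i) s ^ 2) y' t ∧
        y' ≤ C * srcRate i q θ K H B (Nnorm 3 (cspeed c0 i) (u.1 i) t) := by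
  have hex : ∀ (i : Fin 3) (a : Fin 7 → ℕ), ∃ C : ℝ, 0 ≤ C ∧ (a ∈ idxSet 7 2 →
      ∀ {t q θ K H B R : ℝ} {u : SU}, Setup c0 t q θ K H B R u →
        Dom (fun x => pd 0 (Zw (wordOf a) (u.1 i)) (t, x) * Ztw (wordOf a) (rhs F Cub u.1 i) (t, x)) univ
          (C * srcRate i q θ K H B (Nnorm 3 (cspeed c0 i) (u.1 i) t))) := by
    intro i a
    by_cases ha : a ∈ idxSet 7 2
    · obtain ⟨C, hC, h⟩ := good_rhs h0 hne hTri hCub hC1 hC2 hC3 i (mem_idxSet.1 ha)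
      exact ⟨C, hC, fun _ => h⟩
    · exact ⟨0, le_rfl, fun h => absurd h ha⟩
  choose C hC hCb using hex
  refine ⟨∑ i, ∑ a ∈ idxSet 7 2, C i a, Finset.sum_nonneg fun i _ => Finset.sum_nonneg fun a _ => hC i a, ?_⟩
  intro t q θ K H B R T u S ht hsol i
  obtain ⟨O, hO, htO, hv⟩ := S.van
  set r := srcRate i q θ K H B (Nnorm 3 (cspeed c0 i) (u.1 i) t) with hr
  have hr0 : 0 ≤ r := by
    have hq : 0 < q := by linarith [S.one_le_q]
    have hB := S.B_nonneg
    have hK := S.K_nonneg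
    have hH := S.H_nonneg
    exact le_trans (by positivity) (S.srcRate_bounds i (Nnorm_nonneg 3 _ _ t)).1
  have hsolO : ∀ a, ∀ x, boxOp (cspeed c0 i) (Zmulti a (u.1 i)) (t, x)
      = Ztw (wordOf a) (rhs F Cub u.1 i) (t, x) := by
    intro a x
    rw [Zmulti_eq, boxOp_Zw (u.2 i)]
    have hopen : IsOpen {p : Pt | p.1 ∈ Ioo 0 T} := isOpen_Ioo.preimage continuous_fst
    exact Ztw_congr_on hopen (fun p hp => hsol.2.2 i p.1 hp p.2) (wordOf a) (t, x) ht
  refine ⟨∑ a ∈ idxSet 7 2, ∫ x, pt (Zmulti a (u.1 i)) (t, x) * boxOp (cspeed c0 i) (Zmulti a (u.1 i)) (t, x), ?_, ?_⟩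
  · simp only [Nnorm_sq]
    refine HasDerivAt.fun_sum fun a _ => ?_
    exact hasDerivAt_energy ((u.2 i).zmulti a) (cspeed c0 i) hO ((hv i).zmulti hO a) htO
  · have h1 : ∀ a ∈ idxSet 7 2, ∫ x, pt (Zmulti a (u.1 i)) (t, x) * boxOp (cspeed c0 i) (Zmulti a (u.1 i)) (t, x)
        ≤ C i a * r := by
      intro a ha
      refine le_trans (le_trans (le_abs_self _) (abs_integral_le_integral_abs)) ?_
      have := (hCb i a ha S).integral_le
      simp only [hsolO]
      rw [Zmulti_eq]
      exact this
    refine (Finset.sum_le_sum h1).trans ?_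
    rw [← Finset.sum_mul]
    refine mul_le_mul_of_nonneg_right ?_ hr0
    exact Finset.single_le_sum (f := fun i => ∑ a ∈ idxSet 7 2, C i a)
      (fun i _ => Finset.sum_nonneg fun a _ => hC i a) (Finset.mem_univ i)

lemma le_of_hasDerivAt_nonpos {f : ℝ → ℝ} {t : ℝ} (ht : 0 ≤ t) (hc : ContinuousOn f (Icc 0 t))
    (hd : ∀ s ∈ Ioo 0 t, ∃ f', HasDerivAt f f' s ∧ f' ≤ 0) : f t ≤ f 0 := by
  have h := antitoneOn_of_deriv_nonpos (convex_Icc 0 t) hc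
    (fun s hs => by
      rw [interior_Icc] at hs
      obtain ⟨f', h1, -⟩ := hd s hs
      exact h1.differentiableAt.differentiableWithinAt)
    (fun s hs => by
      rw [interior_Icc] at hs
      obtain ⟨f', h1, h2⟩ := hd s hs
      rw [h1.deriv]; exact h2)
  exact h (left_mem_Icc.2 ht) (right_mem_Icc.2 ht) ht

lemma hasDerivAt_one_add_rpow (p : ℝ) {s : ℝ} (hs : 0 < s) :
    HasDerivAt (fun s : ℝ => (1 + s) ^ p) (p * (1 + s) ^ (p - 1)) s := by
  have h := ((hasDerivAt_id s).const_add 1).rpow_const (p := p) (Or.inl (by simp; linarith))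
  simpa using h

lemma continuousOn_one_add_rpow (p t : ℝ) : ContinuousOn (fun s : ℝ => (1 + s) ^ p) (Icc 0 t) :=
  ContinuousOn.rpow_const (by fun_prop) fun s hs => Or.inl (by have := hs.1; positivity)

lemma le_of_deriv_le_integrable {y : ℝ → ℝ} {t A : ℝ} (ht : 0 ≤ t) (hA : 0 ≤ A)
    (hc : ContinuousOn y (Icc 0 t))
    (hd : ∀ s ∈ Ioo 0 t, ∃ y', HasDerivAt y y' s ∧ y' ≤ A * (1 + s) ^ (-(5 / 4) : ℝ)) :
    y t ≤ y 0 + 4 * A := by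
  have h := le_of_hasDerivAt_nonpos (f := fun s => y s + 4 * A * (1 + s) ^ (-(1 / 4) : ℝ)) ht
    (hc.add (continuousOn_const.mul (continuousOn_one_add_rpow _ _))) (fun s hs => by
      obtain ⟨y', h1, h2⟩ := hd s hs
      refine ⟨_, h1.add ((hasDerivAt_one_add_rpow _ hs.1).const_mul (4 * A)), ?_⟩
      have e : (-(1 / 4) - 1 : ℝ) = -(5 / 4) := by norm_num
      rw [e]
      linarith)
  have h1 : 0 ≤ 4 * A * (1 + t) ^ (-(1 / 4) : ℝ) := by positivity
  simp only [add_zero, Real.one_rpow] at h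
  linarith

lemma le_of_deriv_le_growth {y : ℝ → ℝ} {t δ D : ℝ} (ht : 0 ≤ t) (hδ : 0 < δ) (hD : 0 ≤ D)
    (hy : ∀ s, 0 ≤ y s) (hc : ContinuousOn y (Icc 0 t))
    (hd : ∀ s ∈ Ioo 0 t, ∃ y', HasDerivAt y y' s ∧
      y' ≤ δ * y s / (1 + s) + D * (1 + s) ^ (2 * δ - 1)) :
    (1 + t) ^ (-(2 * δ)) * y t ≤ y 0 + D / δ := by
  have h := le_of_hasDerivAt_nonpos
    (f := fun s => (1 + s) ^ (-δ) * y s - D / δ * (1 + s) ^ δ) ht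
    (((continuousOn_one_add_rpow _ _).mul hc).sub (continuousOn_const.mul (continuousOn_one_add_rpow _ _)))
    (fun s hs => by
      obtain ⟨y', h1, h2⟩ := hd s hs
      refine ⟨_, ((hasDerivAt_one_add_rpow (-δ) hs.1).mul h1).sub
        ((hasDerivAt_one_add_rpow δ hs.1).const_mul (D / δ)), ?_⟩
      have hs0 : 0 < 1 + s := by have := hs.1; linarith
      have e1 : (1 + s) ^ (-δ - 1) = (1 + s) ^ (-δ) / (1 + s) := by
        rw [Real.rpow_sub hs0, Real.rpow_one]
      have e2 : (1 + s) ^ (-δ) * (1 + s) ^ (2 * δ - 1) = (1 + s) ^ (δ - 1) := by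
        rw [← Real.rpow_add hs0]; congr 1; ring
      have h3 := mul_le_mul_of_nonneg_left h2 (Real.rpow_nonneg hs0.le (-δ))
      have e3 : D / δ * (δ * (1 + s) ^ (δ - 1)) = D * (1 + s) ^ (δ - 1) := by field_simp
      rw [e3, ← e2, e1]
      have e4 : -δ * ((1 + s) ^ (-δ) / (1 + s)) * y s + (1 + s) ^ (-δ) * (δ * y s / (1 + s)
        + D * (1 + s) ^ (2 * δ - 1)) = D * ((1 + s) ^ (-δ) * (1 + s) ^ (2 * δ - 1)) := by ring
      linarith)
  have ht0 : 0 < 1 + t := by linarith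
  simp only [add_zero, Real.one_rpow, one_mul, mul_one] at h
  have hDδ : 0 ≤ D / δ := by positivity
  have h4 := mul_le_mul_of_nonneg_left (sub_le_iff_le_add.1 h) (Real.rpow_nonneg ht0.le (-δ))
  have e5 : (1 + t) ^ (-δ) * ((1 + t) ^ (-δ) * y t) = (1 + t) ^ (-(2 * δ)) * y t := by
    rw [← mul_assoc, ← Real.rpow_add ht0]; congr 2; ring
  have e6 : (1 + t) ^ (-δ) * (1 + t) ^ δ = 1 := by
    rw [← Real.rpow_add ht0]; simp
  have h5 : (1 + t) ^ (-δ) ≤ 1 := Real.rpow_le_one_of_one_le_of_nonpos (by linarith) (by linarith)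
  rw [e5] at h4
  have h6 : (1 + t) ^ (-δ) * (y 0 - D / δ) ≤ y 0 := by
    have := Real.rpow_nonneg ht0.le (-δ)
    nlinarith [mul_nonneg this hDδ, hy 0]
  have e7 : (1 + t) ^ (-δ) * (y 0 - D / δ + D / δ * (1 + t) ^ δ)
      = (1 + t) ^ (-δ) * (y 0 - D / δ) + D / δ * ((1 + t) ^ (-δ) * (1 + t) ^ δ) := by ring
  rw [e7, e6] at h4
  linarith

lemma one_add_le_two_jb {t : ℝ} (ht : 0 ≤ t) : 1 + t ≤ 2 * jb t := by
  linarith [one_le_jb t, (le_abs_self t).trans (abs_le_jb t)]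

lemma jb_le_one_add {t : ℝ} (ht : 0 ≤ t) : jb t ≤ 1 + t := by
  have := jb_le t; rwa [abs_of_nonneg ht] at this

lemma jb_rpow_neg_le {t p : ℝ} (ht : 0 ≤ t) (hp : 0 ≤ p) : jb t ^ (-p) ≤ 2 ^ p * (1 + t) ^ (-p) := by
  have h1 : (0:ℝ) < 1 + t := by linarith
  have h2 : (2 * jb t) ^ (-p) ≤ (1 + t) ^ (-p) :=
    Real.rpow_le_rpow_of_nonpos h1 (one_add_le_two_jb ht) (by linarith)
  rw [Real.mul_rpow (by norm_num) (jb_pos t).le] at h2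
  calc jb t ^ (-p) = 2 ^ p * (2 ^ (-p) * jb t ^ (-p)) := by
        rw [← mul_assoc, ← Real.rpow_add (by norm_num)]; simp
    _ ≤ _ := mul_le_mul_of_nonneg_left h2 (by positivity)

lemma fourth_root_pow {t : ℝ} (n : ℕ) : (jb t ^ (1 / 4 : ℝ)) ^ n = jb t ^ ((n : ℝ) / 4) := by
  rw [← Real.rpow_natCast, ← Real.rpow_mul (jb_pos t).le]; congr 1; ring

/-- The energy inequality without the resonant term. -/
lemma bounded_growth {y : ℝ → ℝ} {t C A : ℝ} (ht : 0 ≤ t) (hC : 0 ≤ C) (hA : 0 ≤ A)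
    (hc : ContinuousOn y (Icc 0 t))
    (hd : ∀ s ∈ Ioo 0 t, ∃ y', HasDerivAt y y' s ∧ y' ≤ C * (A / (jb s ^ (1 / 4 : ℝ)) ^ 5)) :
    y t ≤ y 0 + 16 * C * A := by
  have h := le_of_deriv_le_integrable (A := 4 * C * A) ht (by positivity) hc (fun s hs => by
    obtain ⟨y', h1, h2⟩ := hd s hs
    refine ⟨y', h1, h2.trans ?_⟩
    have h3 := jb_rpow_neg_le hs.1.le (p := 5 / 4) (by norm_num)
    have h4 : (2:ℝ) ^ (5 / 4 : ℝ) ≤ 4 := by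
      calc (2:ℝ) ^ (5 / 4 : ℝ) ≤ 2 ^ (2 : ℝ) := Real.rpow_le_rpow_of_exponent_le (by norm_num) (by norm_num)
        _ = 4 := by norm_num
    have hs0 : (0:ℝ) < 1 + s := by have := hs.1; linarith
    have h5 : jb s ^ (-(5 / 4) : ℝ) ≤ 4 * (1 + s) ^ (-(5 / 4) : ℝ) :=
      h3.trans (mul_le_mul_of_nonneg_right h4 (Real.rpow_nonneg hs0.le _))
    rw [fourth_root_pow, div_eq_mul_inv, ← Real.rpow_neg (jb_pos s).le]
    push_cast
    calc C * (A * jb s ^ (-(5 / 4) : ℝ)) ≤ C * (A * (4 * (1 + s) ^ (-(5 / 4) : ℝ))) := by gcongr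
      _ = _ := by ring)
  linarith

/-- The energy inequality with the resonant term. -/
lemma resonant_growth {N : ℝ → ℝ} {t δ C A W : ℝ} (ht : 0 ≤ t) (hδ : 0 < δ) (hδ1 : δ ≤ 1 / 2)
    (hC : 0 ≤ C) (hA : 0 ≤ A) (hW : 0 ≤ W) (hc : ContinuousOn (fun s => N s ^ 2) (Icc 0 t))
    (hN : ∀ s, 0 ≤ N s)
    (hd : ∀ s ∈ Ioo 0 t, ∃ y', HasDerivAt (fun s => N s ^ 2) y' s ∧
      y' ≤ C * (A / (jb s ^ (1 / 4 : ℝ)) ^ 5 + jb s ^ δ * W * N s / (jb s ^ (1 / 4 : ℝ)) ^ 4)) :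
    (jb t ^ (-δ) * N t) ^ 2 ≤ 2 * (N 0 ^ 2 + (4 * C * A + C ^ 2 * W ^ 2 / δ) / δ) := by
  have h := le_of_deriv_le_growth (y := fun s => N s ^ 2) (D := 4 * C * A + C ^ 2 * W ^ 2 / δ) ht hδ
    (by positivity) (fun s => sq_nonneg _) hc (fun s hs => by
      obtain ⟨y', h1, h2⟩ := hd s hs
      refine ⟨y', h1, h2.trans ?_⟩
      have hs0 : (0:ℝ) < 1 + s := by have := hs.1; linarith
      have hj := jb_pos s
      have hq4 : (jb s ^ (1 / 4 : ℝ)) ^ 4 = jb s := by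
        rw [fourth_root_pow]; norm_num
      have hq5 : jb s ≤ (jb s ^ (1 / 4 : ℝ)) ^ 5 := by
        rw [fourth_root_pow]
        calc jb s = jb s ^ (1 : ℝ) := (Real.rpow_one _).symm
          _ ≤ _ := Real.rpow_le_rpow_of_exponent_le (one_le_jb s) (by norm_num)
      have hj2 := one_add_le_two_jb hs.1.le
      have hjδ : jb s ^ δ ≤ (1 + s) ^ δ := Real.rpow_le_rpow hj.le (jb_le_one_add hs.1.le) hδ.le
      set p := (1 + s) ^ δ with hp
      have hp1 : 1 ≤ p := Real.one_le_rpow (by linarith [hs.1]) hδ.le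
      have hp2 : (1 + s) ^ (2 * δ - 1) = p ^ 2 / (1 + s) := by
        rw [Real.rpow_sub hs0, Real.rpow_one, mul_comm, Real.rpow_mul hs0.le, Real.rpow_two]
      have t1 : A / (jb s ^ (1 / 4 : ℝ)) ^ 5 ≤ 4 * A * p ^ 2 / (1 + s) := by
        have : A / (jb s ^ (1 / 4 : ℝ)) ^ 5 ≤ A / jb s := by gcongr
        refine this.trans ?_
        rw [div_le_div_iff₀ hj hs0]
        have : 1 ≤ p ^ 2 := one_le_pow₀ hp1
        calc A * (1 + s) ≤ A * (2 * jb s) * 1 := by rw [mul_one]; gcongr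
          _ ≤ A * (2 * jb s) * p ^ 2 := by gcongr
          _ ≤ 4 * A * p ^ 2 * jb s := by nlinarith [mul_nonneg (mul_nonneg hA hj.le) (sq_nonneg p)]
      have t2 : jb s ^ δ * W * N s / (jb s ^ (1 / 4 : ℝ)) ^ 4 ≤ 2 * p * W * N s / (1 + s) := by
        rw [hq4, div_le_div_iff₀ hj hs0]
        have := hN s
        calc jb s ^ δ * W * N s * (1 + s) ≤ p * W * N s * (2 * jb s) := by gcongr
          _ = _ := by ring
      have t3 : C * (2 * p * W * N s) ≤ δ * N s ^ 2 + C ^ 2 * W ^ 2 / δ * p ^ 2 := by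
        have e : δ * N s ^ 2 + C ^ 2 * W ^ 2 / δ * p ^ 2 - C * (2 * p * W * N s)
          = (δ * N s - C * W * p) ^ 2 / δ := by field_simp; ring
        have : 0 ≤ (δ * N s - C * W * p) ^ 2 / δ := by positivity
        linarith
      calc C * (A / (jb s ^ (1 / 4 : ℝ)) ^ 5 + jb s ^ δ * W * N s / (jb s ^ (1 / 4 : ℝ)) ^ 4)
          ≤ C * (4 * A * p ^ 2 / (1 + s) + 2 * p * W * N s / (1 + s)) := by gcongr
        _ = (4 * C * A * p ^ 2 + C * (2 * p * W * N s)) / (1 + s) := by ring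
        _ ≤ (4 * C * A * p ^ 2 + (δ * N s ^ 2 + C ^ 2 * W ^ 2 / δ * p ^ 2)) / (1 + s) := by gcongr
        _ = δ * N s ^ 2 / (1 + s) + (4 * C * A + C ^ 2 * W ^ 2 / δ) * (p ^ 2 / (1 + s)) := by ring
        _ = _ := by rw [hp2])
  have h1 := jb_rpow_neg_le ht (p := 2 * δ) (by linarith)
  have h2 : (2:ℝ) ^ (2 * δ) ≤ 2 := by
    calc (2:ℝ) ^ (2 * δ) ≤ 2 ^ (1 : ℝ) := Real.rpow_le_rpow_of_exponent_le (by norm_num) (by linarith)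
      _ = 2 := by norm_num
  have e : (jb t ^ (-δ)) ^ 2 = jb t ^ (-(2 * δ)) := by
    rw [← Real.rpow_natCast, ← Real.rpow_mul (jb_pos t).le]; congr 1; push_cast; ring
  have h3 : jb t ^ (-(2 * δ)) ≤ 2 * (1 + t) ^ (-(2 * δ)) :=
    h1.trans (mul_le_mul_of_nonneg_right h2 (by positivity))
  rw [mul_pow, e]
  calc jb t ^ (-(2 * δ)) * N t ^ 2 ≤ 2 * (1 + t) ^ (-(2 * δ)) * N t ^ 2 := by gcongr
    _ = 2 * ((1 + t) ^ (-(2 * δ)) * N t ^ 2) := by ring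
    _ ≤ _ := by gcongr

lemma VanOut.closed {T R : ℝ} {f : Fn} (hT : 0 < T) (h : VanOut (Ioo 0 T) R f) (hf : Continuous f) :
    VanOut (Icc 0 T) R f := fun t ht x hx => by
  have h1 : IsClosed {s : ℝ | f (s, x) = 0} := isClosed_eq (hf.comp (by fun_prop)) continuous_const
  have h2 : closure (Ioo 0 T) ⊆ {s : ℝ | f (s, x) = 0} :=
    closure_minimal (fun s hs => h s hs x hx) h1
  rw [closure_Ioo hT.ne] at h2
  exact h2 ht

lemma VanOut.bounded {T R : ℝ} {f : Fn} (h : VanOut (Icc 0 T) R f) (hf : Continuous f) :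
    ∃ M, 0 ≤ M ∧ ∀ t ∈ Icc 0 T, ∀ x, |f (t, x)| ≤ M := by
  obtain ⟨M, hM⟩ := ((isCompact_Icc (a := (0:ℝ)) (b := T)).prod
    (isCompact_closedBall (0 : Sp) R)).exists_bound_of_continuousOn hf.continuousOn
  refine ⟨max M 0, le_max_right _ _, fun t ht x => ?_⟩
  rcases le_or_gt ‖x‖ R with hx | hx
  · exact (hM (t, x) ⟨ht, by simpa using hx⟩).trans (le_max_left _ _)
  · rw [h t ht x hx, abs_zero]; exact le_max_right _ _

lemma VanOut.integral_continuousOn {I : Set ℝ} {R : ℝ} {f : Fn} (h : VanOut I R f)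
    (hf : Continuous f) : ContinuousOn (fun t => ∫ x, f (t, x)) I :=
  continuousOn_integral_of_compact_support (f := fun t x => f (t, x))
    (isCompact_closedBall (0 : Sp) R) hf.continuousOn
    (fun t x ht hx => h t ht x (by simpa using hx))

/-- Boundedness on the time interval `[0, T]`. -/
def BddTime (T : ℝ) (g : ℝ → ℝ) : Prop := ∃ M, ∀ t ∈ Icc 0 T, |g t| ≤ M

lemma BddTime.of_continuousOn {T : ℝ} {g : ℝ → ℝ} (h : ContinuousOn g (Icc 0 T)) : BddTime T g :=
  isCompact_Icc.exists_bound_of_continuousOn h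

lemma BddTime.add {T : ℝ} {g k : ℝ → ℝ} (hg : BddTime T g) (hk : BddTime T k) :
    BddTime T fun t => g t + k t := by
  obtain ⟨M, hM⟩ := hg
  obtain ⟨M', hM'⟩ := hk
  exact ⟨M + M', fun t ht => (abs_add_le _ _).trans (add_le_add (hM t ht) (hM' t ht))⟩

lemma BddTime.mul {T : ℝ} {g k : ℝ → ℝ} (hg : BddTime T g) (hk : BddTime T k) :
    BddTime T fun t => g t * k t := by
  obtain ⟨M, hM⟩ := hg
  obtain ⟨M', hM'⟩ := hk
  exact ⟨M * M', fun t ht => by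
    rw [abs_mul]
    exact mul_le_mul (hM t ht) (hM' t ht) (abs_nonneg _) ((abs_nonneg _).trans (hM t ht))⟩

lemma BddTime.sum {ι : Type*} {T : ℝ} (s : Finset ι) {g : ι → ℝ → ℝ}
    (hg : ∀ i ∈ s, BddTime T (g i)) : BddTime T fun t => ∑ i ∈ s, g i t := by
  classical
  induction s using Finset.induction_on with
  | empty => exact ⟨0, by simp⟩
  | insert a s ha ih =>
    simp only [Finset.sum_insert ha]
    exact (hg a (by simp)).add (ih fun i hi => hg i (by simp [hi]))

lemma BddTime.jb_rpow (T p : ℝ) : BddTime T fun t => jb t ^ p :=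
  .of_continuousOn (jb_cont.continuousOn.rpow_const fun t _ => .inl (jb_pos t).ne')

lemma BddTime.bddAbove {T : ℝ} {g : ℝ → ℝ} (hg : BddTime T g) :
    BddAbove (range fun t : Ioo (0:ℝ) T => g t) := by
  obtain ⟨M, hM⟩ := hg
  exact ⟨M, by rintro _ ⟨t, rfl⟩; exact (le_abs_self _).trans (hM t ⟨t.2.1.le, t.2.2.le⟩)⟩

lemma Linf_nonneg (f : Sp → ℝ) : 0 ≤ Linf f := Real.iSup_nonneg fun _ => abs_nonneg _

lemma L4sph_nonneg (f : Sp → ℝ) (r : ℝ) : 0 ≤ L4sph f r :=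
  Real.rpow_nonneg (integral_nonneg fun _ => by positivity) _

lemma LinfrL4_nonneg (f : Sp → ℝ) : 0 ≤ LinfrL4 f := Real.iSup_nonneg fun _ => L4sph_nonneg _ _

lemma L6_nonneg (f : Sp → ℝ) : 0 ≤ L6 f :=
  Real.rpow_nonneg (integral_nonneg fun _ => by positivity) _

lemma abs_le_Linf {f : Sp → ℝ} {M : ℝ} (h : ∀ x, |f x| ≤ M) (x : Sp) : |f x| ≤ Linf f :=
  le_ciSup (f := fun x => |f x|) ⟨M, by rintro _ ⟨y, rfl⟩; exact h y⟩ x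

lemma L4sph_le {f : Sp → ℝ} {M : ℝ} (hf : Continuous f) (h : ∀ x, |f x| ≤ M) (r : ℝ) :
    L4sph f r ≤ (sphMeas.real univ * M ^ 4) ^ ((1:ℝ)/4) := by
  refine Real.rpow_le_rpow (integral_nonneg fun _ => by positivity) ?_ (by norm_num)
  calc ∫ ω : S2, |f (r • (ω : Sp))| ^ 4 ∂sphMeas ≤ ∫ _ω : S2, M ^ 4 ∂sphMeas :=
        integral_mono (sph_integrable hf r) (integrable_const _)
          fun ω => pow_le_pow_left₀ (abs_nonneg _) (h _) 4
    _ = _ := by simp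

lemma sphere_integral_le_LinfrL4 {f : Sp → ℝ} {M : ℝ} (hf : Continuous f) (h : ∀ x, |f x| ≤ M)
    {r : ℝ} (hr : 0 < r) : ∫ ω : S2, |f (r • (ω : Sp))| ^ 4 ∂sphMeas ≤ LinfrL4 f ^ 4 := by
  have h1 : L4sph f r ≤ LinfrL4 f :=
    le_ciSup (f := fun r : Ioi (0:ℝ) => L4sph f r)
      ⟨_, by rintro _ ⟨y, rfl⟩; exact L4sph_le hf h y⟩ ⟨r, hr⟩
  have h2 : L4sph f r ^ 4 = ∫ ω : S2, |f (r • (ω : Sp))| ^ 4 ∂sphMeas := by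
    rw [L4sph, ← Real.rpow_natCast, ← Real.rpow_mul (integral_nonneg fun _ => by positivity)]
    norm_num
  rw [← h2]
  exact pow_le_pow_left₀ (L4sph_nonneg _ _) h1 4

lemma VanOut.bddTime_Linf {T R : ℝ} {f : Fn} (h : VanOut (Icc 0 T) R f) (hf : Continuous f) :
    BddTime T fun t => Linf fun x => f (t, x) := by
  obtain ⟨M, _, hM⟩ := h.bounded hf
  exact ⟨M, fun t ht => by rw [abs_of_nonneg (Linf_nonneg _)]; exact ciSup_le (hM t ht)⟩

lemma VanOut.bddTime_LinfrL4 {T R : ℝ} {f : Fn} (h : VanOut (Icc 0 T) R f) (hf : Continuous f) :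
    BddTime T fun t => LinfrL4 fun x => f (t, x) := by
  obtain ⟨M, _, hM⟩ := h.bounded hf
  refine ⟨(sphMeas.real univ * M ^ 4) ^ ((1:ℝ)/4), fun t ht => ?_⟩
  rw [abs_of_nonneg (LinfrL4_nonneg _)]
  exact ciSup_le fun r => L4sph_le (hf.comp (by fun_prop)) (hM t ht) r

lemma VanOut.bddTime_L2 {T R : ℝ} {f : Fn} (h : VanOut (Icc 0 T) R f) (hf : Continuous f) :
    BddTime T fun t => L2 fun x => f (t, x) :=
  .of_continuousOn (VanOut.integral_continuousOn (R := R) (f := fun p => f p ^ 2)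
    (fun t ht x hx => by simp [h t ht x hx]) (hf.pow 2)).sqrt

lemma VanOut.bddTime_L6 {T R : ℝ} {f : Fn} (h : VanOut (Icc 0 T) R f) (hf : Continuous f) :
    BddTime T fun t => L6 fun x => f (t, x) :=
  .of_continuousOn ((VanOut.integral_continuousOn (R := R) (f := fun p => |f p| ^ 6)
    (fun t ht x hx => by simp [h t ht x hx]) (hf.abs.pow 6)).rpow_const fun _ _ => .inr (by norm_num))

lemma pdNorm_continuous {v : Fn} (hv : Sm v) : Continuous (pdNorm v) := by
  unfold pdNorm
  exact (continuous_finsetSum _ fun α _ => (hv.pd α).continuous.pow 2).sqrt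

lemma VanOut.pdNorm {O : Set ℝ} {R : ℝ} {f : Fn} (h : VanOut O R f) (hO : IsOpen O) :
    VanOut O R (pdNorm f) := fun t ht x hx => by
  simp [MultiSpeedWave.pdNorm, h.pd hO _ t ht x hx]

lemma VanOut.mul_weight {O : Set ℝ} {R : ℝ} {f : Fn} (h : VanOut O R f) (w : Fn) :
    VanOut O R fun p => w p * f p := fun t ht x hx => by simp [h t ht x hx]

lemma VanOut.sphere_le_LinfrL4 {T R : ℝ} {f : Fn} (h : VanOut (Icc 0 T) R f) (hf : Continuous f)
    {t : ℝ} (ht : t ∈ Ioo 0 T) {r : ℝ} (hr : 0 < r) :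
    ∫ ω : S2, |f (t, r • (ω : Sp))| ^ 4 ∂sphMeas ≤ (LinfrL4 fun x => f (t, x)) ^ 4 := by
  obtain ⟨M, _, hM⟩ := h.bounded hf
  exact sphere_integral_le_LinfrL4
    (hf.comp (by fun_prop : Continuous fun x : Sp => ((t, x) : Pt))) (hM t ⟨ht.1.le, ht.2.le⟩) hr

lemma weighted_continuous {v : Fn} (hv : Sm v) {w : ℝ → Sp → ℝ}
    (hw : Continuous fun p : Pt => w p.1 p.2) : Continuous fun p : Pt => w p.1 p.2 * pdNorm v p :=
  hw.mul (pdNorm_continuous hv)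

section Bounded
variable {T R : ℝ} {v : Fn} (hT : 0 < T) (hv : Sm v) (h : VanOut (Ioo 0 T) R v)
  {w : ℝ → Sp → ℝ} (hw : Continuous fun p : Pt => w p.1 p.2)
include hT hv h

lemma Nnorm_sq_continuousOn (κ : ℕ) (c : ℝ) :
    ContinuousOn (fun t => Nnorm κ c v t ^ 2) (Icc 0 T) := by
  simp only [Nnorm_sq, energy_eq]
  exact continuousOn_finsetSum _ fun a _ =>
    (((h.zmulti isOpen_Ioo a).en isOpen_Ioo c).closed hT ((hv.zmulti a).en c).continuous).integral_continuousOn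
      ((hv.zmulti a).en c).continuous

lemma bddTime_Nnorm (κ : ℕ) (c : ℝ) : BddTime T (Nnorm κ c v) := by
  have h1 := (Nnorm_sq_continuousOn hT hv h κ c).sqrt
  simp only [Real.sqrt_sq (Nnorm_nonneg _ _ _ _)] at h1
  exact .of_continuousOn h1

lemma bddTime_Mmu (μ : ℕ) (c : ℝ) : BddTime T (Mmu μ c v) := by
  refine .sum _ fun a _ => .sum _ fun α _ => .sum _ fun j _ => ?_
  have hf : Continuous fun p : Pt => jb (c * p.1 - ‖p.2‖) * pd α (px j (Zmulti a v)) p :=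
    (jb_cont.comp (by fun_prop)).mul (((hv.zmulti a).px j).pd α).continuous
  exact ((((((h.zmulti isOpen_Ioo a).pd isOpen_Ioo j.succ).pd isOpen_Ioo α).mul_weight
    _).closed hT hf).bddTime_L2 hf)

include hw

lemma weighted_vanOut : VanOut (Icc 0 T) R fun p : Pt => w p.1 p.2 * pdNorm v p :=
  ((h.pdNorm isOpen_Ioo).mul_weight _).closed hT (weighted_continuous hv hw)

lemma bddTime_wInf : BddTime T fun t => wInf (w t) v t :=
  (weighted_vanOut hT hv h hw).bddTime_Linf (weighted_continuous hv hw)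

lemma bddTime_wL4 : BddTime T fun t => wL4 (w t) v t :=
  (weighted_vanOut hT hv h hw).bddTime_LinfrL4 (weighted_continuous hv hw)

lemma bddTime_wL6 : BddTime T fun t => wL6 (w t) v t :=
  (weighted_vanOut hT hv h hw).bddTime_L6 (weighted_continuous hv hw)

lemma le_wInf {t : ℝ} (ht : t ∈ Ioo 0 T) (x : Sp) : w t x * pdNorm v (t, x) ≤ wInf (w t) v t := by
  obtain ⟨M, _, hM⟩ := (weighted_vanOut hT hv h hw).bounded (weighted_continuous hv hw)
  exact (le_abs_self _).trans (abs_le_Linf (f := fun x => w t x * pdNorm v (t, x))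
    (hM t ⟨ht.1.le, ht.2.le⟩) x)

lemma sphere_le_wL4 {t : ℝ} (ht : t ∈ Ioo 0 T) {r : ℝ} (hr : 0 < r) :
    ∫ ω : S2, |w t (r • (ω : Sp)) * pdNorm v (t, r • (ω : Sp))| ^ 4 ∂sphMeas ≤ wL4 (w t) v t ^ 4 :=
  (weighted_vanOut hT hv h hw).sphere_le_LinfrL4 (weighted_continuous hv hw) ht hr

end Bounded

section Field
variable {T R : ℝ} {v : Fn} (hT : 0 < T) (hv : Sm v) (h : VanOut (Ioo 0 T) R v)
include hT hv h

lemma field_vanOut (j : Fin 7) : VanOut (Icc 0 T) R fun p : Pt => Real.sqrt ‖p.2‖ * Zop j v p := by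
  have h1 : VanOut (Ioo 0 T) R (Zop j v) := h.zw isOpen_Ioo [j]
  exact (h1.mul_weight fun p => Real.sqrt ‖p.2‖).closed hT
    (continuous_snd.norm.sqrt.mul (hv.zop j).continuous)

lemma bddTime_field (j : Fin 7) :
    BddTime T fun t => LinfrL4 fun x => Real.sqrt ‖x‖ * Zop j v (t, x) := by
  have hc : Continuous fun p : Pt => Real.sqrt ‖p.2‖ * Zop j v p :=
    continuous_snd.norm.sqrt.mul (hv.zop j).continuous
  exact (field_vanOut hT hv h j).bddTime_LinfrL4 hc

lemma sphere_le_field (j : Fin 7) {t : ℝ} (ht : t ∈ Ioo 0 T) {r : ℝ} (hr : 0 < r) :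
    ∫ ω : S2, |Real.sqrt ‖r • (ω : Sp)‖ * Zop j v (t, r • (ω : Sp))| ^ 4 ∂sphMeas ≤
      (LinfrL4 fun x => Real.sqrt ‖x‖ * Zop j v (t, x)) ^ 4 := by
  have hc := (hv.zop j).continuous
  have hv := field_vanOut hT hv h j
  generalize Zop j v = g at hc hv ⊢
  exact hv.sphere_le_LinfrL4 (continuous_snd.norm.sqrt.mul hc) ht hr

end Field

lemma bddTime_bigBracket {T R c0 δ : ℝ} {u : Fin 3 → Fn} (hT : 0 < T) (hu : ∀ i, Sm (u i))
    (h : ∀ i, VanOut (Ioo 0 T) R (u i)) : BddTime T (bigBracket c0 δ u) := by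
  have hJ : ∀ i : Fin 3, Continuous fun p : Pt => jb (cspeed c0 i * p.1 - ‖p.2‖) :=
    fun i => jb_cont.comp (by fun_prop)
  have hx : Continuous fun p : Pt => ‖p.2‖ := continuous_snd.norm
  have hz := fun i a => (hu i).zmulti a
  have hvz := fun i a => (h i).zmulti isOpen_Ioo a
  have e := BddTime.jb_rpow T
  have m : ∀ m : ℕ, ∀ σ : ℝ → Fin 3 → ℝ, ∀ d : ℝ, BddTime T fun t => ∑ i : Fin 3, ∑ a ∈ idxSet 7 m,
      jb t ^ (σ d i) *
     (wL4 (fun x => Real.sqrt ‖x‖ * jb (cspeed c0 i * t - ‖x‖)) (Zmulti a (u i)) t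
      + ∑ j : Fin 7, LinfrL4 fun x => Real.sqrt ‖x‖ * Zop j (Zmulti a (u i)) (t,x)) :=
    fun m σ d => .sum _ fun i _ => .sum _ fun a _ => (e _).mul
      ((bddTime_wL4 hT (hz i a) (hvz i a) (hx.sqrt.mul (hJ i))).add
        (.sum _ fun j _ => bddTime_field hT (hz i a) (hvz i a) j))
  unfold bigBracket
  refine (((((((BddTime.add ?_ ?_).add (m 1 (fun _ i => -(sig δ i)) δ)).add
    (m 2 (fun d i => -(sig δ i) - d) δ)).add ?_).add ?_).add ?_).add ?_)
  · exact .sum _ fun i _ => (e _).mul (bddTime_wInf hT (hu i) (h i) (hx.mul (hJ i).sqrt))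
  · exact .sum _ fun i _ => .sum _ fun a _ => (e _).mul
      (bddTime_wInf hT (hz i a) (hvz i a) (hx.mul (hJ i).sqrt))
  · exact .sum _ fun i _ => .sum _ fun a _ => (e _).mul
      (bddTime_wL4 hT (hz i a) (hvz i a) (w := fun _ x => ‖x‖) hx)
  · exact .sum _ fun i _ => (e _).mul (bddTime_wInf hT (hu i) (h i) (hJ i))
  · exact (e _).mul (.sum _ fun i _ => .sum _ fun a _ => (e _).mul
      (bddTime_wInf hT (hz i a) (hvz i a) (hJ i)))
  · exact .sum _ fun i _ => .sum _ fun a _ => (e _).mul (bddTime_wL6 hT (hz i a) (hvz i a) (hJ i))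

lemma bddTime_calN {T R c0 δ : ℝ} {u : Fin 3 → Fn} (hT : 0 < T) (hu : ∀ i, Sm (u i))
    (h : ∀ i, VanOut (Ioo 0 T) R (u i)) (κ : ℕ) : BddTime T (calN c0 δ κ u) :=
  (((BddTime.jb_rpow T _).mul (bddTime_Nnorm hT (hu 0) (h 0) κ 1)).add
    (bddTime_Nnorm hT (hu 1) (h 1) κ 1)).add (bddTime_Nnorm hT (hu 2) (h 2) κ c0)

lemma bddTime_calM {T R c0 δ : ℝ} {u : Fin 3 → Fn} (hT : 0 < T) (hu : ∀ i, Sm (u i))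
    (h : ∀ i, VanOut (Ioo 0 T) R (u i)) (κ : ℕ) : BddTime T (calM c0 δ κ u) :=
  (((BddTime.jb_rpow T _).mul (bddTime_Mmu hT (hu 0) (h 0) κ 1)).add
    (bddTime_Mmu hT (hu 1) (h 1) κ 1)).add (bddTime_Mmu hT (hu 2) (h 2) κ c0)

lemma le_supIoo {T : ℝ} {f : ℝ → ℝ} (h : BddTime T f) {t : ℝ} (ht : t ∈ Ioo 0 T) : f t ≤ supIoo T f :=
  le_ciSup (f := fun t : Ioo (0:ℝ) T => f t) h.bddAbove ⟨t, ht⟩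

/-- The individual pointwise norms controlled by `bigBracket`. -/
structure BracketTerms (c0 δ : ℝ) (u : Fin 3 → Fn) (t X : ℝ) : Prop where
  sup_norm : ∀ i, jb t ^ (-(sig δ i)) *
    wInf (fun x => ‖x‖ * Real.sqrt (jb (cspeed c0 i * t - ‖x‖))) (u i) t ≤ X
  sup_mixed : ∀ i, ∀ a ∈ idxSet 7 1, jb t ^ (-(sig δ i) - δ) *
    wInf (fun x => ‖x‖ * Real.sqrt (jb (cspeed c0 i * t - ‖x‖))) (Zmulti a (u i)) t ≤ X
  sph_cone : ∀ i, ∀ a ∈ idxSet 7 2, jb t ^ (-(sig δ i) - δ) *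
    wL4 (fun x => Real.sqrt ‖x‖ * jb (cspeed c0 i * t - ‖x‖)) (Zmulti a (u i)) t ≤ X
  sph_field : ∀ i, ∀ a ∈ idxSet 7 2, ∀ j : Fin 7, jb t ^ (-(sig δ i) - δ) *
    (LinfrL4 fun x => Real.sqrt ‖x‖ * Zop j (Zmulti a (u i)) (t, x)) ≤ X
  sph_norm : ∀ i, ∀ a ∈ idxSet 7 1, jb t ^ (-(sig δ i)) *
    wL4 (fun x => ‖x‖) (Zmulti a (u i)) t ≤ X
  sup_cone : ∀ i, ∀ a ∈ idxSet 7 1, jb t ^ (-δ) * (jb t ^ (-(sig δ i)) *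
    wInf (fun x => jb (cspeed c0 i * t - ‖x‖)) (Zmulti a (u i)) t) ≤ X

lemma le_sum_sum {A : Type*} {s : Finset A} {f : Fin 3 → A → ℝ} (hf : ∀ i a, 0 ≤ f i a) (i : Fin 3)
    {a : A} (ha : a ∈ s) : f i a ≤ ∑ i, ∑ a ∈ s, f i a :=
  (Finset.single_le_sum (fun a _ => hf i a) ha).trans
    (Finset.single_le_sum (f := fun i => ∑ a ∈ s, f i a)
      (fun i _ => Finset.sum_nonneg fun a _ => hf i a) (Finset.mem_univ i))

lemma bracketTerms (c0 δ : ℝ) (u : Fin 3 → Fn) (t : ℝ) :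
    BracketTerms c0 δ u t (bigBracket c0 δ u t) ∧ 0 ≤ bigBracket c0 δ u t := by
  have hp : ∀ s : ℝ, 0 ≤ jb t ^ s := fun s => Real.rpow_nonneg (jb_pos t).le s
  have g1 : ∀ i, 0 ≤ jb t ^ (-(sig δ i)) *
    wInf (fun x => ‖x‖ * Real.sqrt (jb (cspeed c0 i * t - ‖x‖))) (u i) t :=
    fun i => mul_nonneg (hp _) (Linf_nonneg _)
  have g2 : ∀ (i : Fin 3) (a : Fin 7 → ℕ), 0 ≤ jb t ^ (-(sig δ i) - δ) *
    wInf (fun x => ‖x‖ * Real.sqrt (jb (cspeed c0 i * t - ‖x‖))) (Zmulti a (u i)) t :=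
    fun i a => mul_nonneg (hp _) (Linf_nonneg _)
  have gz : ∀ (i : Fin 3) (a : Fin 7 → ℕ), 0 ≤ ∑ j : Fin 7,
      LinfrL4 fun x => Real.sqrt ‖x‖ * Zop j (Zmulti a (u i)) (t,x) :=
    fun i a => Finset.sum_nonneg fun j _ => LinfrL4_nonneg _
  have gw : ∀ (i : Fin 3) (a : Fin 7 → ℕ),
      0 ≤ wL4 (fun x => Real.sqrt ‖x‖ * jb (cspeed c0 i * t - ‖x‖)) (Zmulti a (u i)) t :=
    fun i a => LinfrL4_nonneg _
  have g3 : ∀ (s : ℝ) (i : Fin 3) (a : Fin 7 → ℕ), 0 ≤ jb t ^ (-(sig δ i) - s) *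
     (wL4 (fun x => Real.sqrt ‖x‖ * jb (cspeed c0 i * t - ‖x‖)) (Zmulti a (u i)) t
      + ∑ j : Fin 7, LinfrL4 fun x => Real.sqrt ‖x‖ * Zop j (Zmulti a (u i)) (t,x)) :=
    fun s i a => mul_nonneg (hp _) (add_nonneg (gw i a) (gz i a))
  have g5 : ∀ (i : Fin 3) (a : Fin 7 → ℕ), 0 ≤ jb t ^ (-(sig δ i)) *
     wL4 (fun x => ‖x‖) (Zmulti a (u i)) t := fun i a => mul_nonneg (hp _) (LinfrL4_nonneg _)
  have g6 : ∀ i, 0 ≤ jb t ^ (-(sig δ i)) *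
     wInf (fun x => jb (cspeed c0 i * t - ‖x‖)) (u i) t := fun i => mul_nonneg (hp _) (Linf_nonneg _)
  have g7 : ∀ (i : Fin 3) (a : Fin 7 → ℕ), 0 ≤ jb t ^ (-(sig δ i)) *
     wInf (fun x => jb (cspeed c0 i * t - ‖x‖)) (Zmulti a (u i)) t :=
    fun i a => mul_nonneg (hp _) (Linf_nonneg _)
  have g8 : ∀ (i : Fin 3) (a : Fin 7 → ℕ), 0 ≤ jb t ^ (-(sig δ i)) *
     wL6 (fun x => jb (cspeed c0 i * t - ‖x‖)) (Zmulti a (u i)) t :=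
    fun i a => mul_nonneg (hp _) (L6_nonneg _)
  have g0 := g3 0
  simp only [sub_zero] at g0
  have s1 := Finset.sum_nonneg fun i (_ : i ∈ Finset.univ) => g1 i
  have s2 := Finset.sum_nonneg fun i (_ : i ∈ Finset.univ) =>
    Finset.sum_nonneg fun a (_ : a ∈ idxSet 7 1) => g2 i a
  have s3 := Finset.sum_nonneg fun i (_ : i ∈ Finset.univ) =>
    Finset.sum_nonneg fun a (_ : a ∈ idxSet 7 1) => g0 i a
  have s4 := Finset.sum_nonneg fun i (_ : i ∈ Finset.univ) =>
    Finset.sum_nonneg fun a (_ : a ∈ idxSet 7 2) => g3 δ i a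
  have s5 := Finset.sum_nonneg fun i (_ : i ∈ Finset.univ) =>
    Finset.sum_nonneg fun a (_ : a ∈ idxSet 7 1) => g5 i a
  have s6 := Finset.sum_nonneg fun i (_ : i ∈ Finset.univ) => g6 i
  have s7 := mul_nonneg (hp (-δ)) (Finset.sum_nonneg fun i (_ : i ∈ Finset.univ) =>
    Finset.sum_nonneg fun a (_ : a ∈ idxSet 7 1) => g7 i a)
  have s8 := Finset.sum_nonneg fun i (_ : i ∈ Finset.univ) =>
    Finset.sum_nonneg fun a (_ : a ∈ idxSet 7 1) => g8 i a
  have k4 : ∀ i, ∀ a ∈ idxSet 7 2, jb t ^ (-(sig δ i) - δ) *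
     (wL4 (fun x => Real.sqrt ‖x‖ * jb (cspeed c0 i * t - ‖x‖)) (Zmulti a (u i)) t
      + ∑ j : Fin 7, LinfrL4 fun x => Real.sqrt ‖x‖ * Zop j (Zmulti a (u i)) (t,x))
      ≤ bigBracket c0 δ u t := fun i a ha => by
    refine (le_sum_sum (g3 δ) i ha).trans ?_
    unfold bigBracket; linarith
  refine ⟨⟨fun i => ?_, fun i a ha => ?_, fun i a ha => ?_, fun i a ha j => ?_, fun i a ha => ?_,
    fun i a ha => ?_⟩, ?_⟩
  · refine (Finset.single_le_sum (fun i _ => g1 i) (Finset.mem_univ i)).trans ?_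
    unfold bigBracket; linarith
  · refine (le_sum_sum g2 i ha).trans ?_
    unfold bigBracket; linarith
  · refine le_trans (mul_le_mul_of_nonneg_left ?_ (hp _)) (k4 i a ha)
    linarith [gz i a]
  · refine le_trans (mul_le_mul_of_nonneg_left ?_ (hp _)) (k4 i a ha)
    have := Finset.single_le_sum (f := fun j =>
      LinfrL4 fun x => Real.sqrt ‖x‖ * Zop j (Zmulti a (u i)) (t,x))
      (fun j _ => LinfrL4_nonneg _) (Finset.mem_univ j)
    exact this.trans (le_add_of_nonneg_left (gw i a))
  · refine (le_sum_sum g5 i ha).trans ?_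
    unfold bigBracket; linarith
  · refine (mul_le_mul_of_nonneg_left (le_sum_sum g7 i ha) (hp _)).trans ?_
    unfold bigBracket; linarith
  · unfold bigBracket; linarith

lemma le_rpow_mul {t s X B : ℝ} (h : jb t ^ (-s) * X ≤ B) : X ≤ jb t ^ s * B := by
  have hp : 0 < jb t ^ s := Real.rpow_pos_of_pos (jb_pos t) s
  rw [Real.rpow_neg (jb_pos t).le] at h
  exact (inv_mul_le_iff₀ hp).1 h

lemma jb_rpow_sig (δ t : ℝ) (i : Fin 3) : jb t ^ sig δ i = epz (jb t ^ δ) i := by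
  fin_cases i <;> simp [sig, epz]

lemma one_le_jb_rpow {s : ℝ} (hs : 0 ≤ s) (t : ℝ) : 1 ≤ jb t ^ s := Real.one_le_rpow (one_le_jb t) hs

lemma jb_rpow_sig_add_le {δ : ℝ} (hδ : 0 < δ) (t : ℝ) (i : Fin 3) :
    jb t ^ (sig δ i + δ) ≤ (jb t ^ δ) ^ 2 := by
  rw [Real.rpow_add (jb_pos t), jb_rpow_sig, sq]
  exact mul_le_mul_of_nonneg_right (epz_bounds (one_le_jb_rpow hδ.le t) i).2
    (Real.rpow_nonneg (jb_pos t).le _)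

lemma component_le {δ t : ℝ} {g : Fin 3 → ℝ} (hg : ∀ i, 0 ≤ g i) (i : Fin 3) :
    g i ≤ epz (jb t ^ δ) i * (jb t ^ (-δ) * g 0 + g 1 + g 2) := by
  have hp : 0 < jb t ^ δ := Real.rpow_pos_of_pos (jb_pos t) δ
  have h0 := hg 0
  have h1 := hg 1
  have h2 := hg 2
  have h3 : 0 ≤ jb t ^ (-δ) * g 0 := mul_nonneg (Real.rpow_nonneg (jb_pos t).le _) h0
  have h4 : jb t ^ δ * (jb t ^ (-δ) * g 0) = g 0 := by
    rw [← mul_assoc, ← Real.rpow_add (jb_pos t)]; simp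
  fin_cases i
  · simp only [epz, Fin.zero_eta, Matrix.cons_val_zero]
    nlinarith [mul_nonneg hp.le h1, mul_nonneg hp.le h2]
  · simp [epz]; linarith
  · simp [epz]; linarith

lemma Nnorm_le_calN (c0 δ : ℝ) (κ : ℕ) (u : Fin 3 → Fn) (t : ℝ) (i : Fin 3) :
    Nnorm κ (cspeed c0 i) (u i) t ≤ epz (jb t ^ δ) i * calN c0 δ κ u t :=
  component_le (g := fun i => Nnorm κ (cspeed c0 i) (u i) t) (fun _ => Nnorm_nonneg _ _ _ _) i

lemma Mmu_nonneg (μ : ℕ) (c : ℝ) (v : Fn) (t : ℝ) : 0 ≤ Mmu μ c v t :=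
  Finset.sum_nonneg fun _ _ => M2_nonneg _ _ _

lemma Mmu_le_calM (c0 δ : ℝ) (μ : ℕ) (u : Fin 3 → Fn) (t : ℝ) (i : Fin 3) :
    Mmu μ (cspeed c0 i) (u i) t ≤ epz (jb t ^ δ) i * calM c0 δ μ u t :=
  component_le (g := fun i => Mmu μ (cspeed c0 i) (u i) t) (fun _ => Mmu_nonneg _ _ _ _) i

lemma calN_nonneg (c0 δ : ℝ) (κ : ℕ) (u : Fin 3 → Fn) (t : ℝ) : 0 ≤ calN c0 δ κ u t :=
  add_nonneg (add_nonneg (mul_nonneg (Real.rpow_nonneg (jb_pos t).le _) (Nnorm_nonneg _ _ _ _))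
    (Nnorm_nonneg _ _ _ _)) (Nnorm_nonneg _ _ _ _)

lemma calM_nonneg (c0 δ : ℝ) (μ : ℕ) (u : Fin 3 → Fn) (t : ℝ) : 0 ≤ calM c0 δ μ u t :=
  add_nonneg (add_nonneg (mul_nonneg (Real.rpow_nonneg (jb_pos t).le _) (Mmu_nonneg _ _ _ _))
    (Mmu_nonneg _ _ _ _)) (Mmu_nonneg _ _ _ _)

lemma supIoo_nonneg {T : ℝ} {f : ℝ → ℝ} (h : ∀ t, 0 ≤ f t) : 0 ≤ supIoo T f :=
  Real.iSup_nonneg fun _ => h _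

lemma bigBracketSup_nonneg (c0 δ T : ℝ) (u : Fin 3 → Fn) : 0 ≤ bigBracketSup c0 δ T u :=
  Real.iSup_nonneg fun _ => (bracketTerms _ _ _ _).2

lemma weighted_calN_nonneg (c0 δ : ℝ) (κ : ℕ) (u : Fin 3 → Fn) (s : ℝ) :
    0 ≤ jb s ^ (-δ) * calN c0 δ κ u s :=
  mul_nonneg (Real.rpow_nonneg (jb_pos s).le _) (calN_nonneg _ _ _ _ _)

lemma weighted_calM_nonneg (c0 δ : ℝ) (μ : ℕ) (u : Fin 3 → Fn) (s : ℝ) :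
    0 ≤ jb s ^ (-δ) * calM c0 δ μ u s :=
  mul_nonneg (Real.rpow_nonneg (jb_pos s).le _) (calM_nonneg _ _ _ _ _)

/-- The norms of a compactly supported triple satisfy the fixed-time bounds at every time. -/
lemma setup_of_vanOut {c0 δ T R : ℝ} (hδ : 0 < δ) (hδ' : δ < 1 / 24) (u : SU)
    (h : ∀ i, VanOut (Ioo 0 T) R (u.1 i)) (hB : bigBracketSup c0 δ T u.1 ≤ 1) {t : ℝ}
    (ht : t ∈ Ioo 0 T) :
    Setup c0 t (jb t ^ (1 / 4 : ℝ)) (jb t ^ δ) (supIoo T fun s => calN c0 δ 3 u.1 s)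
      ((supIoo T fun s => jb s ^ (-δ) * calN c0 δ 4 u.1 s)
        + supIoo T fun s => jb s ^ (-δ) * calM c0 δ 4 u.1 s)
      (bigBracketSup c0 δ T u.1) R u := by
  have hT : 0 < T := ht.1.trans ht.2
  have hu := u.2
  have hz := fun i a => (hu i).zmulti a
  have hvz := fun i a => (h i).zmulti isOpen_Ioo a
  have hp : 0 < jb t ^ δ := Real.rpow_pos_of_pos (jb_pos t) δ
  have hθ1 := one_le_jb_rpow hδ.le t
  have hJ : ∀ i : Fin 3, Continuous fun p : Pt => jb (cspeed c0 i * p.1 - ‖p.2‖) :=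
    fun i => jb_cont.comp (by fun_prop)
  have hx : Continuous fun p : Pt => ‖p.2‖ := continuous_snd.norm
  have hBB : bigBracket c0 δ u.1 t ≤ bigBracketSup c0 δ T u.1 :=
    le_ciSup (f := fun t : Ioo (0:ℝ) T => bigBracket c0 δ u.1 t)
      (bddTime_bigBracket hT hu h).bddAbove ⟨t, ht⟩
  have hB0 := bigBracketSup_nonneg c0 δ T u.1
  have hb := (bracketTerms c0 δ u.1 t).1
  generalize bigBracketSup c0 δ T u.1 = B at *
  have hN4 := le_supIoo ((BddTime.jb_rpow T (-δ)).mul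
    (bddTime_calN (c0 := c0) (δ := δ) hT hu h 4)) ht
  have hM4 := le_supIoo ((BddTime.jb_rpow T (-δ)).mul
    (bddTime_calM (c0 := c0) (δ := δ) hT hu h 4)) ht
  have hN40 := supIoo_nonneg (T := T) (weighted_calN_nonneg c0 δ 4 u.1)
  have hM40 := supIoo_nonneg (T := T) (weighted_calM_nonneg c0 δ 4 u.1)
  have hσ1 : ∀ i X, jb t ^ (-(sig δ i)) * X ≤ bigBracket c0 δ u.1 t → X ≤ epz (jb t ^ δ) i * B :=
    fun i X hX => by
      have := le_rpow_mul (hX.trans hBB)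
      rwa [jb_rpow_sig] at this
  have hσ2 : ∀ i X, jb t ^ (-(sig δ i) - δ) * X ≤ bigBracket c0 δ u.1 t → X ≤ (jb t ^ δ) ^ 2 * B :=
    fun i X hX => by
      rw [show -(sig δ i) - δ = -(sig δ i + δ) by ring] at hX
      exact (le_rpow_mul (hX.trans hBB)).trans
        (mul_le_mul_of_nonneg_right (jb_rpow_sig_add_le hδ t i) hB0)
  have hlin : ∀ i X Y H, X ≤ epz (jb t ^ δ) i * Y → jb t ^ (-δ) * Y ≤ H → 0 ≤ H →
      X ≤ (jb t ^ δ) ^ 2 * H := fun i X Y H h1 h2 h3 => by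
    have h4 := le_rpow_mul h2
    have he := epz_bounds hθ1 i
    calc X ≤ epz (jb t ^ δ) i * Y := h1
      _ ≤ epz (jb t ^ δ) i * (jb t ^ δ * H) := mul_le_mul_of_nonneg_left h4 (by linarith)
      _ ≤ jb t ^ δ * (jb t ^ δ * H) := mul_le_mul_of_nonneg_right he.2 (by positivity)
      _ = _ := by ring
  refine
    { t_nonneg := ht.1.le
      jb_eq := ?_
      one_le_q := one_le_jb_rpow (by norm_num) t
      one_le_θ := hθ1
      θ_le := ?_
      K_nonneg := supIoo_nonneg fun s => calN_nonneg _ _ _ _ _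
      H_nonneg := add_nonneg hN40 hM40
      B_nonneg := hB0
      B_le := hB
      van := ⟨Ioo 0 T, isOpen_Ioo, ht, h⟩
      energy_low := fun i => ?_
      energy_high := fun i => hlin i _ _ _ (Nnorm_le_calN c0 δ 4 u.1 t i) (hN4.trans (by linarith))
        (by linarith)
      weighted_high := fun i => hlin i _ _ _ (Mmu_le_calM c0 δ 4 u.1 t i) (hM4.trans (by linarith))
        (by linarith)
      sup_norm := fun i x => ?_
      sup_mixed := fun i a ha x => ?_
      sup_cone := fun i a ha x => ?_
      sph_norm := fun i a ha r hr => ?_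
      sph_cone := fun i a ha r hr => ?_
      sph_field := fun i a ha j r hr => ?_ }
  · rw [fourth_root_pow]; norm_num
  · rw [← Real.rpow_natCast, ← Real.rpow_mul (jb_pos t).le]
    exact Real.rpow_le_rpow_of_exponent_le (one_le_jb t) (by push_cast; linarith)
  · have he := epz_bounds hθ1 i
    exact (Nnorm_le_calN c0 δ 3 u.1 t i).trans
      (mul_le_mul_of_nonneg_left (le_supIoo (bddTime_calN hT hu h 3) ht) (by linarith))
  · refine le_trans ?_ (hσ1 i _ (hb.sup_norm i))
    refine le_trans ?_ (le_wInf hT (hu i) (h i)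
      (w := fun t x => ‖x‖ * Real.sqrt (jb (cspeed c0 i * t - ‖x‖))) (hx.mul (hJ i).sqrt) ht x)
    have h1 : 1 ≤ Real.sqrt (jb (cspeed c0 i * t - ‖x‖)) := by
      rw [Real.le_sqrt' one_pos, one_pow]; exact one_le_jb _
    exact mul_le_mul_of_nonneg_right (le_mul_of_one_le_right (norm_nonneg x) h1) (pdNorm_nonneg _ _)
  · exact (le_wInf hT (hz i a) (hvz i a)
      (w := fun t x => ‖x‖ * Real.sqrt (jb (cspeed c0 i * t - ‖x‖))) (hx.mul (hJ i).sqrt) ht x).trans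
      (hσ2 i _ (hb.sup_mixed i a ha))
  · refine (le_wInf hT (hz i a) (hvz i a)
      (w := fun t x => jb (cspeed c0 i * t - ‖x‖)) (hJ i) ht x).trans (hσ2 i _ ?_)
    rw [sub_eq_add_neg, add_comm, Real.rpow_add (jb_pos t), mul_assoc]
    exact hb.sup_cone i a ha
  · have h1 := sphere_le_wL4 hT (hz i a) (hvz i a) (w := fun _ x => ‖x‖) hx ht hr
    simp only [norm_smul_sphere hr] at h1
    exact h1.trans (pow_le_pow_left₀ (LinfrL4_nonneg _) (hσ1 i _ (hb.sph_norm i a ha)) 4)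
  · have h1 := sphere_le_wL4 hT (hz i a) (hvz i a)
      (w := fun t x => Real.sqrt ‖x‖ * jb (cspeed c0 i * t - ‖x‖)) (hx.sqrt.mul (hJ i)) ht hr
    simp only [norm_smul_sphere hr] at h1
    exact h1.trans (pow_le_pow_left₀ (LinfrL4_nonneg _) (hσ2 i _ (hb.sph_cone i a ha)) 4)
  · have h1 := sphere_le_field hT (hz i a) (hvz i a) j ht hr
    simp only [norm_smul_sphere hr] at h1
    exact h1.trans (pow_le_pow_left₀ (LinfrL4_nonneg _) (hσ2 i _ (hb.sph_field i a ha j)) 4)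

lemma exists_small_bracket_estimate {c0 δ : ℝ} (h0 : 0 < c0) (hne : c0 ≠ 1) (hδ : 0 < δ)
    (hδ' : δ < 1 / 24) {F : Coef}
    {Cub : Fin 3 → MvPolynomial (Fin 3 × Fin 4) ℝ} (hTri : LowerTri F) (hCub : ∀ i, CubicLike (Cub i))
    (hC1 : CondC1 F) (hC2 : CondC2 F) (hC3 : CondC3 c0 F) :
    ∃ C : ℝ, 0 ≤ C ∧ ∀ {T : ℝ} {u : SU}, LocalSolution c0 F Cub T u.1 →
      bigBracketSup c0 δ T u.1 ≤ 1 → ∀ t ∈ Ioo 0 T, ∀ K H B A : ℝ,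
      K = (supIoo T fun s => calN c0 δ 3 u.1 s) →
      H = ((supIoo T fun s => jb s ^ (-δ) * calN c0 δ 4 u.1 s)
        + supIoo T fun s => jb s ^ (-δ) * calM c0 δ 4 u.1 s) →
      B = bigBracketSup c0 δ T u.1 → A = B * K * H + B ^ 2 * K ^ 2 →
      (jb t ^ (-δ) * Nnorm 3 1 (u.1 0) t) ^ 2 ≤
        2 * (Nnorm 3 1 (u.1 0) 0 ^ 2 + (4 * C * A + C ^ 2 * (B * K) ^ 2 / δ) / δ) ∧
      Nnorm 3 1 (u.1 1) t ^ 2 ≤ Nnorm 3 1 (u.1 1) 0 ^ 2 + 16 * C * A ∧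
      Nnorm 3 c0 (u.1 2) t ^ 2 ≤ Nnorm 3 c0 (u.1 2) 0 ^ 2 + 16 * C * A := by
  obtain ⟨C, hC, hrate⟩ := exists_energy_rate h0 hne hTri hCub hC1 hC2 hC3
  refine ⟨C, hC, fun {T u} hsol hsmall t ht K H B A hK hH hB hA => ?_⟩
  obtain ⟨R, hR⟩ := hsol.uniform_support h0 hCub
  have hT : 0 < T := ht.1.trans ht.2
  have hset : ∀ s ∈ Ioo 0 T, Setup c0 s (jb s ^ (1 / 4 : ℝ)) (jb s ^ δ) K H B R u := fun s hs => by
    subst hK hH hB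
    exact setup_of_vanOut hδ hδ' u hR hsmall hs
  have hK0 := (hset t ht).K_nonneg
  have hH0 := (hset t ht).H_nonneg
  have hB0 := (hset t ht).B_nonneg
  have hA0 : 0 ≤ A := by rw [hA]; positivity
  have hr : ∀ i, ∀ s ∈ Ioo 0 t, ∃ y', HasDerivAt (fun s => Nnorm 3 (cspeed c0 i) (u.1 i) s ^ 2) y' s ∧
      y' ≤ C * srcRate i (jb s ^ (1 / 4 : ℝ)) (jb s ^ δ) K H B (Nnorm 3 (cspeed c0 i) (u.1 i) s) :=
    fun i s hs => hrate (hset s ⟨hs.1, hs.2.trans ht.2⟩) ⟨hs.1, hs.2.trans ht.2⟩ hsol i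
  have hcont : ∀ i, ContinuousOn (fun s => Nnorm 3 (cspeed c0 i) (u.1 i) s ^ 2) (Icc 0 t) :=
    fun i => (Nnorm_sq_continuousOn hT (u.2 i) (hR i) 3 _).mono (Icc_subset_Icc_right ht.2.le)
  refine ⟨?_, ?_, ?_⟩
  · refine resonant_growth (N := Nnorm 3 1 (u.1 0)) ht.1.le hδ (by linarith) hC hA0
      (mul_nonneg hB0 hK0) (hcont 0) (fun s => Nnorm_nonneg _ _ _ _) fun s hs => ?_
    have := hr 0 s hs
    simp only [srcRate, if_true, ← hA] at this
    exact this
  · refine bounded_growth ht.1.le hC hA0 (hcont 1) fun s hs => ?_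
    have := hr 1 s hs
    simpa only [srcRate, one_ne_zero, if_false, add_zero, ← hA] using this
  · refine bounded_growth ht.1.le hC hA0 (hcont 2) fun s hs => ?_
    have := hr 2 s hs
    simpa only [srcRate, show (2 : Fin 3) ≠ 0 by decide, if_false, add_zero, ← hA] using this

/-- Low energy estimate (first half of Proposition 4.1). -/
theorem low_energy_estimate (c0 δ : ℝ) (hc0 : 0 < c0) (hne : c0 ≠ 1)
    (hδ : 0 < δ) (hδ' : δ < 1/24)
    (F : Coef) (Cub : Fin 3 → MvPolynomial (Fin 3 × Fin 4) ℝ)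
    (hTri : LowerTri F) (hCub : ∀ i, CubicLike (Cub i))
    (hC1 : CondC1 F) (hC2 : CondC2 F) (hC3 : CondC3 c0 F)
    (hC4 : CondC4 F) (hC5 : CondC5 F) :
    ∃ C : ℝ, 0 < C ∧ ∀ (T : ℝ) (u : Fin 3 → Fn), LocalSolution c0 F Cub T u →
      ∀ t ∈ Set.Ioo (0:ℝ) T,
        (jb t ^ (-δ) * Nnorm 3 1 (u 0) t)^2 + Nnorm 3 1 (u 1) t ^ 2
            + Nnorm 3 c0 (u 2) t ^ 2 ≤
          C * (∑ k : Fin 3, Nnorm 3 (cspeed c0 k) (u k) 0 ^ 2)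
          + C * bigBracketSup c0 δ T u *
              (supIoo T (fun s => jb s ^ (-δ) * calN c0 δ 4 u s)
               + supIoo T (fun s => jb s ^ (-δ) * calM c0 δ 4 u s)) *
              supIoo T (fun s => calN c0 δ 3 u s)
          + C * bigBracketSup c0 δ T u ^ 2 *
              (supIoo T (fun s => calN c0 δ 3 u s)) ^ 2 := by
  obtain ⟨C, hC, hest⟩ := exists_small_bracket_estimate hc0 hne hδ hδ' hTri hCub hC1 hC2 hC3
  refine ⟨3 + 32 * C + 8 * C / δ + 2 * C ^ 2 / δ ^ 2, by positivity, fun T u hsol t ht => ?_⟩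
  have hT : 0 < T := ht.1.trans ht.2
  obtain ⟨R, hR⟩ := hsol.uniform_support hc0 hCub
  have hest := hest (u := ⟨u, hsol.1⟩) hsol
  have hKt := le_supIoo (bddTime_calN (c0 := c0) (δ := δ) hT hsol.1 hR 3) ht
  have hK0 := supIoo_nonneg (T := T) (calN_nonneg c0 δ 3 u)
  have hH1 := supIoo_nonneg (T := T) (weighted_calN_nonneg c0 δ 4 u)
  have hH2 := supIoo_nonneg (T := T) (weighted_calM_nonneg c0 δ 4 u)
  have hB0 := bigBracketSup_nonneg c0 δ T u
  have hsum : ∑ k : Fin 3, Nnorm 3 (cspeed c0 k) (u k) 0 ^ 2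
      = Nnorm 3 1 (u 0) 0 ^ 2 + Nnorm 3 1 (u 1) 0 ^ 2 + Nnorm 3 c0 (u 2) 0 ^ 2 := by
    rw [Fin.sum_univ_three]; rfl
  rw [hsum]
  replace hest := fun hs => hest hs t ht _ _ _ _ rfl rfl rfl rfl
  dsimp only at hest
  generalize supIoo T (fun s => calN c0 δ 3 u s) = K at *
  generalize supIoo T (fun s => jb s ^ (-δ) * calN c0 δ 4 u s) = H1 at *
  generalize supIoo T (fun s => jb s ^ (-δ) * calM c0 δ 4 u s) = H2 at *
  generalize bigBracketSup c0 δ T u = B at *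
  have i0 := sq_nonneg (Nnorm 3 1 (u 0) 0)
  have i1 := sq_nonneg (Nnorm 3 1 (u 1) 0)
  have i2 := sq_nonneg (Nnorm 3 c0 (u 2) 0)
  set I := Nnorm 3 1 (u 0) 0 ^ 2 + Nnorm 3 1 (u 1) 0 ^ 2 + Nnorm 3 c0 (u 2) 0 ^ 2 with hI
  have hI0 : 0 ≤ I := by positivity
  have hP : 0 ≤ B * (H1 + H2) * K := by positivity
  have hQ : 0 ≤ B ^ 2 * K ^ 2 := by positivity
  have hc1 : 0 ≤ C / δ := by positivity
  have hc2 : 0 ≤ C ^ 2 / δ ^ 2 := by positivity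
  have hexp : ∀ D : ℝ, D * I + D * B * (H1 + H2) * K + D * B ^ 2 * K ^ 2
      = D * (I + B * (H1 + H2) * K + B ^ 2 * K ^ 2) := fun D => by ring
  rw [hexp]
  rcases le_or_gt B 1 with hB1 | hB1
  · obtain ⟨h1, h2, h3⟩ := hest hB1
    have h4 : (4 * C * (B * K * (H1 + H2) + B ^ 2 * K ^ 2) + C ^ 2 * (B * K) ^ 2 / δ) / δ
        = 4 * (C / δ) * (B * (H1 + H2) * K + B ^ 2 * K ^ 2) + C ^ 2 / δ ^ 2 * (B ^ 2 * K ^ 2) := by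
      field_simp
    rw [h4] at h1
    have h5 : B * K * (H1 + H2) = B * (H1 + H2) * K := by ring
    rw [h5] at h2 h3
    have e : (3 + 32 * C + 8 * C / δ + 2 * C ^ 2 / δ ^ 2)
        = 3 + 32 * C + 8 * (C / δ) + 2 * (C ^ 2 / δ ^ 2) := by ring
    rw [e]
    generalize C / δ = c₁ at *
    generalize C ^ 2 / δ ^ 2 = c₂ at *
    generalize B * (H1 + H2) * K = P at *
    generalize B ^ 2 * K ^ 2 = Q at *
    have := mul_nonneg hC hI0
    have := mul_nonneg hc1 hI0
    have := mul_nonneg hc2 hI0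
    have := mul_nonneg hc2 hP
    nlinarith
  · have hN0 : 0 ≤ jb t ^ (-δ) * Nnorm 3 1 (u 0) t :=
      mul_nonneg (Real.rpow_nonneg (jb_pos t).le _) (Nnorm_nonneg _ _ _ _)
    have hN1 := Nnorm_nonneg 3 1 (u 1) t
    have hN2 := Nnorm_nonneg 3 c0 (u 2) t
    have hKt' : jb t ^ (-δ) * Nnorm 3 1 (u 0) t + Nnorm 3 1 (u 1) t + Nnorm 3 c0 (u 2) t ≤ K := hKt
    have hsq : (jb t ^ (-δ) * Nnorm 3 1 (u 0) t) ^ 2 + Nnorm 3 1 (u 1) t ^ 2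
        + Nnorm 3 c0 (u 2) t ^ 2 ≤ K ^ 2 := by
      refine le_trans ?_ (pow_le_pow_left₀ (by positivity) hKt' 2)
      nlinarith [mul_nonneg hN0 hN1, mul_nonneg hN0 hN2, mul_nonneg hN1 hN2]
    have hBK : K ^ 2 ≤ B ^ 2 * K ^ 2 := by
      have : 1 ≤ B ^ 2 := one_le_pow₀ hB1.le
      nlinarith [sq_nonneg K]
    have hD : 1 ≤ 3 + 32 * C + 8 * C / δ + 2 * C ^ 2 / δ ^ 2 := by
      have h8 : 0 ≤ 8 * C / δ := by positivity
      have h9 : 0 ≤ 2 * C ^ 2 / δ ^ 2 := by positivity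
      linarith
    calc _ ≤ 1 * (I + B * (H1 + H2) * K + B ^ 2 * K ^ 2) := by linarith
      _ ≤ _ := mul_le_mul_of_nonneg_right hD (by positivity)

end MultiSpeedWave
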